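/- If a commutative square in Fun(BG, C*Cat^nu) with top arrow A → B and bottom arrow C → D is excisive and moreover B and D are unital, then the induced square with corners A⋊G, B⋊G, C⋊G, and D⋊G is an excisive square in C*Cat^nu. -/

import Mathlib

noncomputable section

open scoped ENNReal

/-- A possibly non-unital ℂ-linear ∗-category. -/
structure StarCatNu : Type 1 where
  Obj : Type
  Hom : Obj → Obj → Type
  [homAddCommGroup : ∀ X Y, AddCommGroup (Hom X Y)]
  [homModule : ∀ X Y, Module ℂ (Hom X Y)]
  comp : ∀ {X Y Z : Obj}, Hom Y Z → Hom X Y → Hom X Z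
  star : ∀ {X Y : Obj}, Hom X Y → Hom Y X
  comp_assoc : ∀ {W X Y Z : Obj} (h : Hom Y Z) (g : Hom X Y) (f : Hom W X),
    comp (comp h g) f = comp h (comp g f)
  add_comp : ∀ {X Y Z : Obj} (g g' : Hom Y Z) (f : Hom X Y),
    comp (g + g') f = comp g f + comp g' f
  comp_add : ∀ {X Y Z : Obj} (g : Hom Y Z) (f f' : Hom X Y),
    comp g (f + f') = comp g f + comp g f'
  smul_comp : ∀ {X Y Z : Obj} (c : ℂ) (g : Hom Y Z) (f : Hom X Y),
    comp (c • g) f = c • comp g f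
  comp_smul : ∀ {X Y Z : Obj} (c : ℂ) (g : Hom Y Z) (f : Hom X Y),
    comp g (c • f) = c • comp g f
  star_star : ∀ {X Y : Obj} (f : Hom X Y), star (star f) = f
  star_comp : ∀ {X Y Z : Obj} (g : Hom Y Z) (f : Hom X Y),
    star (comp g f) = comp (star f) (star g)
  star_add : ∀ {X Y : Obj} (f f' : Hom X Y), star (f + f') = star f + star f'
  star_smul : ∀ {X Y : Obj} (c : ℂ) (f : Hom X Y),
    star (c • f) = (starRingEnd ℂ) c • star f

attribute [instance] StarCatNu.homAddCommGroup StarCatNu.homModule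

namespace StarCatNu

/-- Transport of morphisms along equalities of objects. -/
def castHom (C : StarCatNu) {X X' Y Y' : C.Obj} (hX : X = X') (hY : Y = Y')
    (f : C.Hom X Y) : C.Hom X' Y' := hX ▸ hY ▸ f

theorem comp_zero (C : StarCatNu) {X Y Z : C.Obj} (g : C.Hom Y Z) :
    C.comp g (0 : C.Hom X Y) = 0 :=
  (AddMonoidHom.mk' (fun f : C.Hom X Y => C.comp g f) (C.comp_add g)).map_zero

theorem zero_comp (C : StarCatNu) {X Y Z : C.Obj} (f : C.Hom X Y) :
    C.comp (0 : C.Hom Y Z) f = 0 :=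
  (AddMonoidHom.mk' (fun g : C.Hom Y Z => C.comp g f) (fun a b => C.add_comp a b f)).map_zero

theorem star_zero' (C : StarCatNu) {X Y : C.Obj} :
    C.star (0 : C.Hom X Y) = 0 :=
  (AddMonoidHom.mk' (fun f : C.Hom X Y => C.star f) C.star_add).map_zero

end StarCatNu

/-- A (not necessarily unit-preserving) functor between possibly non-unital ℂ-linear
∗-categories, compatible with the enrichment and the involutions. -/
structure StarFunctor (C D : StarCatNu) where
  obj : C.Obj → D.Obj
  map : ∀ {X Y : C.Obj}, C.Hom X Y → D.Hom (obj X) (obj Y)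
  map_add : ∀ (X Y : C.Obj) (f f' : C.Hom X Y), map (f + f') = map f + map f'
  map_smul : ∀ (X Y : C.Obj) (c : ℂ) (f : C.Hom X Y), map (c • f) = c • map f
  map_comp : ∀ (X Y Z : C.Obj) (g : C.Hom Y Z) (f : C.Hom X Y),
    map (C.comp g f) = D.comp (map g) (map f)
  map_star : ∀ (X Y : C.Obj) (f : C.Hom X Y), map (C.star f) = D.star (map f)

namespace StarFunctor

theorem map_zero {C D : StarCatNu} (F : StarFunctor C D) (X Y : C.Obj) :
    F.map (0 : C.Hom X Y) = 0 :=
  (AddMonoidHom.mk' (fun f : C.Hom X Y => F.map f) (F.map_add X Y)).map_zero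

/-- The identity functor. -/
def id (C : StarCatNu) : StarFunctor C C where
  obj X := X
  map f := f
  map_add _ _ _ _ := rfl
  map_smul _ _ _ _ := rfl
  map_comp _ _ _ _ _ := rfl
  map_star _ _ _ := rfl

/-- Composition of functors: first `F`, then `G`. -/
def comp {C D E : StarCatNu} (F : StarFunctor C D) (G : StarFunctor D E) :
    StarFunctor C E where
  obj X := G.obj (F.obj X)
  map f := G.map (F.map f)
  map_add X Y f f' := by
    show G.map (F.map (f + f')) = G.map (F.map f) + G.map (F.map f')
    rw [F.map_add, G.map_add]
  map_smul X Y c f := by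
    show G.map (F.map (c • f)) = c • G.map (F.map f)
    rw [F.map_smul, G.map_smul]
  map_comp X Y Z g f := by
    show G.map (F.map (C.comp g f)) = E.comp (G.map (F.map g)) (G.map (F.map f))
    rw [F.map_comp, G.map_comp]
  map_star X Y f := by
    show G.map (F.map (C.star f)) = E.star (G.map (F.map f))
    rw [F.map_star, G.map_star]

end StarFunctor

instance : CategoryTheory.Category StarCatNu where
  Hom := StarFunctor
  id := StarFunctor.id
  comp := StarFunctor.comp
  id_comp := by intros; rfl
  comp_id := by intros; rfl
  assoc := by intros; rfl
/-- A possibly non-unital ∗-algebra over ℂ regarded as a ℂ-linear ∗-category with a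
single object. -/
def StarCatNu.ofAlgebra (B : Type) [NonUnitalRing B] [Module ℂ B]
    [SMulCommClass ℂ B B] [IsScalarTower ℂ B B] [StarRing B] [StarModule ℂ B] :
    StarCatNu where
  Obj := PUnit
  Hom _ _ := B
  comp g f := g * f
  star b := Star.star b
  comp_assoc h g f := mul_assoc h g f
  add_comp g g' f := add_mul g g' f
  comp_add g f f' := mul_add g f f'
  smul_comp c g f := smul_mul_assoc c g f
  comp_smul c g f := mul_smul_comm c g f
  star_star f := InvolutiveStar.star_involutive f
  star_comp g f := StarMul.star_mul g f
  star_add f f' := StarAddMonoid.star_add f f'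
  star_smul c f := by
    show Star.star (c • f) = (starRingEnd ℂ) c • Star.star f
    rw [StarModule.star_smul, starRingEnd_apply]

/-- The maximal semi-norm of a morphism in a possibly non-unital ℂ-linear ∗-category:
the supremum of `‖ρ f‖` over all morphisms `ρ` into C*-algebras regarded as one-object
ℂ-linear ∗-categories. -/
noncomputable def StarCatNu.repNorm (C : StarCatNu) {X Y : C.Obj} (f : C.Hom X Y)
    (B : Type) [NonUnitalCStarAlgebra B] (ρ : StarFunctor C (StarCatNu.ofAlgebra B)) : ℝ≥0∞ :=
  (‖id (α := B) (ρ.map f)‖₊ : ℝ≥0∞)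

noncomputable def StarCatNu.maxNorm (C : StarCatNu) {X Y : C.Obj} (f : C.Hom X Y) : ℝ≥0∞ :=
  sSup { r : ℝ≥0∞ | ∃ (B : Type) (i : NonUnitalCStarAlgebra B)
    (ρ : StarFunctor C (StarCatNu.ofAlgebra B)), r = @StarCatNu.repNorm C X Y f B i ρ }

/-- A pre-C*-category: all morphisms have finite maximal semi-norm. -/
def IsPreCStar (C : StarCatNu) : Prop :=
  ∀ (X Y : C.Obj) (f : C.Hom X Y), C.maxNorm f < ⊤

/-- A C*-category: the maximal semi-norm is a finite norm and the morphism spaces are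
complete with respect to it (completeness is expressed via Cauchy sequences). -/
def IsCStar (C : StarCatNu) : Prop :=
  IsPreCStar C ∧
  (∀ (X Y : C.Obj) (f : C.Hom X Y), C.maxNorm f = 0 → f = 0) ∧
  (∀ (X Y : C.Obj) (u : ℕ → C.Hom X Y),
    (∀ ε : ℝ≥0∞, 0 < ε → ∃ N, ∀ m ≥ N, ∀ n ≥ N, C.maxNorm (u m - u n) < ε) →
    ∃ f : C.Hom X Y, ∀ ε : ℝ≥0∞, 0 < ε → ∃ N, ∀ n ≥ N, C.maxNorm (u n - f) < ε)

/-- `e` is an identity morphism at its object. -/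
def IsIdentityAt (C : StarCatNu) {X : C.Obj} (e : C.Hom X X) : Prop :=
  (∀ (Y : C.Obj) (f : C.Hom X Y), C.comp f e = f) ∧
  (∀ (Y : C.Obj) (g : C.Hom Y X), C.comp e g = g)

/-- A ℂ-linear ∗-category is unital if every object admits an identity morphism. -/
def StarCatNu.IsUnital (C : StarCatNu) : Prop :=
  ∀ X : C.Obj, ∃ e : C.Hom X X, IsIdentityAt C e

/-- A functor is unital if it sends identity morphisms to identity morphisms. -/
def StarFunctor.Unital {C D : StarCatNu} (F : StarFunctor C D) : Prop :=
  ∀ (X : C.Obj) (e : C.Hom X X), IsIdentityAt C e → IsIdentityAt D (F.map e)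

/-- A morphism `u` is unitary if `u* ∘ u` and `u ∘ u*` are identity morphisms. -/
def IsUnitary (D : StarCatNu) {A B : D.Obj} (u : D.Hom A B) : Prop :=
  IsIdentityAt D (D.comp (D.star u) u) ∧ IsIdentityAt D (D.comp u (D.star u))

/-- A unitary natural transformation between two functors. -/
structure UnitaryTrans {C D : StarCatNu} (F G : StarFunctor C D) where
  app : ∀ X : C.Obj, D.Hom (F.obj X) (G.obj X)
  natural : ∀ (X Y : C.Obj) (f : C.Hom X Y),
    D.comp (app Y) (F.map f) = D.comp (G.map f) (app X)
  unitary : ∀ X : C.Obj, IsUnitary D (app X)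

/-- A functor is a unitary equivalence if it is invertible up to unitary isomorphism. -/
def IsUnitaryEquiv {C D : StarCatNu} (F : StarFunctor C D) : Prop :=
  ∃ H : StarFunctor D C,
    Nonempty (UnitaryTrans (F.comp H) (StarFunctor.id C)) ∧
    Nonempty (UnitaryTrans (H.comp F) (StarFunctor.id D))

/-- A quotient morphism: bijective on objects and surjective on all morphism spaces. -/
def IsQuotientHom {C D : StarCatNu} (F : StarFunctor C D) : Prop :=
  Function.Bijective F.obj ∧
  ∀ (X Y : C.Obj), Function.Surjective (fun f : C.Hom X Y => F.map f)

/-- An exact sequence `0 → C → D → Q → 0`: `p` is a quotient morphism and `i` is the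
inclusion of its kernel. -/
structure IsExactSeq {C D Q : StarCatNu} (i : StarFunctor C D) (p : StarFunctor D Q) : Prop where
  i_obj_bij : Function.Bijective i.obj
  i_map_inj : ∀ (X Y : C.Obj), Function.Injective (fun f : C.Hom X Y => i.map f)
  p_quot : IsQuotientHom p
  exact : ∀ (X Y : C.Obj) (f : D.Hom (i.obj X) (i.obj Y)),
    p.map f = 0 ↔ ∃ g : C.Hom X Y, i.map g = f

/-- `ι : C → Cc` exhibits the C*-category `Cc` as the completion of the pre-C*-category `C`
with respect to the maximal semi-norm. -/
structure IsCompletion (C Cc : StarCatNu) (ι : StarFunctor C Cc) : Prop where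
  pre : IsPreCStar C
  cstar : IsCStar Cc
  obj_bij : Function.Bijective ι.obj
  isometric : ∀ (X Y : C.Obj) (f : C.Hom X Y), Cc.maxNorm (ι.map f) = C.maxNorm f
  dense : ∀ (X Y : C.Obj) (h : Cc.Hom (ι.obj X) (ι.obj Y)) (ε : ℝ≥0∞), 0 < ε →
    ∃ f : C.Hom X Y, Cc.maxNorm (h - ι.map f) < ε
/-- An action of a group `G` on a possibly non-unital ℂ-linear ∗-category `C` by
automorphisms (an object of `Fun(BG, ∗Cat^nu_ℂ)`). -/
structure GAction (G : Type) [Group G] (C : StarCatNu) where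
  actObj : G → C.Obj → C.Obj
  actMap : ∀ (g : G) {X Y : C.Obj}, C.Hom X Y → C.Hom (actObj g X) (actObj g Y)
  one_obj : ∀ X : C.Obj, actObj 1 X = X
  mul_obj : ∀ (g h : G) (X : C.Obj), actObj g (actObj h X) = actObj (g * h) X
  one_map : ∀ (X Y : C.Obj) (f : C.Hom X Y),
    C.castHom (one_obj X) (one_obj Y) (actMap 1 f) = f
  mul_map : ∀ (g h : G) (X Y : C.Obj) (f : C.Hom X Y),
    C.castHom (mul_obj g h X) (mul_obj g h Y) (actMap g (actMap h f)) = actMap (g * h) f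
  map_add : ∀ (g : G) (X Y : C.Obj) (f f' : C.Hom X Y),
    actMap g (f + f') = actMap g f + actMap g f'
  map_smul : ∀ (g : G) (X Y : C.Obj) (c : ℂ) (f : C.Hom X Y),
    actMap g (c • f) = c • actMap g f
  map_comp : ∀ (g : G) (X Y Z : C.Obj) (u : C.Hom Y Z) (f : C.Hom X Y),
    actMap g (C.comp u f) = C.comp (actMap g u) (actMap g f)
  map_star : ∀ (g : G) (X Y : C.Obj) (f : C.Hom X Y),
    actMap g (C.star f) = C.star (actMap g f)

namespace GAction

variable {G : Type} [Group G] {C : StarCatNu}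

/-- The automorphism of `C` given by the action of `g`. -/
def functor (α : GAction G C) (g : G) : StarFunctor C C where
  obj := α.actObj g
  map := α.actMap g
  map_add := α.map_add g
  map_smul := α.map_smul g
  map_comp := α.map_comp g
  map_star := α.map_star g

theorem inv_mul_obj (α : GAction G C) (g g' : G) (Z : C.Obj) :
    α.actObj g⁻¹ (α.actObj g'⁻¹ Z) = α.actObj (g' * g)⁻¹ Z := by
  rw [α.mul_obj, mul_inv_rev]

theorem cancel_obj (α : GAction G C) (g : G) (Y : C.Obj) :
    α.actObj g (α.actObj g⁻¹ Y) = Y := by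
  rw [α.mul_obj, mul_inv_cancel, α.one_obj]

theorem inv_inv_obj (α : GAction G C) (g : G) (X : C.Obj) :
    α.actObj g⁻¹⁻¹ X = α.actObj g X := by rw [inv_inv]

theorem one_inv_obj (α : GAction G C) (Y : C.Obj) :
    α.actObj (1 : G)⁻¹ Y = Y := by rw [inv_one, α.one_obj]

theorem lc_obj (α : GAction G C) (a b : G) (Y : C.Obj) :
    α.actObj a⁻¹ Y = α.actObj (b⁻¹ * a)⁻¹ (α.actObj b⁻¹ Y) := by
  rw [α.mul_obj]
  congr 1
  group

end GAction

/-- `CG` together with the data `obj`, `ins` is a realization of the algebraic crossed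
product `C ⋊^alg G`: its objects are those of `C`, its morphism spaces are the direct sums
`⊕_{g ∈ G} Hom_C(X, g⁻¹Y)` (the element of the `g`-th summand corresponding to `f` being
`ins g f`, i.e. `(f, g)`), with composition `(f', g') ∘ (f, g) = (g⁻¹f' ∘ f, g'g)` and
involution `(f, g)* = (g f*, g⁻¹)`. -/
structure IsCrossedProductAlg (G : Type) [Group G] (C : StarCatNu) (α : GAction G C)
    (CG : StarCatNu) where
  obj : C.Obj → CG.Obj
  obj_bij : Function.Bijective obj
  ins : ∀ (g : G) {X Y : C.Obj}, C.Hom X (α.actObj g⁻¹ Y) → CG.Hom (obj X) (obj Y)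
  ins_add : ∀ (g : G) (X Y : C.Obj) (f f' : C.Hom X (α.actObj g⁻¹ Y)),
    ins g (f + f') = ins g f + ins g f'
  ins_smul : ∀ (g : G) (X Y : C.Obj) (c : ℂ) (f : C.Hom X (α.actObj g⁻¹ Y)),
    ins g (c • f) = c • ins g f
  ins_comp : ∀ (g g' : G) (X Y Z : C.Obj)
    (f : C.Hom X (α.actObj g⁻¹ Y)) (f' : C.Hom Y (α.actObj g'⁻¹ Z)),
    CG.comp (ins g' f') (ins g f) =
      ins (g' * g) (C.castHom rfl (α.inv_mul_obj g g' Z)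
        (C.comp (α.actMap g⁻¹ f') f))
  ins_star : ∀ (g : G) (X Y : C.Obj) (f : C.Hom X (α.actObj g⁻¹ Y)),
    CG.star (ins g f) =
      ins g⁻¹ (C.castHom (α.cancel_obj g Y) (α.inv_inv_obj g X).symm
        (α.actMap g (C.star f)))
  span : ∀ (X Y : C.Obj) (u : CG.Hom (obj X) (obj Y)),
    ∃ (s : Finset G) (φ : ∀ g : G, C.Hom X (α.actObj g⁻¹ Y)),
      u = s.sum fun g => ins g (φ g)
  indep : ∀ (X Y : C.Obj) (s : Finset G) (φ : ∀ g : G, C.Hom X (α.actObj g⁻¹ Y)),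
    (s.sum fun g => ins g (φ g)) = 0 → ∀ g ∈ s, φ g = 0

/-- A (strictly) equivariant morphism between ℂ-linear ∗-categories with `G`-action,
i.e. a morphism in `Fun(BG, ∗Cat^nu_ℂ)`. -/
structure EquivariantMap {G : Type} [Group G] {C D : StarCatNu}
    (α : GAction G C) (β : GAction G D) (φ : StarFunctor C D) : Prop where
  obj_comm : ∀ (g : G) (X : C.Obj), φ.obj (α.actObj g X) = β.actObj g (φ.obj X)
  map_comm : ∀ (g : G) (X Y : C.Obj) (f : C.Hom X Y),
    D.castHom (obj_comm g X) (obj_comm g Y) (φ.map (α.actMap g f)) =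
      β.actMap g (φ.map f)

/-- The morphism `φ ⋊^alg G : C ⋊^alg G → D ⋊^alg G` induced by an equivariant morphism
`φ : C → D`: it acts like `φ` on objects and sends `(f, g)` to `(φ(f), g)`. -/
structure IsCrossedMap {G : Type} [Group G] {C D : StarCatNu}
    (α : GAction G C) (β : GAction G D) (φ : StarFunctor C D)
    (hφ : EquivariantMap α β φ) {CG DG : StarCatNu}
    (hC : IsCrossedProductAlg G C α CG) (hD : IsCrossedProductAlg G D β DG)
    (ψ : StarFunctor CG DG) : Prop where
  obj_eq : ∀ X : C.Obj, ψ.obj (hC.obj X) = hD.obj (φ.obj X)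
  map_eq : ∀ (g : G) (X Y : C.Obj) (f : C.Hom X (α.actObj g⁻¹ Y)),
    DG.castHom (obj_eq X) (obj_eq Y) (ψ.map (hC.ins g f)) =
      hD.ins g (D.castHom rfl (hφ.obj_comm g⁻¹ Y) (φ.map f))

/-- The morphism `φ ⋊ G : C ⋊ G → D ⋊ G` of completed crossed products induced by an
equivariant morphism `φ : C → D` of C*-categories with `G`-action. -/
structure IsCrossedMapC {G : Type} [Group G] {C D : StarCatNu}
    (α : GAction G C) (β : GAction G D) (φ : StarFunctor C D)
    (hφ : EquivariantMap α β φ) {CG DG CGc DGc : StarCatNu}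
    (hC : IsCrossedProductAlg G C α CG) (hD : IsCrossedProductAlg G D β DG)
    (κC : StarFunctor CG CGc) (κD : StarFunctor DG DGc)
    (ψ : StarFunctor CGc DGc) : Prop where
  obj_eq : ∀ X : C.Obj, ψ.obj (κC.obj (hC.obj X)) = κD.obj (hD.obj (φ.obj X))
  map_eq : ∀ (g : G) (X Y : C.Obj) (f : C.Hom X (α.actObj g⁻¹ Y)),
    DGc.castHom (obj_eq X) (obj_eq Y) (ψ.map (κC.map (hC.ins g f))) =
      κD.map (hD.ins g (D.castHom rfl (hφ.obj_comm g⁻¹ Y) (φ.map f)))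

/-- An excisive square of (possibly non-unital) C*-categories
```
A --i₁--> B
|         |
v₁        v₂
|         |
v         v
C --i₂--> D
```
the horizontal morphisms are inclusions of (closed) ideals — expressed as kernels of
quotient morphisms onto C*-categories — the quotients `B/A` and `D/C` are unital, and the
induced morphism `B/A → D/C` is unital and a unitary equivalence. -/
structure IsExcisive {A B C D : StarCatNu}
    (i₁ : StarFunctor A B) (v₁ : StarFunctor A C)
    (v₂ : StarFunctor B D) (i₂ : StarFunctor C D) : Prop where
  comm : i₁.comp v₂ = v₁.comp i₂
  exB : ∃ (QB : StarCatNu) (qB : StarFunctor B QB), IsCStar QB ∧ IsExactSeq i₁ qB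
  exD : ∃ (QD : StarCatNu) (qD : StarFunctor D QD), IsCStar QD ∧ IsExactSeq i₂ qD
  quot : ∀ (QB QD : StarCatNu) (qB : StarFunctor B QB) (qD : StarFunctor D QD)
    (r : StarFunctor QB QD), IsCStar QB → IsCStar QD →
    IsExactSeq i₁ qB → IsExactSeq i₂ qD →
    v₂.comp qD = qB.comp r →
    (QB.IsUnital ∧ QD.IsUnital ∧ r.Unital ∧ IsUnitaryEquiv r)


/-! ### Elementary facts about ∗-categories and their representations -/

namespace StarCatNu

theorem neg_comp (C : StarCatNu) {X Y Z : C.Obj} (g : C.Hom Y Z) (f : C.Hom X Y) :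
    C.comp (-g) f = - C.comp g f :=
  (AddMonoidHom.mk' (fun g : C.Hom Y Z => C.comp g f) (fun a b => C.add_comp a b f)).map_neg g

theorem comp_neg (C : StarCatNu) {X Y Z : C.Obj} (g : C.Hom Y Z) (f : C.Hom X Y) :
    C.comp g (-f) = - C.comp g f :=
  (AddMonoidHom.mk' (fun f : C.Hom X Y => C.comp g f) (C.comp_add g)).map_neg f

theorem sub_comp (C : StarCatNu) {X Y Z : C.Obj} (g g' : C.Hom Y Z) (f : C.Hom X Y) :
    C.comp (g - g') f = C.comp g f - C.comp g' f :=
  (AddMonoidHom.mk' (fun g : C.Hom Y Z => C.comp g f) (fun a b => C.add_comp a b f)).map_sub g g'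

theorem comp_sub (C : StarCatNu) {X Y Z : C.Obj} (g : C.Hom Y Z) (f f' : C.Hom X Y) :
    C.comp g (f - f') = C.comp g f - C.comp g f' :=
  (AddMonoidHom.mk' (fun f : C.Hom X Y => C.comp g f) (C.comp_add g)).map_sub f f'

theorem star_neg (C : StarCatNu) {X Y : C.Obj} (f : C.Hom X Y) :
    C.star (-f) = - C.star f :=
  (AddMonoidHom.mk' (fun f : C.Hom X Y => C.star f) C.star_add).map_neg f

theorem star_sub (C : StarCatNu) {X Y : C.Obj} (f f' : C.Hom X Y) :
    C.star (f - f') = C.star f - C.star f' :=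
  (AddMonoidHom.mk' (fun f : C.Hom X Y => C.star f) C.star_add).map_sub f f'

end StarCatNu

namespace StarFunctor

theorem map_neg {C D : StarCatNu} (F : StarFunctor C D) {X Y : C.Obj} (f : C.Hom X Y) :
    F.map (-f) = - F.map f :=
  (AddMonoidHom.mk' (fun f : C.Hom X Y => F.map f) (F.map_add X Y)).map_neg f

theorem map_sub {C D : StarCatNu} (F : StarFunctor C D) {X Y : C.Obj} (f f' : C.Hom X Y) :
    F.map (f - f') = F.map f - F.map f' :=
  (AddMonoidHom.mk' (fun f : C.Hom X Y => F.map f) (F.map_add X Y)).map_sub f f'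

/-- A functor as a linear map on morphism spaces. -/
def mapLin {C D : StarCatNu} (F : StarFunctor C D) (X Y : C.Obj) :
    C.Hom X Y →ₗ[ℂ] D.Hom (F.obj X) (F.obj Y) where
  toFun f := F.map f
  map_add' := F.map_add X Y
  map_smul' := F.map_smul X Y

@[simp] theorem mapLin_apply {C D : StarCatNu} (F : StarFunctor C D) {X Y : C.Obj}
    (f : C.Hom X Y) : F.mapLin X Y f = F.map f := rfl

variable {C : StarCatNu} {U : Type} [NonUnitalCStarAlgebra U]

/-- The value of a representation, as an element of the algebra. -/
def ev (ρ : StarFunctor C (StarCatNu.ofAlgebra U)) {X Y : C.Obj} (f : C.Hom X Y) : U := ρ.map f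

theorem ev_add (ρ : StarFunctor C (StarCatNu.ofAlgebra U)) {X Y : C.Obj} (f f' : C.Hom X Y) :
    ρ.ev (f + f') = ρ.ev f + ρ.ev f' := ρ.map_add X Y f f'
theorem ev_smul (ρ : StarFunctor C (StarCatNu.ofAlgebra U)) {X Y : C.Obj} (c : ℂ)
    (f : C.Hom X Y) : ρ.ev (c • f) = c • ρ.ev f := ρ.map_smul X Y c f
theorem ev_comp (ρ : StarFunctor C (StarCatNu.ofAlgebra U)) {X Y Z : C.Obj} (g : C.Hom Y Z)
    (f : C.Hom X Y) : ρ.ev (C.comp g f) = ρ.ev g * ρ.ev f := ρ.map_comp X Y Z g f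
theorem ev_star (ρ : StarFunctor C (StarCatNu.ofAlgebra U)) {X Y : C.Obj} (f : C.Hom X Y) :
    ρ.ev (C.star f) = star (ρ.ev f) := ρ.map_star X Y f
theorem ev_zero (ρ : StarFunctor C (StarCatNu.ofAlgebra U)) {X Y : C.Obj} :
    ρ.ev (0 : C.Hom X Y) = 0 := ρ.map_zero X Y
theorem ev_neg (ρ : StarFunctor C (StarCatNu.ofAlgebra U)) {X Y : C.Obj} (f : C.Hom X Y) :
    ρ.ev (-f) = - ρ.ev f := ρ.map_neg f
theorem ev_sub (ρ : StarFunctor C (StarCatNu.ofAlgebra U)) {X Y : C.Obj} (f f' : C.Hom X Y) :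
    ρ.ev (f - f') = ρ.ev f - ρ.ev f' := ρ.map_sub f f'

/-- A representation as a linear map. -/
def evLin (ρ : StarFunctor C (StarCatNu.ofAlgebra U)) (X Y : C.Obj) : C.Hom X Y →ₗ[ℂ] U where
  toFun f := ρ.ev f
  map_add' := ρ.ev_add
  map_smul' := ρ.ev_smul

end StarFunctor

namespace StarCatNu
open StarFunctor
variable {C D : StarCatNu}

/-- Constructor for representations. -/
def mkRep (C : StarCatNu) (U : Type) [NonUnitalCStarAlgebra U]
    (m : ∀ (X Y : C.Obj), C.Hom X Y → U)
    (h_add : ∀ (X Y : C.Obj) (f f' : C.Hom X Y), m X Y (f + f') = m X Y f + m X Y f')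
    (h_smul : ∀ (X Y : C.Obj) (c : ℂ) (f : C.Hom X Y), m X Y (c • f) = c • m X Y f)
    (h_comp : ∀ (X Y Z : C.Obj) (g : C.Hom Y Z) (f : C.Hom X Y),
      m X Z (C.comp g f) = m Y Z g * m X Y f)
    (h_star : ∀ (X Y : C.Obj) (f : C.Hom X Y), m Y X (C.star f) = Star.star (m X Y f)) :
    StarFunctor C (StarCatNu.ofAlgebra U) where
  obj _ := PUnit.unit
  map f := m _ _ f
  map_add := h_add
  map_smul := h_smul
  map_comp := h_comp
  map_star := h_star

theorem mkRep_ev (C : StarCatNu) (U : Type) [NonUnitalCStarAlgebra U]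
    (m : ∀ (X Y : C.Obj), C.Hom X Y → U) (h1) (h2) (h3) (h4) {X Y : C.Obj} (f : C.Hom X Y) :
    (mkRep C U m h1 h2 h3 h4).ev f = m X Y f := rfl

theorem ev_le_maxNorm {U : Type} [NonUnitalCStarAlgebra U]
    (ρ : StarFunctor C (StarCatNu.ofAlgebra U)) {X Y : C.Obj} (f : C.Hom X Y) :
    ‖ρ.ev f‖ₑ ≤ C.maxNorm f :=
  le_sSup ⟨U, inferInstance, ρ, rfl⟩

theorem maxNorm_le {X Y : C.Obj} {f : C.Hom X Y} {c : ℝ≥0∞}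
    (h : ∀ (U : Type) [NonUnitalCStarAlgebra U] (ρ : StarFunctor C (StarCatNu.ofAlgebra U)),
      ‖ρ.ev f‖ₑ ≤ c) : C.maxNorm f ≤ c := by
  apply sSup_le
  rintro r ⟨U, i, ρ, rfl⟩
  exact h U ρ

theorem exists_of_lt_maxNorm {X Y : C.Obj} {f : C.Hom X Y} {c : ℝ≥0∞} (h : c < C.maxNorm f) :
    ∃ (U : Type) (_ : NonUnitalCStarAlgebra U) (ρ : StarFunctor C (StarCatNu.ofAlgebra U)),
      c < ‖ρ.ev f‖ₑ := by
  obtain ⟨r, ⟨U, i, ρ, rfl⟩, hr⟩ := lt_sSup_iff.1 h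
  exact ⟨U, i, ρ, hr⟩

theorem maxNorm_zero {X Y : C.Obj} : C.maxNorm (0 : C.Hom X Y) = 0 := by
  apply le_antisymm _ bot_le
  apply maxNorm_le
  intro U _ ρ
  simp [ev_zero]

theorem maxNorm_add_le {X Y : C.Obj} (f g : C.Hom X Y) :
    C.maxNorm (f + g) ≤ C.maxNorm f + C.maxNorm g := by
  apply maxNorm_le
  intro U _ ρ
  rw [ev_add]
  exact (enorm_add_le _ _).trans (add_le_add (ev_le_maxNorm ρ f) (ev_le_maxNorm ρ g))

theorem maxNorm_neg {X Y : C.Obj} (f : C.Hom X Y) : C.maxNorm (-f) = C.maxNorm f := by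
  have key : ∀ f : C.Hom X Y, C.maxNorm (-f) ≤ C.maxNorm f := by
    intro f
    apply maxNorm_le
    intro U _ ρ
    rw [ev_neg, enorm_neg]
    exact ev_le_maxNorm ρ f
  apply le_antisymm (key f)
  simpa using key (-f)

theorem maxNorm_sub_le {X Y : C.Obj} (f g : C.Hom X Y) :
    C.maxNorm (f - g) ≤ C.maxNorm f + C.maxNorm g := by
  rw [sub_eq_add_neg, ← maxNorm_neg g]
  exact maxNorm_add_le _ _

theorem maxNorm_smul_le {X Y : C.Obj} (c : ℂ) (f : C.Hom X Y) :
    C.maxNorm (c • f) ≤ ‖c‖ₑ * C.maxNorm f := by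
  apply maxNorm_le
  intro U _ ρ
  rw [ev_smul, enorm_smul]
  gcongr
  exact ev_le_maxNorm ρ f

theorem maxNorm_star {X Y : C.Obj} (f : C.Hom X Y) : C.maxNorm (C.star f) = C.maxNorm f := by
  have key : ∀ {X Y : C.Obj} (f : C.Hom X Y), C.maxNorm (C.star f) ≤ C.maxNorm f := by
    intro X Y f
    apply maxNorm_le
    intro U _ ρ
    rw [ev_star]
    have : ‖Star.star (ρ.ev f)‖ₑ = ‖ρ.ev f‖ₑ := by
      rw [← ofReal_norm, norm_star, ofReal_norm]
    rw [this]
    exact ev_le_maxNorm ρ f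
  apply le_antisymm (key f)
  simpa [C.star_star] using key (C.star f)

theorem maxNorm_comp_le {X Y Z : C.Obj} (g : C.Hom Y Z) (f : C.Hom X Y) :
    C.maxNorm (C.comp g f) ≤ C.maxNorm g * C.maxNorm f := by
  apply maxNorm_le
  intro U _ ρ
  rw [ev_comp]
  have : ‖ρ.ev g * ρ.ev f‖ₑ ≤ ‖ρ.ev g‖ₑ * ‖ρ.ev f‖ₑ := by
    simp only [enorm_eq_nnnorm]
    exact_mod_cast nnnorm_mul_le _ _
  exact this.trans (mul_le_mul' (ev_le_maxNorm ρ g) (ev_le_maxNorm ρ f))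

theorem maxNorm_star_comp_self {X Y : C.Obj} (f : C.Hom X Y) :
    C.maxNorm f * C.maxNorm f ≤ C.maxNorm (C.comp (C.star f) f) := by
  by_contra hlt
  push Not at hlt
  rw [← pow_two] at hlt
  have h2 : C.maxNorm (C.comp (C.star f) f) ^ (1/2 : ℝ) < C.maxNorm f := by
    have := ENNReal.rpow_lt_rpow hlt (by norm_num : (0:ℝ) < 1/2)
    rwa [← ENNReal.rpow_natCast, ← ENNReal.rpow_mul, show ((2:ℕ):ℝ) * (1/2) = 1 by norm_num,
      ENNReal.rpow_one] at this
  obtain ⟨U, _, ρ, hρ⟩ := exists_of_lt_maxNorm h2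
  have h3 := ev_le_maxNorm ρ (C.comp (C.star f) f)
  rw [ev_comp, ev_star] at h3
  have h4 : ‖Star.star (ρ.ev f) * ρ.ev f‖ₑ = ‖ρ.ev f‖ₑ ^ 2 := by
    simp only [enorm_eq_nnnorm]
    rw [CStarRing.nnnorm_star_mul_self, pow_two]
    push_cast
    rfl
  rw [h4] at h3
  have h5 := ENNReal.rpow_le_rpow h3 (by norm_num : (0:ℝ) ≤ 1/2)
  rw [← ENNReal.rpow_natCast, ← ENNReal.rpow_mul, show ((2:ℕ):ℝ) * (1/2) = 1 by norm_num,
      ENNReal.rpow_one] at h5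
  exact absurd hρ (not_lt.2 h5)

theorem maxNorm_map_le (F : StarFunctor C D) {X Y : C.Obj} (f : C.Hom X Y) :
    D.maxNorm (F.map f) ≤ C.maxNorm f := by
  apply maxNorm_le
  intro U _ ρ
  exact ev_le_maxNorm (F.comp ρ) f

theorem maxNorm_castHom {X X' Y Y' : C.Obj} (hX : X = X') (hY : Y = Y') (f : C.Hom X Y) :
    C.maxNorm (C.castHom hX hY f) = C.maxNorm f := by
  subst hX hY; rfl

end StarCatNu

/-! ### The normed structure on morphism spaces of C*-categories -/

namespace IsCStar
open StarCatNu
variable {C : StarCatNu}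

theorem ne_top (h : IsCStar C) {X Y : C.Obj} (f : C.Hom X Y) : C.maxNorm f ≠ ⊤ := (h.1 X Y f).ne
/-- The additive group norm on morphisms. -/
def homAddGroupNorm (h : IsCStar C) (X Y : C.Obj) : AddGroupNorm (C.Hom X Y) where
  toFun f := (C.maxNorm f).toReal
  map_zero' := by simp [maxNorm_zero]
  add_le' f g := by
    rw [← ENNReal.toReal_add (h.ne_top f) (h.ne_top g)]
    exact ENNReal.toReal_mono (by simp [h.ne_top]) (maxNorm_add_le f g)
  neg' f := by rw [maxNorm_neg]
  eq_zero_of_map_eq_zero' f hf := by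
    apply h.2.1
    simpa [ENNReal.toReal_eq_zero_iff, h.ne_top] using hf

/-- The morphism spaces of a C*-category as normed groups. -/
@[reducible] def homNormed (h : IsCStar C) (X Y : C.Obj) : NormedAddCommGroup (C.Hom X Y) :=
  (h.homAddGroupNorm X Y).toNormedAddCommGroup

theorem norm_def (h : IsCStar C) {X Y : C.Obj} (f : C.Hom X Y) :
    letI := h.homNormed X Y
    ‖f‖ = (C.maxNorm f).toReal := rfl

theorem enorm_def (h : IsCStar C) {X Y : C.Obj} (f : C.Hom X Y) :
    letI := h.homNormed X Y
    ‖f‖ₑ = C.maxNorm f := by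
  let := h.homNormed X Y
  rw [← ofReal_norm, h.norm_def, ENNReal.ofReal_toReal (h.ne_top f)]

@[reducible] def homNormedSpace (h : IsCStar C) (X Y : C.Obj) :
    @NormedSpace ℂ (C.Hom X Y) _ (h.homNormed X Y).toSeminormedAddCommGroup :=
  letI := h.homNormed X Y
  { (C.homModule X Y) with
    norm_smul_le := fun c f => by
      rw [h.norm_def, h.norm_def]
      have := ENNReal.toReal_mono (by finiteness [h.ne_top f]) (maxNorm_smul_le c f)
      simpa [ENNReal.toReal_mul] using this }

theorem homComplete (h : IsCStar C) (X Y : C.Obj) :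
    @CompleteSpace (C.Hom X Y) (h.homNormed X Y).toUniformSpace := by
  let := h.homNormed X Y
  have key : ∀ x y : C.Hom X Y, edist x y = C.maxNorm (x - y) := by
    intro x y
    rw [edist_eq_enorm_sub, h.enorm_def]
  apply UniformSpace.complete_of_cauchySeq_tendsto
  intro u hu
  obtain ⟨f, hf⟩ := h.2.2 X Y u (by
    intro ε hε
    obtain ⟨N, hN⟩ := EMetric.cauchySeq_iff.1 hu ε hε
    exact ⟨N, fun m hm n hn => by rw [← key]; exact hN m hm n hn⟩)
  refine ⟨f, EMetric.tendsto_atTop.2 ?_⟩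
  intro ε hε
  obtain ⟨N, hN⟩ := hf ε hε
  exact ⟨N, fun n hn => by rw [key]; exact hN n hn⟩

end IsCStar

/-- The endomorphism algebra of an object with a unit in a C*-category. -/
def EndAlg (C : StarCatNu) (_h : IsCStar C) (X : C.Obj) (e : C.Hom X X)
    (_he : IsIdentityAt C e) : Type := C.Hom X X

namespace EndAlg
open StarCatNu
variable {C : StarCatNu} {h : IsCStar C} {X : C.Obj} {e : C.Hom X X} {he : IsIdentityAt C e}

theorem star_id (he : IsIdentityAt C e) : C.star e = e := by
  have h1 : C.comp e (C.star e) = C.star e := he.2 _ _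
  have h2 := congrArg C.star h1
  rw [C.star_comp, C.star_star] at h2
  rw [← h1]; exact h2

instance : Ring (EndAlg C h X e he) where
  __ := C.homAddCommGroup X X
  mul f g := C.comp f g
  one := e
  mul_assoc f g k := C.comp_assoc f g k
  one_mul f := he.2 _ f
  mul_one f := he.1 _ f
  left_distrib f g k := C.comp_add f g k
  right_distrib f g k := C.add_comp f g k
  zero_mul f := C.zero_comp f
  mul_zero f := C.comp_zero f

instance : StarRing (EndAlg C h X e he) where
  star f := C.star f
  star_involutive f := C.star_star f
  star_mul f g := C.star_comp f g
  star_add f g := C.star_add f g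

instance : Module ℂ (EndAlg C h X e he) := C.homModule X X

instance : Algebra ℂ (EndAlg C h X e he) :=
  Algebra.ofModule (fun c f g => C.smul_comp c f g) (fun c f g => C.comp_smul c f g)

instance : StarModule ℂ (EndAlg C h X e he) where
  star_smul c f := C.star_smul c f

instance : NormedRing (EndAlg C h X e he) where
  __ := (inferInstance : Ring (EndAlg C h X e he))
  __ := h.homNormed X X
  norm_mul_le f g := by
    have := ENNReal.toReal_mono (ENNReal.mul_ne_top (h.ne_top f) (h.ne_top g))
      (maxNorm_comp_le f g)
    rw [ENNReal.toReal_mul] at this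
    exact this

theorem norm_def (f : EndAlg C h X e he) : ‖f‖ = (C.maxNorm (X := X) (Y := X) f).toReal := rfl

instance : NormedAlgebra ℂ (EndAlg C h X e he) where
  norm_smul_le := (h.homNormedSpace X X).norm_smul_le

instance : CompleteSpace (EndAlg C h X e he) := h.homComplete X X

instance : CStarRing (EndAlg C h X e he) where
  norm_mul_self_le f := by
    have h1 : C.maxNorm f * C.maxNorm f ≤ C.maxNorm (C.comp (C.star f) f) :=
      maxNorm_star_comp_self f
    have := ENNReal.toReal_mono (h.ne_top _) h1
    rw [ENNReal.toReal_mul] at this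
    exact this

instance : CStarAlgebra (EndAlg C h X e he) where

/-- The element of the endomorphism algebra given by an endomorphism. -/
def mk (h : IsCStar C) (he : IsIdentityAt C e) (f : C.Hom X X) : EndAlg C h X e he := f

/-- If `x` is a self-adjoint endomorphism then `c • 1 - x` is of the form `γ* γ`
for `c ≥ ‖x‖`. -/
theorem exists_sqrt (h : IsCStar C) (he : IsIdentityAt C e) (x : C.Hom X X)
    (hx : C.star x = x) : ∃ (c : ℝ) (γ : C.Hom X X), 0 ≤ c ∧
      (c : ℂ) • e - x = C.comp (C.star γ) γ := by
  let := CStarAlgebra.spectralOrder (EndAlg C h X e he)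
  have := CStarAlgebra.spectralOrderedRing (EndAlg C h X e he)
  have hsa : IsSelfAdjoint (mk h he x) := hx
  have h1 := hsa.le_algebraMap_norm_self
  rw [← sub_nonneg, CStarAlgebra.nonneg_iff_eq_star_mul_self] at h1
  obtain ⟨γ, hγ⟩ := h1
  refine ⟨‖mk h he x‖, γ, norm_nonneg _, ?_⟩
  rw [Algebra.algebraMap_eq_smul_one] at hγ
  exact hγ

end EndAlg

/-! ### Separation: existence of positive functionals -/

theorem exists_pos_functional {M : Type} [NormedAddCommGroup M] [NormedSpace ℂ M]
    [StarAddMonoid M] [StarModule ℂ M] (S : Set M) (h0 : (0 : M) ∈ S)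
    (hadd : ∀ x ∈ S, ∀ y ∈ S, x + y ∈ S) (hsmul : ∀ (c : ℝ), 0 ≤ c → ∀ x ∈ S, (c : ℂ) • x ∈ S)
    (hskew : ∀ x : M, star x = -x → x ∈ S) (y : M) (hy : y ∉ closure S) :
    ∃ l : M →ₗ[ℂ] ℂ, (∀ x ∈ S, 0 ≤ (l x).re) ∧ (∀ x, l (star x) = (starRingEnd ℂ) (l x)) ∧
      (l y).re < 0 := by
  have hsmul' : ∀ (c : ℝ), 0 ≤ c → ∀ x ∈ S, c • x ∈ S := by
    intro c hc x hx
    have := hsmul c hc x hx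
    rwa [Complex.coe_smul] at this
  have hconv : Convex ℝ (closure S) := by
    apply Convex.closure
    intro x hx z hz a b ha hb _
    exact hadd _ (hsmul' a ha x hx) _ (hsmul' b hb z hz)
  obtain ⟨f, u, hfy, hfS⟩ := geometric_hahn_banach_point_closed hconv isClosed_closure hy
  have hu0 : u < 0 := by simpa using hfS 0 (subset_closure h0)
  have hpos : ∀ x ∈ S, 0 ≤ f x := by
    intro x hx
    by_contra hneg
    push Not at hneg
    have h1 := hfS ((u / f x) • x) (subset_closure (hsmul' _ (div_nonneg_of_nonpos hu0.le hneg.le) x hx))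
    rw [map_smul, smul_eq_mul, div_mul_cancel₀ _ hneg.ne] at h1
    exact lt_irrefl _ h1
  have hsk : ∀ x : M, star x = -x → f x = 0 := by
    intro x hx
    have h1 := hpos x (hskew x hx)
    have h2 := hpos (-x) (hskew (-x) (by simp [hx]))
    rw [map_neg] at h2
    linarith
  have hst : ∀ x : M, f (star x) = f x := by
    intro x
    have := hsk (star x - x) (by simp)
    rw [map_sub] at this
    linarith
  let l : M →ₗ[ℂ] ℂ := Module.Dual.extendRCLike (f : M →ₗ[ℝ] ℝ)
  have hl : ∀ x, l x = (f x : ℂ) - Complex.I * (f (Complex.I • x) : ℂ) := by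
    intro x
    exact Module.Dual.extendRCLike_apply (𝕜 := ℂ) (f : M →ₗ[ℝ] ℝ) x
  have hre : ∀ x, (l x).re = f x := by
    intro x; rw [hl]; simp
  refine ⟨l, ?_, ?_, ?_⟩
  · intro x hx; rw [hre]; exact hpos x hx
  · intro x
    rw [hl, hl]
    have h1 : f (Complex.I • star x) = - f (Complex.I • x) := by
      have : Complex.I • star x = - star (Complex.I • x) := by
        rw [star_smul]; simp
      rw [this, map_neg, hst]
    rw [h1, hst]
    simp
  · rw [hre]; linarith

/-! ### The GNS construction -/

section GNS

/-- Data for the GNS construction over a ∗-category. -/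
structure GNSData (E : StarCatNu) where
  X : E.Obj
  L : ∀ Z : E.Obj, Submodule ℂ (E.Hom X Z)
  L_comp : ∀ {Z W : E.Obj} (f : E.Hom Z W) (h : E.Hom X Z), h ∈ L Z → E.comp f h ∈ L W
  l : E.Hom X X →ₗ[ℂ] ℂ
  l_symm : ∀ (Z : E.Obj) (h k : E.Hom X Z), h ∈ L Z → k ∈ L Z →
    (starRingEnd ℂ) (l (E.comp (E.star k) h)) = l (E.comp (E.star h) k)
  l_pos : ∀ (Z : E.Obj) (h : E.Hom X Z), h ∈ L Z → 0 ≤ (l (E.comp (E.star h) h)).re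
  bdd : ∀ {Z W : E.Obj} (f : E.Hom Z W), ∃ K : ℝ, 0 ≤ K ∧ ∀ h : E.Hom X Z, h ∈ L Z →
    (l (E.comp (E.star (E.comp f h)) (E.comp f h))).re ≤ K * (l (E.comp (E.star h) h)).re

namespace GNSData
variable {E : StarCatNu} (d : GNSData E)

open Classical in
/-- The algebraic direct sum carrying the GNS form. -/
def Pre : Type := Π₀ Z : E.Obj, d.L Z

open Classical in
instance : AddCommGroup d.Pre := inferInstanceAs (AddCommGroup (Π₀ Z : E.Obj, d.L Z))
open Classical in
instance : Module ℂ d.Pre := inferInstanceAs (Module ℂ (Π₀ Z : E.Obj, d.L Z))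

/-- Coordinates. -/
def co (w : d.Pre) (Z : E.Obj) : d.L Z := (show Π₀ Z : E.Obj, d.L Z from w) Z

theorem co_add (w w' : d.Pre) (Z : E.Obj) : d.co (w + w') Z = d.co w Z + d.co w' Z := rfl
theorem co_smul (c : ℂ) (w : d.Pre) (Z : E.Obj) : d.co (c • w) Z = c • d.co w Z := rfl

/-- The form on a single summand. -/
def form (Z : E.Obj) (h k : d.L Z) : ℂ := d.l (E.comp (E.star h.1) k.1)

open Classical in
/-- The support of a vector. -/
def supp (w : d.Pre) : Finset E.Obj := DFinsupp.support (show Π₀ Z : E.Obj, d.L Z from w)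

theorem co_eq_zero (w : d.Pre) (Z : E.Obj) (h : Z ∉ d.supp w) : d.co w Z = 0 := by
  classical
  exact DFinsupp.notMem_support_iff.1 h

theorem form_zero_left (Z : E.Obj) (k : d.L Z) : d.form Z 0 k = 0 := by
  simp [form, E.star_zero', E.zero_comp]

theorem form_zero_right (Z : E.Obj) (k : d.L Z) : d.form Z k 0 = 0 := by
  simp [form, E.comp_zero]

open Classical in
/-- The inner product. -/
def ip (w w' : d.Pre) : ℂ := ∑ Z ∈ d.supp w ∪ d.supp w', d.form Z (d.co w Z) (d.co w' Z)

theorem ip_eq (w w' : d.Pre) (s : Finset E.Obj) (hs : d.supp w ⊆ s ∨ d.supp w' ⊆ s) :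
    d.ip w w' = ∑ Z ∈ s, d.form Z (d.co w Z) (d.co w' Z) := by
  classical
  have key : ∀ Z, (Z ∉ d.supp w ∨ Z ∉ d.supp w') → d.form Z (d.co w Z) (d.co w' Z) = 0 := by
    rintro Z (h | h)
    · rw [d.co_eq_zero w Z h, form_zero_left]
    · rw [d.co_eq_zero w' Z h, form_zero_right]
  unfold ip
  trans ∑ Z ∈ (d.supp w ∪ d.supp w') ∪ s, d.form Z (d.co w Z) (d.co w' Z)
  · apply Finset.sum_subset Finset.subset_union_left
    intro Z _ hZ
    apply key
    simp only [Finset.mem_union, not_or] at hZ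
    exact Or.inl hZ.1
  · symm
    apply Finset.sum_subset Finset.subset_union_right
    intro Z _ hZ
    apply key
    rcases hs with hs | hs
    · exact Or.inl (fun h => hZ (hs h))
    · exact Or.inr (fun h => hZ (hs h))

theorem form_add_left (Z : E.Obj) (h h' k : d.L Z) :
    d.form Z (h + h') k = d.form Z h k + d.form Z h' k := by
  simp [form, E.star_add, E.add_comp]

theorem form_smul_left (Z : E.Obj) (c : ℂ) (h k : d.L Z) :
    d.form Z (c • h) k = (starRingEnd ℂ) c * d.form Z h k := by
  simp [form, E.star_smul, E.smul_comp]

/-- The core of the inner product. -/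
@[reducible] def core : PreInnerProductSpace.Core ℂ d.Pre where
  inner w w' := d.ip w w'
  conj_inner_symm w w' := by
    classical
    rw [d.ip_eq w w' (d.supp w ∪ d.supp w') (Or.inl Finset.subset_union_left),
      d.ip_eq w' w (d.supp w ∪ d.supp w') (Or.inl Finset.subset_union_right), map_sum]
    refine Finset.sum_congr rfl fun Z _ => ?_
    exact d.l_symm Z _ _ (d.co w Z).2 (d.co w' Z).2
  re_inner_nonneg w := by
    rw [d.ip_eq w w (d.supp w) (Or.inl subset_rfl), map_sum]
    exact Finset.sum_nonneg fun Z _ => d.l_pos Z _ (d.co w Z).2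
  add_left w w' v := by
    rw [d.ip_eq w v (d.supp v) (Or.inr subset_rfl), d.ip_eq w' v (d.supp v) (Or.inr subset_rfl),
      d.ip_eq (w + w') v (d.supp v) (Or.inr subset_rfl), ← Finset.sum_add_distrib]
    refine Finset.sum_congr rfl fun Z _ => ?_
    rw [co_add, form_add_left]
  smul_left w v c := by
    rw [d.ip_eq w v (d.supp v) (Or.inr subset_rfl),
      d.ip_eq (c • w) v (d.supp v) (Or.inr subset_rfl), Finset.mul_sum]
    refine Finset.sum_congr rfl fun Z _ => ?_
    rw [co_smul, form_smul_left]

instance : SeminormedAddCommGroup d.Pre :=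
  InnerProductSpace.Core.toSeminormedAddCommGroup (c := d.core)
instance : InnerProductSpace ℂ d.Pre := InnerProductSpace.ofCore d.core

theorem inner_def (w w' : d.Pre) : inner ℂ w w' = d.ip w w' := rfl

theorem norm_sq (w : d.Pre) : ‖w‖ ^ 2 = (d.ip w w).re := by
  rw [← inner_def, ← inner_self_eq_norm_sq (𝕜 := ℂ)]; rfl

open Classical in
/-- The inclusion of a summand. -/
def sing (Z : E.Obj) : d.L Z →ₗ[ℂ] d.Pre := DFinsupp.lsingle (M := fun Z => d.L Z) Z

/-- The coordinate projection. -/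
def coL (Z : E.Obj) : d.Pre →ₗ[ℂ] d.L Z where
  toFun w := d.co w Z
  map_add' w w' := rfl
  map_smul' c w := rfl

theorem co_sing (Z : E.Obj) (h : d.L Z) : d.co (d.sing Z h) Z = h := by
  classical
  exact DFinsupp.single_eq_same

theorem supp_sing (Z : E.Obj) (h : d.L Z) : d.supp (d.sing Z h) ⊆ {Z} := by
  classical
  exact DFinsupp.support_single_subset

theorem ip_sing_left (Z : E.Obj) (h : d.L Z) (w : d.Pre) :
    d.ip (d.sing Z h) w = d.form Z h (d.co w Z) := by
  rw [d.ip_eq _ _ {Z} (Or.inl (d.supp_sing Z h)), Finset.sum_singleton, co_sing]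

theorem ip_sing_right (Z : E.Obj) (h : d.L Z) (w : d.Pre) :
    d.ip w (d.sing Z h) = d.form Z (d.co w Z) h := by
  rw [d.ip_eq _ _ {Z} (Or.inr (d.supp_sing Z h)), Finset.sum_singleton, co_sing]

/-- Left composition on a summand. -/
def actL {Z W : E.Obj} (f : E.Hom Z W) : d.L Z →ₗ[ℂ] d.L W where
  toFun h := ⟨E.comp f h.1, d.L_comp f h.1 h.2⟩
  map_add' h h' := by ext; exact E.comp_add f _ _
  map_smul' c h := by ext; exact E.comp_smul c f _

/-- The operator of a morphism on the algebraic direct sum. -/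
def opL {Z W : E.Obj} (f : E.Hom Z W) : d.Pre →ₗ[ℂ] d.Pre :=
  d.sing W ∘ₗ d.actL f ∘ₗ d.coL Z

theorem opL_apply {Z W : E.Obj} (f : E.Hom Z W) (w : d.Pre) :
    d.opL f w = d.sing W (d.actL f (d.co w Z)) := rfl

theorem form_self_le (w : d.Pre) (Z : E.Obj) : (d.form Z (d.co w Z) (d.co w Z)).re ≤ ‖w‖ ^ 2 := by
  classical
  rw [norm_sq, d.ip_eq w w (insert Z (d.supp w)) (Or.inl (Finset.subset_insert _ _)),
    Complex.re_sum]
  exact Finset.single_le_sum (f := fun Z => (d.form Z (d.co w Z) (d.co w Z)).re)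
    (fun Z _ => d.l_pos Z _ (d.co w Z).2) (Finset.mem_insert_self _ _)

theorem opL_bdd {Z W : E.Obj} (f : E.Hom Z W) : ∃ K : ℝ, ∀ w, ‖d.opL f w‖ ≤ K * ‖w‖ := by
  obtain ⟨K, hK, hb⟩ := d.bdd f
  refine ⟨√K, fun w => ?_⟩
  apply abs_le_of_sq_le_sq' _ (by positivity) |>.2
  rw [mul_pow, Real.sq_sqrt hK, norm_sq, opL_apply, ip_sing_left, co_sing]
  refine (hb _ (d.co w Z).2).trans ?_
  exact mul_le_mul_of_nonneg_left (d.form_self_le w Z) hK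

/-- The bounded operator of a morphism on the algebraic direct sum. -/
def opC {Z W : E.Obj} (f : E.Hom Z W) : d.Pre →L[ℂ] d.Pre :=
  LinearMap.mkContinuous (d.opL f) _ (Classical.choose_spec (d.opL_bdd f))

theorem opC_apply {Z W : E.Obj} (f : E.Hom Z W) (w : d.Pre) :
    d.opC f w = d.sing W (d.actL f (d.co w Z)) := rfl

/-- The GNS Hilbert space. -/
abbrev Hil := UniformSpace.Completion d.Pre

theorem ext_pre {S T : d.Hil →L[ℂ] d.Hil} (h : ∀ w : d.Pre, S w = T w) : S = T := by
  ext a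
  induction a using UniformSpace.Completion.induction_on with
  | hp => exact isClosed_eq S.continuous T.continuous
  | ih a => exact h a

/-- The GNS operator. -/
def op {Z W : E.Obj} (f : E.Hom Z W) : d.Hil →L[ℂ] d.Hil := (d.opC f).completion

theorem op_coe {Z W : E.Obj} (f : E.Hom Z W) (w : d.Pre) :
    d.op f (w : d.Hil) = ((d.opC f w : d.Pre) : d.Hil) := by
  simp [op]

theorem op_star {Z W : E.Obj} (f : E.Hom Z W) : d.op (E.star f) = star (d.op f) := by
  rw [ContinuousLinearMap.star_eq_adjoint, ContinuousLinearMap.eq_adjoint_iff]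
  intro x y
  induction x using UniformSpace.Completion.induction_on with
  | hp => exact isClosed_eq (by fun_prop) (by fun_prop)
  | ih x =>
  induction y using UniformSpace.Completion.induction_on with
  | hp => exact isClosed_eq (by fun_prop) (by fun_prop)
  | ih y =>
  rw [op_coe, op_coe, UniformSpace.Completion.inner_coe, UniformSpace.Completion.inner_coe,
    inner_def, inner_def, opC_apply, opC_apply, ip_sing_left, ip_sing_right]
  simp only [form, actL, LinearMap.coe_mk, AddHom.coe_mk, E.star_comp, E.star_star, E.comp_assoc]

/-- The GNS representation. -/
def rep : StarFunctor E (StarCatNu.ofAlgebra (d.Hil →L[ℂ] d.Hil)) :=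
  StarCatNu.mkRep E _ (fun _ _ f => d.op f)
    (fun X Y f f' => d.ext_pre fun w => by
      simp only [ContinuousLinearMap.add_apply, op_coe, ← UniformSpace.Completion.coe_add]
      congr 1
      rw [opC_apply, opC_apply, opC_apply, ← map_add]
      congr 1
      ext; exact E.add_comp _ _ _)
    (fun X Y c f => d.ext_pre fun w => by
      simp only [ContinuousLinearMap.smul_apply, op_coe, ← UniformSpace.Completion.coe_smul]
      congr 1
      rw [opC_apply, opC_apply, ← map_smul]
      congr 1
      ext; exact E.smul_comp _ _ _)
    (fun X Y Z g f => d.ext_pre fun w => by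
      rw [ContinuousLinearMap.mul_apply]
      simp only [op_coe]
      congr 1
      rw [opC_apply, opC_apply, opC_apply, co_sing]
      congr 1
      ext; exact E.comp_assoc _ _ _)
    (fun X Y f => d.op_star f)

theorem rep_ev {Z W : E.Obj} (f : E.Hom Z W) : d.rep.ev f = d.op f := rfl

theorem le_norm_rep {Z W : E.Obj} (f : E.Hom Z W) (h : E.Hom d.X Z) (hh : h ∈ d.L Z) :
    (d.l (E.comp (E.star (E.comp f h)) (E.comp f h))).re ≤
      ‖d.rep.ev f‖ ^ 2 * (d.l (E.comp (E.star h) h)).re := by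
  have h1 := (d.op f).le_opNorm ((d.sing Z ⟨h, hh⟩ : d.Pre) : d.Hil)
  rw [op_coe, UniformSpace.Completion.norm_coe, UniformSpace.Completion.norm_coe] at h1
  have h2 := pow_le_pow_left₀ (norm_nonneg _) h1 2
  rw [mul_pow, norm_sq, norm_sq, opC_apply, ip_sing_left, ip_sing_left, co_sing, co_sing] at h2
  exact h2

theorem rep_eq_zero {Z W : E.Obj} (f : E.Hom Z W)
    (hf : ∀ h ∈ d.L Z, (d.l (E.comp (E.star (E.comp f h)) (E.comp f h))).re = 0) :
    d.rep.ev f = 0 := by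
  rw [rep_ev]
  apply d.ext_pre
  intro w
  rw [op_coe, ContinuousLinearMap.zero_apply, ← norm_eq_zero, UniformSpace.Completion.norm_coe,
    ← sq_eq_zero_iff, norm_sq, opC_apply, ip_sing_left, co_sing]
  exact hf _ (d.co w Z).2

end GNSData
end GNS

/-! ### Ideals and quotients -/

/-- A ∗-ideal in a ∗-category. -/
structure CIdeal (E : StarCatNu) where
  I : ∀ X Y : E.Obj, Submodule ℂ (E.Hom X Y)
  comp_left : ∀ {X Y Z : E.Obj} (g : E.Hom Y Z) (f : E.Hom X Y), f ∈ I X Y → E.comp g f ∈ I X Z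
  comp_right : ∀ {X Y Z : E.Obj} (g : E.Hom Y Z) (f : E.Hom X Y), g ∈ I Y Z → E.comp g f ∈ I X Z
  star_mem : ∀ {X Y : E.Obj} (f : E.Hom X Y), f ∈ I X Y → E.star f ∈ I Y X

namespace CIdeal
variable {E : StarCatNu} (J : CIdeal E)

/-- The quotient category. -/
def quot : StarCatNu where
  Obj := E.Obj
  Hom X Y := E.Hom X Y ⧸ J.I X Y
  comp {X Y Z} g f := Quotient.liftOn₂' g f (fun g f => (J.I X Z).mkQ (E.comp g f)) (by
    intro g f g' f' hg hf
    have hg := (Submodule.quotientRel_def _).1 hg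
    have hf := (Submodule.quotientRel_def _).1 hf
    apply (Submodule.Quotient.eq _).2
    have : E.comp g f - E.comp g' f' = E.comp (g - g') f + E.comp g' (f - f') := by
      rw [E.sub_comp, E.comp_sub]; abel
    rw [this]
    exact add_mem (J.comp_right _ _ hg) (J.comp_left _ _ hf))
  star {X Y} f := Quotient.liftOn' f (fun f => (J.I Y X).mkQ (E.star f)) (by
    intro f f' hf
    have hf := (Submodule.quotientRel_def _).1 hf
    apply (Submodule.Quotient.eq _).2
    rw [← E.star_sub]
    exact J.star_mem _ hf)
  comp_assoc h g f := by
    induction h using Quotient.inductionOn'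
    induction g using Quotient.inductionOn'
    induction f using Quotient.inductionOn'
    exact congrArg (Submodule.Quotient.mk) (E.comp_assoc _ _ _)
  add_comp h g f := by
    induction h using Quotient.inductionOn'
    induction g using Quotient.inductionOn'
    induction f using Quotient.inductionOn'
    exact congrArg (Submodule.Quotient.mk) (E.add_comp _ _ _)
  comp_add h g f := by
    induction h using Quotient.inductionOn'
    induction g using Quotient.inductionOn'
    induction f using Quotient.inductionOn'
    exact congrArg (Submodule.Quotient.mk) (E.comp_add _ _ _)
  smul_comp c g f := by
    induction g using Quotient.inductionOn'
    induction f using Quotient.inductionOn'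
    exact congrArg (Submodule.Quotient.mk) (E.smul_comp _ _ _)
  comp_smul c g f := by
    induction g using Quotient.inductionOn'
    induction f using Quotient.inductionOn'
    exact congrArg (Submodule.Quotient.mk) (E.comp_smul _ _ _)
  star_star f := by
    induction f using Quotient.inductionOn'
    exact congrArg (Submodule.Quotient.mk) (E.star_star _)
  star_comp g f := by
    induction g using Quotient.inductionOn'
    induction f using Quotient.inductionOn'
    exact congrArg (Submodule.Quotient.mk) (E.star_comp _ _)
  star_add g f := by
    induction g using Quotient.inductionOn'
    induction f using Quotient.inductionOn'
    exact congrArg (Submodule.Quotient.mk) (E.star_add _ _)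
  star_smul c f := by
    induction f using Quotient.inductionOn'
    exact congrArg (Submodule.Quotient.mk) (E.star_smul _ _)

/-- The projection to the quotient category. -/
def proj : StarFunctor E J.quot where
  obj X := X
  map {X Y} f := (J.I X Y).mkQ f
  map_add _ _ _ _ := rfl
  map_smul _ _ _ _ := rfl
  map_comp _ _ _ _ _ := rfl
  map_star _ _ _ := rfl

theorem proj_surj {X Y : E.Obj} (f : J.quot.Hom X Y) : ∃ f' : E.Hom X Y, J.proj.map f' = f :=
  Submodule.mkQ_surjective (J.I X Y) f

theorem proj_eq_zero {X Y : E.Obj} (f : E.Hom X Y) : J.proj.map f = 0 ↔ f ∈ J.I X Y :=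
  Submodule.Quotient.mk_eq_zero (J.I X Y)

theorem proj_eq {X Y : E.Obj} (f f' : E.Hom X Y) :
    J.proj.map f = J.proj.map f' ↔ f - f' ∈ J.I X Y :=
  Submodule.Quotient.eq (J.I X Y)

theorem proj_quot : IsQuotientHom J.proj :=
  ⟨Function.bijective_id, fun _ _ f => J.proj_surj f⟩

/-- Functors killing the ideal descend to the quotient. -/
def desc {F : StarCatNu} (ρ : StarFunctor E F)
    (hρ : ∀ {X Y : E.Obj} (f : E.Hom X Y), f ∈ J.I X Y → ρ.map f = 0) :
    StarFunctor J.quot F where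
  obj := ρ.obj
  map {X Y : E.Obj} f := (J.I X Y).liftQ (ρ.mapLin (X : E.Obj) (Y : E.Obj)) (fun f hf => hρ f hf) f
  map_add _ _ _ _ := _root_.map_add _ _ _
  map_smul _ _ _ _ := _root_.map_smul _ _ _
  map_comp X Y Z g f := by
    obtain ⟨g, rfl⟩ := J.proj_surj g
    obtain ⟨f, rfl⟩ := J.proj_surj f
    exact ρ.map_comp _ _ _ g f
  map_star X Y f := by
    obtain ⟨f, rfl⟩ := J.proj_surj f
    exact ρ.map_star _ _ f

theorem desc_proj {F : StarCatNu} (ρ : StarFunctor E F)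
    (hρ : ∀ {X Y : E.Obj} (f : E.Hom X Y), f ∈ J.I X Y → ρ.map f = 0) {X Y : E.Obj}
    (f : E.Hom X Y) : (J.desc ρ hρ).map (J.proj.map f) = ρ.map f := rfl

theorem ev_le_quot {U : Type} [NonUnitalCStarAlgebra U]
    (ρ : StarFunctor E (StarCatNu.ofAlgebra U))
    (hρ : ∀ {X Y : E.Obj} (f : E.Hom X Y), f ∈ J.I X Y → ρ.ev f = 0) {X Y : E.Obj}
    (f : E.Hom X Y) : ‖ρ.ev f‖ₑ ≤ J.quot.maxNorm (J.proj.map f) :=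
  StarCatNu.ev_le_maxNorm (J.desc ρ hρ) (J.proj.map f)

theorem quot_isUnital (h : E.IsUnital) : J.quot.IsUnital := by
  intro X
  obtain ⟨e, he⟩ := h X
  refine ⟨J.proj.map (X := X) (Y := X) e, ?_, ?_⟩
  · intro Y f
    obtain ⟨f, rfl⟩ := J.proj_surj f
    exact congrArg J.proj.map (he.1 Y f)
  · intro Y f
    obtain ⟨f, rfl⟩ := J.proj_surj f
    exact congrArg J.proj.map (he.2 Y f)

end CIdeal

/-- The approximate-unit element used for the quotient norm. -/
theorem exists_cutoff {M : Type} [CStarAlgebra M] (j : M) (hj : star j = j) (δ : ℝ) (hδ : 0 < δ) :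
    ∃ t s : M, star t = t ∧ ‖t‖ ≤ 1 ∧ ‖t * j * t‖ ≤ δ ∧ 1 - t = j * s := by
  have hsa : IsSelfAdjoint j := hj
  have hpos : ∀ x : ℝ, δ ^ 2 + x ^ 2 ≠ 0 := fun x => by positivity
  have c1 : Continuous (fun x : ℝ => δ ^ 2 / (δ ^ 2 + x ^ 2)) := by
    fun_prop (disch := exact hpos _)
  have c2 : Continuous (fun x : ℝ => x / (δ ^ 2 + x ^ 2)) := by
    fun_prop (disch := exact hpos _)
  refine ⟨cfc (fun x : ℝ => δ ^ 2 / (δ ^ 2 + x ^ 2)) j, cfc (fun x : ℝ => x / (δ ^ 2 + x ^ 2)) j,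
    ?_, ?_, ?_, ?_⟩
  · exact (cfc_predicate (R := ℝ) _ j : IsSelfAdjoint _)
  · apply norm_cfc_le zero_le_one
    intro x _
    rw [Real.norm_of_nonneg (by positivity), div_le_one (by positivity)]
    nlinarith [sq_nonneg x]
  · nth_rewrite 2 [← cfc_id' ℝ j]
    rw [← cfc_mul _ _ j c1.continuousOn (by fun_prop),
      ← cfc_mul _ _ j (by fun_prop) c1.continuousOn]
    apply norm_cfc_le hδ.le
    intro x _
    have hp : 0 < δ ^ 2 + x ^ 2 := by positivity
    have e1 : |δ ^ 2 / (δ ^ 2 + x ^ 2)| ≤ 1 := by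
      rw [abs_of_nonneg (by positivity), div_le_one hp]
      nlinarith [sq_nonneg x]
    have e2 : |δ ^ 2 / (δ ^ 2 + x ^ 2) * x| ≤ δ := by
      rw [abs_mul, abs_of_nonneg (by positivity : 0 ≤ δ ^ 2 / (δ ^ 2 + x ^ 2)),
        div_mul_eq_mul_div, div_le_iff₀ hp, ← sq_abs x]
      nlinarith [sq_nonneg (δ - |x|), abs_nonneg x, mul_nonneg hδ.le (sq_nonneg (δ - |x|)),
        mul_nonneg hδ.le (sq_nonneg (δ)), mul_nonneg hδ.le (sq_nonneg (|x|)),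
        mul_nonneg hδ.le (mul_nonneg hδ.le (abs_nonneg x))]
    rw [Real.norm_eq_abs, abs_mul]
    calc _ ≤ δ * 1 := mul_le_mul e2 e1 (abs_nonneg _) hδ.le
      _ = δ := mul_one _
  · nth_rewrite 2 [← cfc_id' ℝ j]
    rw [← cfc_mul _ _ j (by fun_prop) c2.continuousOn, ← cfc_const_one ℝ j,
      ← cfc_sub _ _ j (by fun_prop) c1.continuousOn]
    congr 1
    ext x
    have := hpos x
    field_simp
    ring

namespace CIdeal
open StarCatNu hiding star_add star_smul star_star star_sub star_neg star
open StarFunctor hiding map_add map_smul map_neg map_sub map_zero map_star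
variable {E : StarCatNu} (J : CIdeal E)

/-- Morphisms whose real part is positive in all representations. -/
def PosRe (E : StarCatNu) {X : E.Obj} (k : E.Hom X X) : Prop :=
  ∀ (U : Type) [NonUnitalCStarAlgebra U] (ρ : StarFunctor E (StarCatNu.ofAlgebra U)),
    letI := CStarAlgebra.spectralOrder U
    0 ≤ ρ.ev k + Star.star (ρ.ev k)

theorem posRe_star_comp {X Y : E.Obj} (h : E.Hom X Y) : PosRe E (E.comp (E.star h) h) := by
  intro U _ ρ
  let := CStarAlgebra.spectralOrder U
  have := CStarAlgebra.spectralOrderedRing U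
  rw [ev_comp, ev_star, star_mul, star_star]
  exact add_nonneg (star_mul_self_nonneg _) (star_mul_self_nonneg _)

theorem posRe_add {X : E.Obj} {h k : E.Hom X X} (h1 : PosRe E h) (h2 : PosRe E k) :
    PosRe E (h + k) := by
  intro U _ ρ
  let := CStarAlgebra.spectralOrder U
  have := CStarAlgebra.spectralOrderedRing U
  rw [ev_add, star_add]
  have := add_nonneg (h1 U ρ) (h2 U ρ)
  convert this using 1
  abel

theorem posRe_smul {X : E.Obj} {h : E.Hom X X} (h1 : PosRe E h) (c : ℝ) (hc : 0 ≤ c) :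
    PosRe E ((c : ℂ) • h) := by
  intro U _ ρ
  let := CStarAlgebra.spectralOrder U
  have := CStarAlgebra.spectralOrderedRing U
  rw [ev_smul, star_smul]
  have e : star (c : ℂ) = (c : ℂ) := by simp
  rw [e, ← smul_add, Complex.coe_smul]
  exact smul_nonneg hc (h1 U ρ)

theorem posRe_skew {X : E.Obj} {h : E.Hom X X} (h1 : E.star h = -h) : PosRe E h := by
  intro U _ ρ
  let := CStarAlgebra.spectralOrder U
  rw [← ev_star, h1, ev_neg]
  simp

/-- If `c • 1 - f* f` is, up to a small error, positive modulo `J`, then `f` has small distance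
to `J`. -/
theorem dist_le_of_approx (hE : IsCStar E) {X Y : E.Obj} (e : E.Hom X X) (he : IsIdentityAt E e)
    (f : E.Hom X Y) (c ε : ℝ) (hc : 0 ≤ c) (hε : 0 < ε) (k j : E.Hom X X) (hk : PosRe E k)
    (hj : j ∈ J.I X X)
    (herr : ‖EndAlg.mk hE he ((c : ℂ) • e - E.comp (E.star f) f - (k + j))‖ ≤ ε) :
    ∃ f' ∈ J.I X Y, (E.maxNorm (f - f')).toReal ^ 2 ≤ c + 2 * ε := by
  set M := EndAlg E hE X e he with hM
  let x : M := EndAlg.mk hE he (E.comp (E.star f) f)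
  let k' : M := EndAlg.mk hE he k
  let j' : M := EndAlg.mk hE he j
  let r : M := (c : ℂ) • 1 - x - (k' + j')
  have hr : ‖r‖ ≤ ε := herr
  have hx : star x = x := by
    show E.star (E.comp (E.star f) f) = E.comp (E.star f) f
    rw [E.star_comp, E.star_star]
  -- self-adjoint parts
  let k1 : M := (1/2 : ℂ) • (k' + star k')
  let j1 : M := (1/2 : ℂ) • (j' + star j')
  let r1 : M := (1/2 : ℂ) • (r + star r)
  have hj1 : j1 ∈ J.I X X :=
    (J.I X X).smul_mem (1/2 : ℂ) (Submodule.add_mem _ hj (J.star_mem j hj))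
  have hhalf : star (1/2 : ℂ) = 1/2 := by simp
  have hj1s : star j1 = j1 := by
    simp only [j1, StarModule.star_smul, hhalf, star_add, star_star]
    rw [add_comm]
  have hr1 : ‖r1‖ ≤ ε := by
    calc ‖r1‖ = (1/2) * ‖r + star r‖ := by simp only [r1]; rw [norm_smul]; norm_num
      _ ≤ (1/2) * (‖r‖ + ‖star r‖) := by gcongr; exact norm_add_le _ _
      _ ≤ ε := by rw [norm_star]; linarith
  have hsum : x = (c : ℂ) • 1 - k1 - j1 - r1 := by
    have hstar : star r = (c : ℂ) • 1 - x - (star k' + star j') := by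
      simp only [r, star_sub, star_add, StarModule.star_smul, star_one, hx]
      simp
    have : r1 = (c : ℂ) • 1 - x - k1 - j1 := by
      simp only [r1, k1, j1]
      rw [hstar]
      simp only [r]
      have : (c : ℂ) • (1 : M) - x = (1/2 : ℂ) • (((c : ℂ) • (1 : M) - x) + ((c : ℂ) • (1 : M) - x)) := by
        rw [← two_smul ℂ ((c : ℂ) • (1 : M) - x), smul_smul]; norm_num
      conv_rhs => rw [this]
      simp only [smul_add, smul_sub]
      abel
    rw [this]; abel
  obtain ⟨t, s, hts, htn, htj, hst⟩ := exists_cutoff j1 hj1s ε hε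
  let z : M := (c : ℂ) • (t * t) - t * j1 * t - t * r1 * t
  have hz : ‖z‖ ≤ c + 2 * ε := by
    have a1 : ‖(c : ℂ) • (t * t)‖ ≤ c := by
      rw [norm_smul]
      have : ‖t * t‖ ≤ 1 := (norm_mul_le _ _).trans (mul_le_one₀ htn (norm_nonneg _) htn)
      simp only [Complex.norm_real, Real.norm_of_nonneg hc]
      nlinarith
    have a2 : ‖t * r1 * t‖ ≤ ε := by
      calc ‖t * r1 * t‖ ≤ ‖t‖ * ‖r1‖ * ‖t‖ := norm_mul₃_le
        _ ≤ 1 * ε * 1 := by gcongr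
        _ = ε := by ring
    calc ‖z‖ ≤ ‖(c : ℂ) • (t * t) - t * j1 * t‖ + ‖t * r1 * t‖ := norm_sub_le _ _
      _ ≤ ‖(c : ℂ) • (t * t)‖ + ‖t * j1 * t‖ + ‖t * r1 * t‖ := by gcongr; exact norm_sub_le _ _
      _ ≤ c + 2 * ε := by linarith
  have htxt : t * x * t = z - t * k1 * t := by
    rw [hsum]
    simp only [z, mul_sub, sub_mul, mul_smul_comm, smul_mul_assoc, mul_one]
    abel
  let t0 : E.Hom X X := t
  let z0 : E.Hom X X := z
  have hts0 : E.star t0 = t0 := hts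
  have key0 : E.comp (E.star (E.comp f t0)) (E.comp f t0) =
      z0 - E.comp t0 (E.comp ((1/2 : ℂ) • (k + E.star k)) t0) := by
    have e1 : E.comp (E.star (E.comp f t0)) (E.comp f t0) =
        E.comp (E.comp t0 (E.comp (E.star f) f)) t0 := by
      rw [E.star_comp, hts0]
      simp only [E.comp_assoc]
    rw [e1, ← E.comp_assoc t0 ((1/2 : ℂ) • (k + E.star k))]
    exact htxt
  refine ⟨f - E.comp f t0, ?_, ?_⟩
  · have : f - E.comp f t0 = E.comp f (e - t0) := by rw [E.comp_sub, he.1]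
    rw [this]
    apply J.comp_left
    have h2 : e - t0 = E.comp (X := X) (Y := X) (Z := X) j1 s := hst
    rw [h2]
    exact J.comp_right _ _ hj1
  · rw [sub_sub_cancel]
    have hle : E.maxNorm (E.comp f t0) * E.maxNorm (E.comp f t0) ≤ E.maxNorm z0 := by
      refine (maxNorm_star_comp_self _).trans ?_
      apply maxNorm_le
      intro U _ ρ
      refine le_trans ?_ (ev_le_maxNorm ρ z0)
      let := CStarAlgebra.spectralOrder U
      have := CStarAlgebra.spectralOrderedRing U
      have n1 : 0 ≤ ρ.ev (E.comp (E.star (E.comp f t0)) (E.comp f t0)) := by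
        rw [ev_comp, ev_star]; exact star_mul_self_nonneg _
      have n2 : ρ.ev (E.comp (E.star (E.comp f t0)) (E.comp f t0)) ≤ ρ.ev z0 := by
        rw [key0, ev_sub]
        apply sub_le_self
        rw [ev_comp, ev_comp, ev_smul, ev_add, ev_star, ← mul_assoc]
        have h3 : Star.star (ρ.ev t0) = ρ.ev t0 := by rw [← ev_star, hts0]
        nth_rewrite 1 [← h3]
        apply star_left_conjugate_nonneg
        have h4 : (1/2 : ℂ) = ((1/2 : ℝ) : ℂ) := by norm_num
        rw [h4, Complex.coe_smul]
        exact smul_nonneg (by norm_num) (hk U ρ)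
      have := CStarAlgebra.norm_le_norm_of_nonneg_of_le n1 n2
      rw [← ofReal_norm, ← ofReal_norm]
      exact ENNReal.ofReal_le_ofReal this
    have := ENNReal.toReal_mono (hE.ne_top _) hle
    rw [ENNReal.toReal_mul] at this
    rw [pow_two]
    exact this.trans hz

/-- The representation of a unital C*-category computing the quotient norm. -/
theorem exists_rep_quot (hE : IsCStar E) (hu : E.IsUnital) {X Y : E.Obj} (f : E.Hom X Y)
    (c c' : ℝ) (hc : 0 ≤ c) (hcc : c < c') (hd : ∀ j ∈ J.I X Y, c' ≤ (E.maxNorm (f - j)).toReal ^ 2) :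
    ∃ (U : Type) (_ : NonUnitalCStarAlgebra U) (ρ : StarFunctor E (StarCatNu.ofAlgebra U)),
      (∀ {Z W : E.Obj} (j : E.Hom Z W), j ∈ J.I Z W → ρ.ev j = 0) ∧ c < ‖ρ.ev f‖ ^ 2 := by
  obtain ⟨e, he⟩ := hu X
  let S : Set (EndAlg E hE X e he) := {x | ∃ k j : E.Hom X X, PosRe E k ∧ j ∈ J.I X X ∧ x = k + j}
  obtain ⟨l, hl1, hl2, hl3⟩ := exists_pos_functional S
    ⟨0, 0, posRe_skew (by rw [E.star_zero', neg_zero]), zero_mem _, (add_zero _).symm⟩ (by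
      rintro _ ⟨k, j, hk, hj, rfl⟩ _ ⟨k', j', hk', hj', rfl⟩
      exact ⟨k + k', j + j', posRe_add hk hk', add_mem hj hj', add_add_add_comm _ _ _ _⟩) (by
      rintro a ha _ ⟨k, j, hk, hj, rfl⟩
      exact ⟨(a : ℂ) • k, (a : ℂ) • j, posRe_smul hk a ha, Submodule.smul_mem _ _ hj,
        smul_add (a : ℂ) k j⟩) (by
      intro x hx
      exact ⟨x, 0, posRe_skew hx, zero_mem _, (add_zero (M := E.Hom X X) _).symm⟩)
    (EndAlg.mk hE he ((c : ℂ) • e - E.comp (E.star f) f)) (by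
      intro hcl
      rw [Metric.mem_closure_iff] at hcl
      obtain ⟨_, ⟨k, j, hk, hj, rfl⟩, hd1⟩ := hcl ((c' - c) / 4) (by linarith)
      have hd1 := (dist_eq_norm (EndAlg.mk hE he _) (EndAlg.mk hE he (k + j))).symm.trans_lt hd1
      obtain ⟨f', hf', hle⟩ := J.dist_le_of_approx hE e he f c ((c' - c) / 4) hc (by linarith) k j
        hk hj hd1.le
      have := hd f' hf'
      linarith)
  let l' : E.Hom X X →ₗ[ℂ] ℂ := l
  have hpos : ∀ k : E.Hom X X, PosRe E k → 0 ≤ (l' k).re := fun k hk =>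
    hl1 _ ⟨k, 0, hk, zero_mem _, (add_zero (M := E.Hom X X) _).symm⟩
  have hJ0 : ∀ j : E.Hom X X, j ∈ J.I X X → 0 ≤ (l' j).re := fun k hk =>
    hl1 _ ⟨0, k, posRe_skew (by rw [E.star_zero', neg_zero]), hk, (zero_add (M := E.Hom X X) _).symm⟩
  have hJ : ∀ j : E.Hom X X, j ∈ J.I X X → (l' j).re = 0 := by
    intro j hj
    apply le_antisymm _ (hJ0 j hj)
    have := hJ0 (-j) (neg_mem hj)
    rw [map_neg, Complex.neg_re] at this
    linarith
  let d : GNSData E :=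
    { X := X
      L := fun _ => ⊤
      L_comp := fun _ _ _ => trivial
      l := l'
      l_symm := by
        intro Z h k _ _
        have : E.comp (E.star h) k = E.star (E.comp (E.star k) h) := by
          rw [E.star_comp, E.star_star]
        rw [this]
        exact (hl2 _).symm
      l_pos := fun Z h _ => hpos _ (posRe_star_comp h)
      bdd := by
        intro Z W f
        obtain ⟨eZ, heZ⟩ := hu Z
        obtain ⟨K, γ, hK, hγ⟩ := EndAlg.exists_sqrt hE heZ (E.comp (E.star f) f)
          (by rw [E.star_comp, E.star_star])
        refine ⟨K, hK, fun h _ => ?_⟩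
        have h1 := hpos _ (posRe_star_comp (E.comp γ h))
        have h2 : E.comp (E.star (E.comp γ h)) (E.comp γ h) =
            (K : ℂ) • E.comp (E.star h) h - E.comp (E.star (E.comp f h)) (E.comp f h) := by
          rw [E.star_comp, E.comp_assoc, ← E.comp_assoc (E.star γ), ← hγ, E.sub_comp, E.smul_comp,
            heZ.2, E.comp_sub, E.comp_smul, E.star_comp, E.comp_assoc, E.comp_assoc]
        rw [h2, map_sub, map_smul, Complex.sub_re, smul_eq_mul, Complex.re_ofReal_mul] at h1
        linarith }
  refine ⟨_, inferInstance, d.rep, ?_, ?_⟩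
  · intro Z W j hj
    apply d.rep_eq_zero
    intro h _
    exact hJ _ (J.comp_left _ _ (J.comp_right _ _ hj))
  · have h1 := d.le_norm_rep f e trivial
    have h2 : 0 ≤ (l' e).re := by
      have := hpos _ (posRe_star_comp e)
      rwa [he.1, EndAlg.star_id he] at this
    have h3 : (l' ((c : ℂ) • e - E.comp (E.star f) f)).re < 0 := hl3
    rw [map_sub, map_smul, Complex.sub_re, smul_eq_mul, Complex.re_ofReal_mul] at h3
    have h4 : (l' (E.comp (E.star f) f)).re ≤ ‖d.rep.ev f‖ ^ 2 * (l' e).re := by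
      have e1 : E.comp f e = f := he.1 _ f
      have e2 : E.comp (E.star e) e = e := by rw [he.1, EndAlg.star_id he]
      have := h1
      change (l' _).re ≤ _ * (l' _).re at this
      rw [e1, e2] at this
      exact this
    by_contra hcon
    push Not at hcon
    nlinarith

end CIdeal

namespace CIdeal
open StarCatNu hiding star_add star_smul star_star star_sub star_neg star
open StarFunctor hiding map_add map_smul map_neg map_sub map_zero map_star
variable {E : StarCatNu} (J : CIdeal E)

/-- The ideal is closed. -/
def Closed : Prop := ∀ {X Y : E.Obj} (f : E.Hom X Y),
  (∀ ε : ℝ≥0∞, 0 < ε → ∃ j ∈ J.I X Y, E.maxNorm (f - j) < ε) → f ∈ J.I X Y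

theorem quot_norm_le {X Y : E.Obj} (f : E.Hom X Y) (j : E.Hom X Y) (hj : j ∈ J.I X Y) :
    J.quot.maxNorm (J.proj.map f) ≤ E.maxNorm (f - j) := by
  have : J.proj.map f = J.proj.map (f - j) := by
    rw [J.proj_eq]; simpa using hj
  rw [this]
  exact maxNorm_map_le _ _

/-- Representations of `E` killing `J` compute the quotient norm. -/
theorem exists_lift_of_forall (hE : IsCStar E) (hu : E.IsUnital) {X Y : E.Obj} (f : E.Hom X Y)
    (ε c : ℝ≥0∞) (hc : c < ε)
    (h : ∀ (U : Type) [NonUnitalCStarAlgebra U] (ρ : StarFunctor E (StarCatNu.ofAlgebra U)),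
      (∀ {Z W : E.Obj} (j : E.Hom Z W), j ∈ J.I Z W → ρ.ev j = 0) → ‖ρ.ev f‖ₑ ≤ c) :
    ∃ j ∈ J.I X Y, E.maxNorm (f - j) < ε := by
  by_contra hcon
  push Not at hcon
  have hεt : ε ≠ ⊤ := ne_top_of_le_ne_top (hE.ne_top _) (hcon 0 (zero_mem _))
  have hct : c ≠ ⊤ := (hc.trans_le le_top).ne
  have hlt : c.toReal < ε.toReal := (ENNReal.toReal_lt_toReal hct hεt).2 hc
  obtain ⟨U, _, ρ, h1, h2⟩ := J.exists_rep_quot hE hu f (c.toReal ^ 2) (ε.toReal ^ 2) (by positivity)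
    (pow_lt_pow_left₀ hlt ENNReal.toReal_nonneg two_ne_zero) (by
      intro j hj
      have := ENNReal.toReal_mono (hE.ne_top _) (hcon j hj)
      exact pow_le_pow_left₀ ENNReal.toReal_nonneg this 2)
  have h3 := ENNReal.toReal_mono hct (h U ρ h1)
  rw [toReal_enorm] at h3
  exact absurd h2 (not_lt.2 (pow_le_pow_left₀ (norm_nonneg _) h3 2))

theorem exists_lift (hE : IsCStar E) (hu : E.IsUnital) {X Y : E.Obj} (f : E.Hom X Y)
    (ε : ℝ≥0∞) (hf : J.quot.maxNorm (J.proj.map f) < ε) :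
    ∃ j ∈ J.I X Y, E.maxNorm (f - j) < ε :=
  J.exists_lift_of_forall hE hu f ε _ hf fun _ _ ρ h => J.ev_le_quot ρ h f

theorem quot_isCStar (hE : IsCStar E) (hu : E.IsUnital) (hJ : J.Closed) : IsCStar J.quot := by
  refine ⟨?_, ?_, ?_⟩
  · intro X Y f
    obtain ⟨f, rfl⟩ := J.proj_surj f
    exact (maxNorm_map_le _ _).trans_lt (hE.1 _ _ f)
  · intro X Y f hf
    obtain ⟨f, rfl⟩ := J.proj_surj f
    refine (J.proj_eq_zero f).2 ?_
    apply hJ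
    intro ε hε
    exact J.exists_lift hE hu f ε (hf ▸ hε)
  · intro (X : E.Obj) (Y : E.Obj) u hu'
    let := hE.homNormed X Y
    let := hE.homNormedSpace X Y
    have := hE.homComplete X Y
    have key : ∀ (x : E.Hom X Y ⧸ J.I X Y), ‖x‖ₑ = J.quot.maxNorm (X := X) (Y := Y) x := by
      intro x
      obtain ⟨f, rfl⟩ := Submodule.mkQ_surjective _ x
      apply le_antisymm
      · apply le_of_forall_gt
        intro ε hε
        obtain ⟨j, hj, hlt⟩ := J.exists_lift hE hu f ε hε
        have e1 : (J.I X Y).mkQ f = (J.I X Y).mkQ (f - j) := by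
          apply (Submodule.Quotient.eq _).2; simpa using hj
        rw [e1]
        refine lt_of_le_of_lt ?_ hlt
        rw [← hE.enorm_def, ← ofReal_norm, ← ofReal_norm]
        exact ENNReal.ofReal_le_ofReal (Submodule.Quotient.norm_mk_le (J.I X Y) _)
      · apply le_of_forall_gt
        intro ε hε
        by_cases hεt : ε = ⊤
        · rw [hεt]; exact (maxNorm_map_le J.proj f).trans_lt (hE.1 _ _ f)
        have hε2 : ‖(J.I X Y).mkQ f‖ < ε.toReal := by
          rw [← toReal_enorm]
          exact (ENNReal.toReal_lt_toReal (by simp) hεt).2 hε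
        obtain ⟨m, hm, hlt⟩ := QuotientAddGroup.norm_lt_iff.1 hε2
        have hm : (J.I X Y).mkQ m = (J.I X Y).mkQ f := hm
        rw [← hm]
        refine (maxNorm_map_le J.proj m).trans_lt ?_
        rw [← hE.enorm_def, ← ofReal_norm]
        exact (ENNReal.ofReal_lt_iff_lt_toReal (norm_nonneg _) hεt).2 hlt
    have hcomp : CompleteSpace (E.Hom X Y ⧸ J.I X Y) :=
      inferInstanceAs (CompleteSpace (E.Hom X Y ⧸ (J.I X Y).toAddSubgroup))
    let u' : ℕ → E.Hom X Y ⧸ J.I X Y := u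
    have hcau : CauchySeq u' := by
      apply EMetric.cauchySeq_iff.2
      intro ε hε
      obtain ⟨N, hN⟩ := hu' ε hε
      refine ⟨N, fun m hm n hn => ?_⟩
      rw [edist_eq_enorm_sub, key]
      exact hN m hm n hn
    obtain ⟨f, hf⟩ := cauchySeq_tendsto_of_complete hcau
    refine ⟨f, fun ε hε => ?_⟩
    obtain ⟨N, hN⟩ := EMetric.tendsto_atTop.1 hf ε hε
    refine ⟨N, fun n hn => ?_⟩
    have := hN n hn
    rw [edist_eq_enorm_sub, key] at this
    exact this

/-- The kernel of a functor. -/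
def ker {D Q : StarCatNu} (q : StarFunctor D Q) : CIdeal D where
  I X Y := LinearMap.ker (q.mapLin X Y)
  comp_left g f hf := by
    have hf : q.map f = 0 := hf
    show q.map _ = 0
    rw [q.map_comp, hf, Q.comp_zero]
  comp_right g f hf := by
    have hf : q.map g = 0 := hf
    show q.map _ = 0
    rw [q.map_comp, hf, Q.zero_comp]
  star_mem f hf := by
    have hf : q.map f = 0 := hf
    show q.map _ = 0
    rw [q.map_star, hf, Q.star_zero']

theorem mem_ker {D Q : StarCatNu} (q : StarFunctor D Q) {X Y : D.Obj} (f : D.Hom X Y) :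
    f ∈ (ker q).I X Y ↔ q.map f = 0 := Iff.rfl

theorem ker_closed {D Q : StarCatNu} (hQ : IsCStar Q) (q : StarFunctor D Q) : (ker q).Closed := by
  intro X Y f h
  rw [mem_ker]
  apply hQ.2.1
  by_contra hne
  obtain ⟨j, hj, hlt⟩ := h _ (pos_iff_ne_zero.2 hne)
  rw [mem_ker] at hj
  have := maxNorm_map_le q (f - j)
  rw [q.map_sub, hj, sub_zero] at this
  exact absurd hlt (not_lt.2 this)

theorem exact_proj_ker {C D Q : StarCatNu} {i : StarFunctor C D} {q : StarFunctor D Q}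
    (h : IsExactSeq i q) : IsExactSeq i (ker q).proj where
  i_obj_bij := h.i_obj_bij
  i_map_inj := h.i_map_inj
  p_quot := (ker q).proj_quot
  exact X Y f := by rw [proj_eq_zero, mem_ker, h.exact]

end CIdeal

/-! ### Casting lemmas -/

namespace StarCatNu
variable {C : StarCatNu}

theorem castHom_heq {X X' Y Y' : C.Obj} (hX : X = X') (hY : Y = Y') (f : C.Hom X Y) :
    HEq (C.castHom hX hY f) f := by subst hX hY; rfl

theorem castHom_add {X X' Y Y' : C.Obj} (hX : X = X') (hY : Y = Y') (f f' : C.Hom X Y) :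
    C.castHom hX hY (f + f') = C.castHom hX hY f + C.castHom hX hY f' := by subst hX hY; rfl

theorem castHom_sub {X X' Y Y' : C.Obj} (hX : X = X') (hY : Y = Y') (f f' : C.Hom X Y) :
    C.castHom hX hY (f - f') = C.castHom hX hY f - C.castHom hX hY f' := by subst hX hY; rfl

theorem castHom_zero {X X' Y Y' : C.Obj} (hX : X = X') (hY : Y = Y') :
    C.castHom hX hY 0 = 0 := by subst hX hY; rfl

theorem castHom_smul {X X' Y Y' : C.Obj} (hX : X = X') (hY : Y = Y') (c : ℂ) (f : C.Hom X Y) :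
    C.castHom hX hY (c • f) = c • C.castHom hX hY f := by subst hX hY; rfl

theorem castHom_comp {X X' Y Y' Z Z' : C.Obj} (hX : X = X') (hY : Y = Y') (hZ : Z = Z')
    (g : C.Hom Y Z) (f : C.Hom X Y) :
    C.castHom hX hZ (C.comp g f) = C.comp (C.castHom hY hZ g) (C.castHom hX hY f) := by
  subst hX hY hZ; rfl

theorem castHom_star {X X' Y Y' : C.Obj} (hX : X = X') (hY : Y = Y') (f : C.Hom X Y) :
    C.castHom hY hX (C.star f) = C.star (C.castHom hX hY f) := by subst hX hY; rfl

theorem castHom_castHom {X X' X'' Y Y' Y'' : C.Obj} (hX : X = X') (hY : Y = Y') (hX' : X' = X'')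
    (hY' : Y' = Y'') (f : C.Hom X Y) :
    C.castHom hX' hY' (C.castHom hX hY f) = C.castHom (hX.trans hX') (hY.trans hY') f := by
  subst hX hY hX' hY'; rfl

theorem castHom_rfl {X Y : C.Obj} (hX : X = X) (hY : Y = Y) (f : C.Hom X Y) :
    C.castHom hX hY f = f := rfl

theorem castHom_eq_iff {X X' Y Y' : C.Obj} (hX : X = X') (hY : Y = Y') (f : C.Hom X Y)
    (g : C.Hom X' Y') : C.castHom hX hY f = g ↔ f = C.castHom hX.symm hY.symm g := by
  subst hX hY; rfl

theorem comp_heq {X X' Y Y' Z Z' : C.Obj} (hX : X = X') (hY : Y = Y') (hZ : Z = Z')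
    {g : C.Hom Y Z} {f : C.Hom X Y} {g' : C.Hom Y' Z'} {f' : C.Hom X' Y'} (hg : HEq g g')
    (hf : HEq f f') : HEq (C.comp g f) (C.comp g' f') := by
  subst hX hY hZ; obtain rfl := eq_of_heq hg; obtain rfl := eq_of_heq hf; rfl

theorem star_heq {X X' Y Y' : C.Obj} (hX : X = X') (hY : Y = Y')
    {f : C.Hom X Y} {f' : C.Hom X' Y'} (hf : HEq f f') : HEq (C.star f) (C.star f') := by
  subst hX hY; obtain rfl := eq_of_heq hf; rfl

theorem ideal_castHom (J : CIdeal C) {X X' Y Y' : C.Obj} (hX : X = X') (hY : Y = Y')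
    (f : C.Hom X Y) : C.castHom hX hY f ∈ J.I X' Y' ↔ f ∈ J.I X Y := by
  subst hX hY; rfl

theorem castHom_isIdentity {X X' : C.Obj} (hX hX' : X = X') (f : C.Hom X X)
    (hf : IsIdentityAt C f) : IsIdentityAt C (C.castHom hX hX' f) := by
  subst hX; exact hf

end StarCatNu

namespace StarFunctor
variable {C D : StarCatNu}

theorem map_castHom (F : StarFunctor C D) {X X' Y Y' : C.Obj} (hX : X = X') (hY : Y = Y')
    (f : C.Hom X Y) : F.map (C.castHom hX hY f) =
      D.castHom (congrArg F.obj hX) (congrArg F.obj hY) (F.map f) := by subst hX hY; rfl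

theorem map_heq (F : StarFunctor C D) {X X' Y Y' : C.Obj} (hX : X = X') (hY : Y = Y')
    {f : C.Hom X Y} {f' : C.Hom X' Y'} (hf : HEq f f') : HEq (F.map f) (F.map f') := by
  subst hX hY; obtain rfl := eq_of_heq hf; rfl

theorem ev_castHom {U : Type} [NonUnitalCStarAlgebra U]
    (ρ : StarFunctor C (StarCatNu.ofAlgebra U)) {X X' Y Y' : C.Obj} (hX : X = X') (hY : Y = Y')
    (f : C.Hom X Y) : ρ.ev (C.castHom hX hY f) = ρ.ev f := by subst hX hY; rfl

theorem obj_congr {F F' : StarFunctor C D} (h : F = F') (X : C.Obj) : F.obj X = F'.obj X := by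
  rw [h]

theorem map_congr {F F' : StarFunctor C D} (h : F = F') {X Y : C.Obj} (f : C.Hom X Y) :
    D.castHom (obj_congr h X) (obj_congr h Y) (F.map f) = F'.map f := by subst h; rfl

theorem norm_congr {F F' : StarFunctor C D} (h : F = F') {X Y : C.Obj} (f : C.Hom X Y) :
    D.maxNorm (F.map f) = D.maxNorm (F'.map f) := by subst h; rfl

theorem zero_congr {F F' : StarFunctor C D} (h : F = F') {X Y : C.Obj} (f : C.Hom X Y) :
    F.map f = 0 ↔ F'.map f = 0 := by subst h; rfl

theorem ext_cast {F F' : StarFunctor C D} (h : ∀ X, F.obj X = F'.obj X)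
    (h' : ∀ (X Y : C.Obj) (f : C.Hom X Y), D.castHom (h X) (h Y) (F.map f) = F'.map f) :
    F = F' := by
  obtain ⟨o, m, _, _, _, _⟩ := F
  obtain ⟨o', m', _, _, _, _⟩ := F'
  obtain rfl : o = o' := funext h
  have : @m = @m' := by
    funext X Y f
    exact h' X Y f
  subst this
  rfl

/-- Representations killing the kernel descend along quotient morphisms. -/
theorem exists_desc_rep {D Q : StarCatNu} (q : StarFunctor D Q) (hq : IsQuotientHom q)
    {U : Type} [NonUnitalCStarAlgebra U] (ρ : StarFunctor D (StarCatNu.ofAlgebra U))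
    (hρ : ∀ {X Y : D.Obj} (f : D.Hom X Y), q.map f = 0 → ρ.ev f = 0) :
    ∃ ρ' : StarFunctor Q (StarCatNu.ofAlgebra U),
      ∀ {X Y : D.Obj} (f : D.Hom X Y), ρ'.ev (q.map f) = ρ.ev f := by
  choose s hs using hq.1.2
  have hs' : ∀ X, s (q.obj X) = X := fun X => hq.1.1 (hs _)
  have hex : ∀ (X Y : Q.Obj) (f : Q.Hom X Y), ∃ f' : D.Hom (s X) (s Y),
      Q.castHom (hs X) (hs Y) (q.map f') = f := by
    intro X Y f
    obtain ⟨f', hf'⟩ := hq.2 (s X) (s Y) (Q.castHom (hs X).symm (hs Y).symm f)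
    refine ⟨f', ?_⟩
    rw [StarCatNu.castHom_eq_iff]
    exact hf'
  choose lift hlift using hex
  have huniq : ∀ {X Y : D.Obj} (f f' : D.Hom X Y), q.map f = q.map f' → ρ.ev f = ρ.ev f' := by
    intro X Y f f' h
    rw [← sub_eq_zero, ← ev_sub]
    apply hρ
    rw [map_sub, h, sub_self]
  have huniq' : ∀ {X Y : Q.Obj} (f f' : D.Hom (s X) (s Y)),
      Q.castHom (hs X) (hs Y) (q.map f) = Q.castHom (hs X) (hs Y) (q.map f') →
      ρ.ev f = ρ.ev f' := by
    intro X Y f f' h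
    rw [StarCatNu.castHom_eq_iff, StarCatNu.castHom_castHom, StarCatNu.castHom_rfl] at h
    exact huniq _ _ h
  refine ⟨StarCatNu.mkRep Q U (fun X Y f => ρ.ev (lift X Y f)) ?_ ?_ ?_ ?_, ?_⟩
  · intro X Y f f'
    rw [← ev_add]
    apply huniq'
    rw [map_add, StarCatNu.castHom_add, hlift, hlift, hlift]
  · intro X Y c f
    rw [← ev_smul]
    apply huniq'
    rw [map_smul, StarCatNu.castHom_smul, hlift, hlift]
  · intro X Y Z g f
    rw [← ev_comp]
    apply huniq'
    rw [map_comp, StarCatNu.castHom_comp (hs X) (hs Y) (hs Z), hlift, hlift, hlift]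
  · intro X Y f
    rw [← ev_star]
    apply huniq'
    rw [map_star, StarCatNu.castHom_star, hlift, hlift]
  · intro X Y f
    rw [StarCatNu.mkRep_ev, ← ev_castHom ρ (hs' X).symm (hs' Y).symm f]
    apply huniq'
    rw [hlift, map_castHom, StarCatNu.castHom_castHom, StarCatNu.castHom_rfl]

end StarFunctor

/-- In an exact sequence, the norm of the quotient is the quotient norm. -/
theorem exists_lift_of_quot {D Q : StarCatNu} (hD : IsCStar D) (hu : D.IsUnital)
    (q : StarFunctor D Q) (hq : IsQuotientHom q) {X Y : D.Obj} (f : D.Hom X Y) (ε : ℝ≥0∞)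
    (hf : Q.maxNorm (q.map f) < ε) : ∃ j, q.map j = 0 ∧ D.maxNorm (f - j) < ε := by
  apply (CIdeal.ker q).exists_lift_of_forall hD hu f ε _ hf
  intro U _ ρ h
  obtain ⟨ρ', h'⟩ := q.exists_desc_rep hq ρ h
  rw [← h' f]
  exact StarCatNu.ev_le_maxNorm ρ' _

/-! ### Unitary equivalences -/

theorem IsIdentityAt.unique {C : StarCatNu} {X : C.Obj} {e e' : C.Hom X X}
    (h : IsIdentityAt C e) (h' : IsIdentityAt C e') : e = e' := by
  rw [← h.1 _ e', h'.2]

section Equivalence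
open StarCatNu hiding star_add star_smul star_star star_sub star_neg star
open StarFunctor hiding map_add map_smul map_neg map_sub map_zero map_star
variable {C D : StarCatNu} {F : StarFunctor C D}

/-- The data of a unitary transformation to the identity in unfolded form. -/
theorem UnitaryTrans.exists_data {H : StarFunctor D C}
    (t : UnitaryTrans (F.comp H) (StarFunctor.id C)) :
    ∃ app : ∀ X : C.Obj, C.Hom (H.obj (F.obj X)) X,
      (∀ (X Y : C.Obj) (f : C.Hom X Y),
        C.comp (app Y) (H.map (F.map f)) = C.comp f (app X)) ∧
      ∀ X, IsIdentityAt C (C.comp (C.star (app X)) (app X)) ∧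
        IsIdentityAt C (C.comp (app X) (C.star (app X))) :=
  ⟨t.app, t.natural, t.unitary⟩

theorem UnitaryTrans.faithful {H : StarFunctor D C}
    (t : UnitaryTrans (F.comp H) (StarFunctor.id C)) {X Y : C.Obj} (f : C.Hom X Y)
    (hf : F.map f = 0) : f = 0 := by
  obtain ⟨app, nat, uni⟩ := t.exists_data
  have h1 := nat X Y f
  rw [hf, H.map_zero, C.comp_zero] at h1
  have h3 := (uni X).2.1 _ f
  rw [← h3, ← C.comp_assoc, ← h1, C.zero_comp]

theorem UnitaryTrans.exists_full {H : StarFunctor D C}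
    (t : UnitaryTrans (F.comp H) (StarFunctor.id C)) {X Y : C.Obj}
    (d : C.Hom (H.obj (F.obj X)) (H.obj (F.obj Y))) :
    ∃ f : C.Hom X Y, H.map (F.map f) = d := by
  obtain ⟨app, nat, uni⟩ := t.exists_data
  refine ⟨C.comp (app Y) (C.comp d (C.star (app X))), ?_⟩
  have h1 := nat X Y (C.comp (app Y) (C.comp d (C.star (app X))))
  have h2 : C.comp (C.comp (app Y) (C.comp d (C.star (app X)))) (app X) = C.comp (app Y) d := by
    rw [C.comp_assoc, C.comp_assoc, (uni X).1.1]
  rw [h2] at h1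
  have h3 := congrArg (fun z => C.comp (C.star (app Y)) z) h1
  simp only [← C.comp_assoc] at h3
  rw [(uni Y).1.2, (uni Y).1.2] at h3
  simpa only [← C.comp_assoc] using h3

theorem IsUnitaryEquiv.faithful (h : IsUnitaryEquiv F) {X Y : C.Obj} (f : C.Hom X Y)
    (hf : F.map f = 0) : f = 0 := by
  obtain ⟨H, ⟨t⟩, _⟩ := h
  exact t.faithful f hf

theorem IsUnitaryEquiv.full (h : IsUnitaryEquiv F) {X Y : C.Obj}
    (d : D.Hom (F.obj X) (F.obj Y)) : ∃ f : C.Hom X Y, F.map f = d := by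
  obtain ⟨H, ⟨t⟩, ⟨t'⟩⟩ := h
  obtain ⟨f, hf⟩ := t.exists_full (H.map d)
  refine ⟨f, ?_⟩
  rw [← sub_eq_zero]
  apply t'.faithful
  rw [H.map_sub, hf, sub_self]

theorem IsUnitaryEquiv.essSurj (h : IsUnitaryEquiv F) (Y : D.Obj) :
    ∃ (X : C.Obj) (u : D.Hom (F.obj X) Y), IsUnitary D u := by
  obtain ⟨H, ⟨t⟩, ⟨t'⟩⟩ := h
  exact ⟨H.obj Y, t'.app Y, t'.unitary Y⟩

theorem norm_ev_unitary_le {X Y : D.Obj} (u : D.Hom X Y) (hu : IsIdentityAt D (D.comp (D.star u) u)) :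
    D.maxNorm u ≤ 1 := by
  apply maxNorm_le
  intro U _ ρ
  have h1 : ρ.ev (D.comp (D.star u) u) * ρ.ev (D.comp (D.star u) u) =
      ρ.ev (D.comp (D.star u) u) := by
    rw [← ev_comp, hu.1]
  have h2 : star (ρ.ev (D.comp (D.star u) u)) = ρ.ev (D.comp (D.star u) u) := by
    rw [← ev_star, D.star_comp, D.star_star]
  set p := ρ.ev (D.comp (D.star u) u)
  have h3 : ‖p‖ = ‖p‖ * ‖p‖ := by
    rw [← CStarRing.norm_star_mul_self, h2, h1]
  have h4 : ‖p‖ = ‖ρ.ev u‖ * ‖ρ.ev u‖ := by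
    rw [← CStarRing.norm_star_mul_self, ← ev_star, ← ev_comp]
  have h5 : ‖ρ.ev u‖ ≤ 1 := by
    by_contra hcon
    push Not at hcon
    have : 1 < ‖p‖ := by nlinarith
    nlinarith
  rw [← ofReal_norm]
  exact ENNReal.ofReal_le_one.2 h5

theorem IsUnitaryEquiv.norm_map (h : IsUnitaryEquiv F) {X Y : C.Obj} (f : C.Hom X Y) :
    C.maxNorm f ≤ D.maxNorm (F.map f) := by
  obtain ⟨H, ⟨t⟩, _⟩ := h
  obtain ⟨app, nat, uni⟩ := t.exists_data
  have e1 : f = C.comp (app Y) (C.comp (H.map (F.map f)) (C.star (app X))) := by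
    rw [← C.comp_assoc, nat, C.comp_assoc, (uni X).2.1]
  have h3 := norm_ev_unitary_le _ (uni Y).1
  have h4 := norm_ev_unitary_le _ (uni X).1
  rw [← maxNorm_star] at h4
  have h5 := maxNorm_comp_le (H.map (F.map f)) (C.star (app X))
  have h1 := maxNorm_comp_le (app Y) (C.comp (H.map (F.map f)) (C.star (app X)))
  rw [← e1] at h1
  refine h1.trans ?_
  calc _ ≤ 1 * (D.maxNorm (F.map f) * 1) := by
        refine mul_le_mul' h3 (h5.trans (mul_le_mul' (maxNorm_map_le _ _) h4))
    _ = _ := by simp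

theorem IsUnitaryEquiv.of_ff (hC : C.IsUnital) (hF : F.Unital)
    (hfaith : ∀ {X Y : C.Obj} (f : C.Hom X Y), F.map f = 0 → f = 0)
    (hfull : ∀ {X Y : C.Obj} (d : D.Hom (F.obj X) (F.obj Y)), ∃ f : C.Hom X Y, F.map f = d)
    (hes : ∀ Y : D.Obj, ∃ (X : C.Obj) (u : D.Hom (F.obj X) Y), IsUnitary D u) :
    IsUnitaryEquiv F := by
  choose o u hu using hes
  choose L hL using fun (X Y : C.Obj) (d : D.Hom (F.obj X) (F.obj Y)) => hfull d
  have inj : ∀ {X Y : C.Obj} (f f' : C.Hom X Y), F.map f = F.map f' → f = f' := by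
    intro X Y f f' h
    rw [← sub_eq_zero]
    apply hfaith
    rw [F.map_sub, h, sub_self]
  have c1 : ∀ {X Z : D.Obj} (f : D.Hom X Z), D.comp (D.comp (u Z) (D.star (u Z))) f = f :=
    fun f => (hu _).2.2 _ f
  let H : StarFunctor D C :=
    { obj := o
      map := fun {X Y} d => L _ _ (D.comp (D.star (u Y)) (D.comp d (u X)))
      map_add := by
        intro X Y f f'
        apply inj
        rw [F.map_add, hL, hL, hL, D.add_comp, D.comp_add]
      map_smul := by
        intro X Y c f
        apply inj
        rw [F.map_smul, hL, hL, D.smul_comp, D.comp_smul]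
      map_comp := by
        intro X Y Z g f
        apply inj
        rw [F.map_comp, hL, hL, hL]
        have := c1 (D.comp f (u X))
        simp only [D.comp_assoc] at this ⊢
        rw [this]
      map_star := by
        intro X Y f
        apply inj
        rw [F.map_star, hL, hL]
        simp only [D.star_comp, D.star_star, D.comp_assoc] }
  have hHF : ∀ {X Y : D.Obj} (d : D.Hom X Y),
      F.map (H.map d) = D.comp (D.star (u Y)) (D.comp d (u X)) := fun d => hL _ _ _
  have idlift : ∀ {X : C.Obj} (f : C.Hom X X), IsIdentityAt D (F.map f) → IsIdentityAt C f := by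
    intro X f hf
    obtain ⟨e, he⟩ := hC X
    have := (hF X e he).unique hf
    rw [← inj _ _ this]
    exact he
  let app : ∀ X : C.Obj, C.Hom (o (F.obj X)) X := fun X => L _ _ (u (F.obj X))
  have happ : ∀ X, F.map (app X) = u (F.obj X) := fun X => hL _ _ _
  have hnat : ∀ (X Y : C.Obj) (f : C.Hom X Y),
      C.comp (app Y) (H.map (F.map f)) = C.comp f (app X) := by
    intro X Y f
    apply inj
    rw [F.map_comp, F.map_comp, happ]
    refine (congrArg (D.comp (u (F.obj Y))) (hHF (F.map f))).trans ?_
    rw [happ, ← D.comp_assoc]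
    exact c1 _
  have huni : ∀ X, IsUnitary C (app X) := by
    intro X
    constructor
    · apply idlift
      have h := (hu (F.obj X)).1
      rw [← happ, ← F.map_star, ← F.map_comp] at h
      exact h
    · apply idlift
      have h := (hu (F.obj X)).2
      rw [← happ, ← F.map_star, ← F.map_comp] at h
      exact h
  have hnat' : ∀ (X Y : D.Obj) (f : D.Hom X Y),
      D.comp (u Y) (F.map (H.map f)) = D.comp f (u X) := by
    intro X Y f
    refine (congrArg (D.comp (u Y)) (hHF f)).trans ?_
    rw [← D.comp_assoc]
    exact c1 _
  exact ⟨H, ⟨⟨app, hnat, huni⟩⟩, ⟨⟨fun Y => u Y, hnat', hu⟩⟩⟩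

end Equivalence

/-! ### Isomorphisms of categories and transport of excisive squares -/

section Transport
open StarCatNu hiding star_add star_smul star_star star_sub star_neg star
open StarFunctor hiding map_add map_smul map_neg map_sub map_zero map_star

/-- An isomorphism of ∗-categories. -/
def StarFunctor.IsIso {C D : StarCatNu} (F : StarFunctor C D) : Prop :=
  ∃ F' : StarFunctor D C, F.comp F' = StarFunctor.id C ∧ F'.comp F = StarFunctor.id D

namespace StarFunctor.IsIso
variable {C D : StarCatNu} {F : StarFunctor C D}

theorem obj_bij (h : F.IsIso) : Function.Bijective F.obj := by
  obtain ⟨F', h1, h2⟩ := h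
  refine Function.bijective_iff_has_inverse.2 ⟨F'.obj, fun X => ?_, fun X => ?_⟩
  · exact obj_congr h1 X
  · exact obj_congr h2 X

theorem eq_zero (h : F.IsIso) {X Y : C.Obj} (f : C.Hom X Y) (hf : F.map f = 0) : f = 0 := by
  obtain ⟨F', h1, h2⟩ := h
  refine (zero_congr h1 f).1 ?_
  show F'.map (F.map f) = 0
  rw [hf, F'.map_zero]

theorem inj (h : F.IsIso) {X Y : C.Obj} (f f' : C.Hom X Y) (hf : F.map f = F.map f') : f = f' := by
  rw [← sub_eq_zero]
  apply h.eq_zero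
  rw [F.map_sub, hf, sub_self]

theorem full (h : F.IsIso) {X Y : C.Obj} (d : D.Hom (F.obj X) (F.obj Y)) :
    ∃ f : C.Hom X Y, F.map f = d := by
  obtain ⟨F', h1, h2⟩ := h
  have hX : F'.obj (F.obj X) = X := obj_congr h1 X
  have hY : F'.obj (F.obj Y) = Y := obj_congr h1 Y
  refine ⟨C.castHom hX hY (F'.map d), ?_⟩
  rw [F.map_castHom]
  exact map_congr h2 d

theorem symm (h : F.IsIso) : ∃ F' : StarFunctor D C, F'.IsIso ∧ F.comp F' = StarFunctor.id C ∧
    F'.comp F = StarFunctor.id D := by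
  obtain ⟨F', h1, h2⟩ := h
  exact ⟨F', ⟨F, h2, h1⟩, h1, h2⟩

end StarFunctor.IsIso

theorem IsExactSeq.transport {C D C' D' Q : StarCatNu} {i : StarFunctor C D} {q : StarFunctor D Q}
    (h : IsExactSeq i q) {i' : StarFunctor C' D'} {a : StarFunctor C' C} {b : StarFunctor D' D}
    (ha : a.IsIso) (hb : b.IsIso) (hab : i'.comp b = a.comp i) : IsExactSeq i' (b.comp q) where
  i_obj_bij := by
    have h1 : b.obj ∘ i'.obj = i.obj ∘ a.obj := funext fun X => obj_congr hab X
    have h2 : Function.Bijective (b.obj ∘ i'.obj) := by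
      rw [h1]; exact h.i_obj_bij.comp ha.obj_bij
    exact (Function.Bijective.of_comp_iff' hb.obj_bij _).1 h2
  i_map_inj X Y := by
    intro f f' hf
    have hf : i'.map f = i'.map f' := hf
    rw [← sub_eq_zero]
    apply ha.eq_zero
    apply h.i_map_inj
    show i.map _ = i.map _
    rw [i.map_zero]
    refine (zero_congr hab (f - f')).1 ?_
    show b.map (i'.map (f - f')) = 0
    rw [i'.map_sub, hf, sub_self, b.map_zero]
  p_quot := by
    refine ⟨h.p_quot.1.comp hb.obj_bij, fun X Y f => ?_⟩
    obtain ⟨d, hd⟩ := h.p_quot.2 _ _ f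
    obtain ⟨d', rfl⟩ := hb.full d
    exact ⟨d', hd⟩
  exact X Y f := by
    have hX : b.obj (i'.obj X) = i.obj (a.obj X) := obj_congr hab X
    have hY : b.obj (i'.obj Y) = i.obj (a.obj Y) := obj_congr hab Y
    have e := h.exact (a.obj X) (a.obj Y) (D.castHom hX hY (b.map f))
    have e1 : q.map (D.castHom hX hY (b.map f)) = 0 ↔ q.map (b.map f) = 0 := by
      rw [q.map_castHom, castHom_eq_iff, castHom_zero]
    rw [e1] at e
    refine e.trans ⟨?_, ?_⟩
    · rintro ⟨g, hg⟩
      obtain ⟨g, rfl⟩ := ha.full g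
      refine ⟨g, ?_⟩
      apply hb.inj
      have := (map_congr hab g).trans hg
      exact (((castHom_eq_iff _ _ _ _).1 this).trans (castHom_castHom _ _ _ _ _))
    · rintro ⟨g, rfl⟩
      exact ⟨a.map g, (map_congr hab g).symm⟩

theorem IsExcisive.transport {A B C D A' B' C' D' : StarCatNu}
    {i₁ : StarFunctor A B} {v₁ : StarFunctor A C} {v₂ : StarFunctor B D} {i₂ : StarFunctor C D}
    {i₁' : StarFunctor A' B'} {v₁' : StarFunctor A' C'} {v₂' : StarFunctor B' D'}
    {i₂' : StarFunctor C' D'} (h : IsExcisive i₁' v₁' v₂' i₂')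
    {a : StarFunctor A' A} {b : StarFunctor B' B} {c : StarFunctor C' C} {d : StarFunctor D' D}
    (ha : a.IsIso) (hb : b.IsIso) (hc : c.IsIso) (hd : d.IsIso)
    (e1 : i₁'.comp b = a.comp i₁) (e2 : v₁'.comp c = a.comp v₁) (e3 : v₂'.comp d = b.comp v₂)
    (e4 : i₂'.comp d = c.comp i₂) : IsExcisive i₁ v₁ v₂ i₂ := by
  obtain ⟨a', ha', a1, a2⟩ := ha.symm
  obtain ⟨b', hb', b1, b2⟩ := hb.symm
  obtain ⟨c', hc', c1, c2⟩ := hc.symm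
  obtain ⟨d', hd', d1, d2⟩ := hd.symm
  have key : ∀ {X Y Z W : StarCatNu} {f : StarFunctor X Y} {f' : StarFunctor Y X}
      {g : StarFunctor Z W} {g' : StarFunctor W Z} {j : StarFunctor Y W} {j' : StarFunctor X Z},
      f'.comp f = StarFunctor.id Y → g.comp g' = StarFunctor.id Z → j'.comp g = f.comp j →
      j.comp g' = f'.comp j' := by
    intro X Y Z W f f' g g' j j' hf hg hj
    calc j.comp g' = ((f'.comp f).comp j).comp g' := by rw [hf]; rfl
      _ = (f'.comp (f.comp j)).comp g' := rfl
      _ = (f'.comp (j'.comp g)).comp g' := by rw [hj]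
      _ = f'.comp (j'.comp (g.comp g')) := rfl
      _ = f'.comp j' := by rw [hg]; rfl
  refine ⟨?_, ?_, ?_, ?_⟩
  · calc i₁.comp v₂ = (a'.comp a).comp (i₁.comp v₂) := by rw [a2]; rfl
      _ = a'.comp ((a.comp i₁).comp v₂) := rfl
      _ = a'.comp ((i₁'.comp b).comp v₂) := by rw [e1]
      _ = a'.comp (i₁'.comp (b.comp v₂)) := rfl
      _ = a'.comp (i₁'.comp (v₂'.comp d)) := by rw [e3]
      _ = a'.comp ((i₁'.comp v₂').comp d) := rfl
      _ = a'.comp ((v₁'.comp i₂').comp d) := by rw [h.comm]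
      _ = a'.comp (v₁'.comp (i₂'.comp d)) := rfl
      _ = a'.comp ((v₁'.comp c).comp i₂) := by rw [e4]; rfl
      _ = (a'.comp a).comp (v₁.comp i₂) := by rw [e2]; rfl
      _ = v₁.comp i₂ := by rw [a2]; rfl
  · obtain ⟨Q, q, hQ, hq⟩ := h.exB
    exact ⟨Q, b'.comp q, hQ, hq.transport ha' hb' (key a2 b1 e1)⟩
  · obtain ⟨Q, q, hQ, hq⟩ := h.exD
    exact ⟨Q, d'.comp q, hQ, hq.transport hc' hd' (key c2 d1 e4)⟩
  · intro QB QD qB qD r hQB hQD hqB hqD hr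
    refine h.quot QB QD (b.comp qB) (d.comp qD) r hQB hQD (hqB.transport ha hb e1)
      (hqD.transport hc hd e4) ?_
    calc v₂'.comp (d.comp qD) = (v₂'.comp d).comp qD := rfl
      _ = b.comp (v₂.comp qD) := by rw [e3]; rfl
      _ = (b.comp qB).comp r := by rw [hr]; rfl

/-- Pull back a category along a map to its objects. -/
@[reducible] def StarCatNu.pull (E : StarCatNu) {O : Type} (o : O → E.Obj) : StarCatNu where
  Obj := O
  Hom X Y := E.Hom (o X) (o Y)
  homAddCommGroup X Y := E.homAddCommGroup (o X) (o Y)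
  homModule X Y := E.homModule (o X) (o Y)
  comp g f := E.comp g f
  star f := E.star f
  comp_assoc h g f := E.comp_assoc h g f
  add_comp g g' f := E.add_comp g g' f
  comp_add g f f' := E.comp_add g f f'
  smul_comp c g f := E.smul_comp c g f
  comp_smul c g f := E.comp_smul c g f
  star_star f := E.star_star f
  star_comp g f := E.star_comp g f
  star_add f f' := E.star_add f f'
  star_smul c f := E.star_smul c f

/-- The canonical functor from the pull back. -/
def StarCatNu.unpull (E : StarCatNu) {O : Type} (o : O → E.Obj) : StarFunctor (E.pull o) E where
  obj := o
  map f := f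
  map_add _ _ _ _ := rfl
  map_smul _ _ _ _ := rfl
  map_comp _ _ _ _ _ := rfl
  map_star _ _ _ := rfl

theorem StarCatNu.unpull_isIso (E : StarCatNu) {O : Type} (o : O → E.Obj)
    (ho : Function.Bijective o) : (E.unpull o).IsIso := by
  obtain ⟨s, hs1, hs2⟩ := Function.bijective_iff_has_inverse.1 ho
  let F : StarFunctor E (E.pull o) :=
    { obj := s
      map := fun {X Y} f => E.castHom (hs2 X).symm (hs2 Y).symm f
      map_add := fun X Y f f' => castHom_add _ _ _ _
      map_smul := fun X Y c f => castHom_smul _ _ _ _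
      map_comp := fun X Y Z g f => castHom_comp _ _ _ _ _
      map_star := fun X Y f => castHom_star _ _ _ }
  have aux : ∀ {X X' Y Y' : O} (hX : X = X') (hY : Y = Y') (f : E.Hom (o X) (o Y)),
      (E.pull o).castHom hX hY f = E.castHom (congrArg o hX) (congrArg o hY) f := by
    intro X X' Y Y' hX hY f
    subst hX hY; rfl
  refine ⟨F, ?_, ?_⟩
  · refine ext_cast (fun X => hs1 X) (fun X Y f => ?_)
    refine (aux (hs1 X) (hs1 Y) _).trans ?_
    exact castHom_castHom _ _ _ _ _
  · refine ext_cast (fun X => hs2 X) (fun X Y f => ?_)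
    exact castHom_castHom _ _ _ _ _

theorem StarFunctor.IsIso.norm_map {C D : StarCatNu} {F : StarFunctor C D} (h : F.IsIso)
    {X Y : C.Obj} (f : C.Hom X Y) : D.maxNorm (F.map f) = C.maxNorm f := by
  refine le_antisymm (maxNorm_map_le F f) ?_
  obtain ⟨F', h1, h2⟩ := h
  have := norm_congr h1 f
  exact this.symm.le.trans (maxNorm_map_le F' (F.map f))

theorem StarCatNu.pull_norm (E : StarCatNu) {O : Type} (o : O → E.Obj)
    (ho : Function.Bijective o) {X Y : O} (f : E.Hom (o X) (o Y)) :
    (E.pull o).maxNorm (X := X) (Y := Y) f = E.maxNorm f :=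
  ((E.unpull_isIso o ho).norm_map (X := X) (Y := Y) f).symm

theorem StarCatNu.pull_isCStar (E : StarCatNu) {O : Type} (o : O → E.Obj)
    (ho : Function.Bijective o) (hE : IsCStar E) : IsCStar (E.pull o) := by
  refine ⟨fun X Y f => ?_, fun X Y f hf => ?_, fun X Y u hu => ?_⟩
  · exact (E.pull_norm o ho f).trans_lt (hE.1 _ _ _)
  · exact hE.2.1 _ _ f ((E.pull_norm o ho f).symm.trans hf)
  · obtain ⟨f, hf⟩ := hE.2.2 (o X) (o Y) u (fun ε hε => by
      obtain ⟨N, hN⟩ := hu ε hε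
      exact ⟨N, fun m hm n hn =>
        (E.pull_norm o ho (X := X) (Y := Y) (E.homAddCommGroup _ _ |>.toSub.sub (u m) (u n))).symm.trans_lt (hN m hm n hn)⟩)
    refine ⟨f, fun ε hε => ?_⟩
    obtain ⟨N, hN⟩ := hf ε hε
    exact ⟨N, fun n hn => (E.pull_norm o ho _).trans_lt (hN n hn)⟩

end Transport

/-! ### The algebra of crossed products -/

section Crossed
open StarCatNu hiding star_add star_smul star_star star_sub star_neg star
open StarFunctor hiding map_add map_smul map_neg map_sub map_zero map_star

variable {G : Type} [Group G] {C D : StarCatNu} {α : GAction G C} {β : GAction G D}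
  {CG DG : StarCatNu}

theorem GAction.act_congr (α : GAction G C) {g g' : G} (hg : g = g') {X X' Y Y' : C.Obj}
    (hX : X = X') (hY : Y = Y') {f : C.Hom X Y} {f' : C.Hom X' Y'} (hf : HEq f f') :
    HEq (α.actMap g f) (α.actMap g' f') := by
  subst hg hX hY; rw [eq_of_heq hf]

theorem GAction.act_mul_heq (α : GAction G C) (g h : G) {X Y : C.Obj} (f : C.Hom X Y) :
    HEq (α.actMap g (α.actMap h f)) (α.actMap (g * h) f) :=
  (castHom_heq _ _ _).symm.trans (heq_of_eq (α.mul_map g h X Y f))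

theorem GAction.act_one_heq (α : GAction G C) {g : G} (hg : g = 1) {X Y : C.Obj} (f : C.Hom X Y) :
    HEq (α.actMap g f) f := by
  subst hg
  exact (castHom_heq _ _ _).symm.trans (heq_of_eq (α.one_map X Y f))

theorem GAction.act_one_obj (α : GAction G C) {g : G} (hg : g = 1) (X : C.Obj) :
    α.actObj g X = X := by
  subst hg; exact α.one_obj X

theorem GAction.act_inv_heq (α : GAction G C) (g : G) {X Y : C.Obj} (f : C.Hom X Y) :
    HEq (α.actMap g⁻¹ (α.actMap g f)) f :=
  (α.act_mul_heq _ _ f).trans (α.act_one_heq (inv_mul_cancel g) f)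

theorem EquivariantMap.heq {φ : StarFunctor C D} (hφ : EquivariantMap α β φ) (g : G)
    {X Y : C.Obj} (f : C.Hom X Y) : HEq (φ.map (α.actMap g f)) (β.actMap g (φ.map f)) :=
  (castHom_heq _ _ _).symm.trans (heq_of_eq (hφ.map_comm g X Y f))

namespace IsCrossedProductAlg

/-- The crossed product with the objects of the original category. -/
@[reducible] def cat (hC : IsCrossedProductAlg G C α CG) : StarCatNu := CG.pull hC.obj

/-- The generators. -/
def gen (hC : IsCrossedProductAlg G C α CG) (g : G) {X Y : C.Obj}
    (f : C.Hom X (α.actObj g⁻¹ Y)) : hC.cat.Hom X Y := hC.ins g f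

variable (hC : IsCrossedProductAlg G C α CG) (hD : IsCrossedProductAlg G D β DG)

theorem gen_add (g : G) {X Y : C.Obj} (f f' : C.Hom X (α.actObj g⁻¹ Y)) :
    hC.gen g (f + f') = hC.gen g f + hC.gen g f' := hC.ins_add g X Y f f'

theorem gen_smul (g : G) {X Y : C.Obj} (c : ℂ) (f : C.Hom X (α.actObj g⁻¹ Y)) :
    hC.gen g (c • f) = c • hC.gen g f := hC.ins_smul g X Y c f

theorem gen_comp (g g' : G) {X Y Z : C.Obj}
    (f : C.Hom X (α.actObj g⁻¹ Y)) (f' : C.Hom Y (α.actObj g'⁻¹ Z)) :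
    hC.cat.comp (hC.gen g' f') (hC.gen g f) =
      hC.gen (g' * g) (C.castHom rfl (α.inv_mul_obj g g' Z)
        (C.comp (α.actMap g⁻¹ f') f)) := hC.ins_comp g g' X Y Z f f'

theorem gen_star (g : G) {X Y : C.Obj} (f : C.Hom X (α.actObj g⁻¹ Y)) :
    hC.cat.star (hC.gen g f) =
      hC.gen g⁻¹ (C.castHom (α.cancel_obj g Y) (α.inv_inv_obj g X).symm
        (α.actMap g (C.star f))) := hC.ins_star g X Y f

theorem gen_congr {g g' : G} (hg : g = g') {X Y : C.Obj} {f : C.Hom X (α.actObj g⁻¹ Y)}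
    {f' : C.Hom X (α.actObj g'⁻¹ Y)} (hf : HEq f f') : hC.gen g f = hC.gen g' f' := by
  subst hg; rw [eq_of_heq hf]

/-- The generators as linear maps. -/
def genL (g : G) (X Y : C.Obj) : C.Hom X (α.actObj g⁻¹ Y) →ₗ[ℂ] hC.cat.Hom X Y where
  toFun f := hC.gen g f
  map_add' f f' := hC.gen_add g f f'
  map_smul' c f := hC.gen_smul g c f

theorem genL_apply (g : G) {X Y : C.Obj} (f : C.Hom X (α.actObj g⁻¹ Y)) :
    hC.genL g X Y f = hC.gen g f := rfl

open Classical in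
/-- The direct sum decomposition. -/
def equiv (X Y : C.Obj) : (Π₀ g : G, C.Hom X (α.actObj g⁻¹ Y)) ≃ₗ[ℂ] hC.cat.Hom X Y :=
  LinearEquiv.ofBijective (DFinsupp.lsum ℕ (fun g => hC.genL g X Y)) (by
    have key : ∀ w : Π₀ g : G, C.Hom X (α.actObj g⁻¹ Y),
        DFinsupp.lsum ℕ (fun g => hC.genL g X Y) w = ∑ g ∈ w.support, hC.gen g (w g) := by
      intro w
      rw [DFinsupp.lsum_apply_apply, DFinsupp.sumAddHom_apply]
      rfl
    constructor
    · rw [← LinearMap.ker_eq_bot, LinearMap.ker_eq_bot']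
      intro w hw
      rw [key] at hw
      ext g
      by_cases hg : g ∈ w.support
      · exact hC.indep X Y w.support (fun g => w g) hw g hg
      · exact DFinsupp.notMem_support_iff.1 hg
    · intro u
      obtain ⟨s, φ, hu⟩ := hC.span X Y u
      refine ⟨∑ g ∈ s, DFinsupp.single g (φ g), ?_⟩
      rw [map_sum, hu]
      refine Finset.sum_congr rfl fun g _ => ?_
      rw [DFinsupp.lsum_apply_apply, DFinsupp.sumAddHom_single]
      rfl)

open Classical in
theorem equiv_single (g : G) {X Y : C.Obj} (f : C.Hom X (α.actObj g⁻¹ Y)) :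
    hC.equiv X Y (DFinsupp.single g f) = hC.gen g f := by
  show DFinsupp.lsum ℕ (fun g => hC.genL g X Y) (DFinsupp.single g f) = _
  rw [DFinsupp.lsum_apply_apply, DFinsupp.sumAddHom_single]
  rfl

open Classical in
/-- The coefficients. -/
def coef (g : G) (X Y : C.Obj) : hC.cat.Hom X Y →ₗ[ℂ] C.Hom X (α.actObj g⁻¹ Y) :=
  (DFinsupp.lapply g) ∘ₗ (hC.equiv X Y).symm.toLinearMap

theorem coef_gen_same (g : G) {X Y : C.Obj} (f : C.Hom X (α.actObj g⁻¹ Y)) :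
    hC.coef g X Y (hC.gen g f) = f := by
  classical
  rw [← hC.equiv_single]
  simp [coef]

theorem coef_gen_ne (g g' : G) (h : g ≠ g') {X Y : C.Obj} (f : C.Hom X (α.actObj g⁻¹ Y)) :
    hC.coef g' X Y (hC.gen g f) = 0 := by
  classical
  rw [← hC.equiv_single]
  simp [coef, h]

theorem gen_sum_coef {X Y : C.Obj} (u : hC.cat.Hom X Y) :
    ∃ s : Finset G, u = ∑ g ∈ s, hC.gen g (hC.coef g X Y u) := by
  classical
  obtain ⟨w, rfl⟩ := (hC.equiv X Y).surjective u
  refine ⟨w.support, ?_⟩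
  have h1 : ∀ g, hC.coef g X Y (hC.equiv X Y w) = w g := fun g => by simp [coef]
  simp only [h1]
  conv_lhs => rw [← DFinsupp.sum_single (f := w)]
  rw [DFinsupp.sum, map_sum]
  exact Finset.sum_congr rfl fun g _ => hC.equiv_single g _

theorem ext_coef {X Y : C.Obj} {u u' : hC.cat.Hom X Y}
    (h : ∀ g, hC.coef g X Y u = hC.coef g X Y u') : u = u' := by
  classical
  apply (hC.equiv X Y).symm.injective
  ext g
  exact h g

/-- Induction on generators. -/
theorem ind {X Y : C.Obj} {P : hC.cat.Hom X Y → Prop} (h0 : P 0)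
    (hadd : ∀ u u', P u → P u' → P (u + u'))
    (hg : ∀ (g : G) (f : C.Hom X (α.actObj g⁻¹ Y)), P (hC.gen g f)) (u : hC.cat.Hom X Y) : P u := by
  obtain ⟨s, hs⟩ := hC.gen_sum_coef u
  rw [hs]
  exact Finset.sum_induction _ P hadd h0 fun g _ => hg g _

open Classical in
/-- Linear maps out of the crossed product. -/
def lift {X Y : C.Obj} {M : Type} [AddCommGroup M] [Module ℂ M]
    (T : ∀ g : G, C.Hom X (α.actObj g⁻¹ Y) →ₗ[ℂ] M) : hC.cat.Hom X Y →ₗ[ℂ] M :=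
  (DFinsupp.lsum ℕ T) ∘ₗ (hC.equiv X Y).symm.toLinearMap

theorem lift_gen {X Y : C.Obj} {M : Type} [AddCommGroup M] [Module ℂ M]
    (T : ∀ g : G, C.Hom X (α.actObj g⁻¹ Y) →ₗ[ℂ] M) (g : G) (f : C.Hom X (α.actObj g⁻¹ Y)) :
    hC.lift T (hC.gen g f) = T g f := by
  classical
  rw [← hC.equiv_single]
  simp [lift]

/-- The canonical inclusion of the category into the crossed product. -/
@[reducible] def emb : StarFunctor C hC.cat where
  obj X := X
  map {X Y} f := hC.gen 1 (C.castHom rfl (α.one_inv_obj Y).symm f)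
  map_add X Y f f' := by rw [castHom_add, gen_add]
  map_smul X Y c f := by rw [castHom_smul, gen_smul]
  map_comp X Y Z g f := by
    rw [gen_comp]
    refine hC.gen_congr (one_mul 1).symm ?_
    refine (castHom_heq _ _ _).trans (HEq.trans ?_ (castHom_heq _ _ _).symm)
    refine comp_heq rfl (α.one_inv_obj Y).symm ?_ ?_ (castHom_heq _ _ _).symm
    · rw [α.act_one_obj inv_one, α.one_inv_obj]
    · exact HEq.trans ((castHom_heq _ _ _).symm) (α.act_one_heq inv_one _).symm
  map_star X Y f := by
    rw [gen_star]
    refine hC.gen_congr inv_one.symm ?_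
    refine (castHom_heq _ _ _).trans (HEq.trans ?_ (castHom_heq _ _ _).symm)
    refine HEq.trans ?_ (α.act_one_heq rfl _).symm
    exact star_heq rfl (α.one_inv_obj Y).symm (castHom_heq _ _ _).symm

theorem emb_def {X Y : C.Obj} (f : C.Hom X Y) :
    hC.emb.map f = hC.gen 1 (C.castHom rfl (α.one_inv_obj Y).symm f) := rfl

theorem star_gen_comp_gen (g : G) {X Y : C.Obj} (f : C.Hom X (α.actObj g⁻¹ Y)) :
    hC.cat.comp (hC.cat.star (hC.gen g f)) (hC.gen g f) = hC.emb.map (C.comp (C.star f) f) := by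
  rw [gen_star, gen_comp, emb_def]
  refine hC.gen_congr (inv_mul_cancel g) ?_
  refine (castHom_heq _ _ _).trans (HEq.trans ?_ (castHom_heq _ _ _).symm)
  have e1 : α.actObj g⁻¹ Y = α.actObj g⁻¹ Y := rfl
  have e2 : α.actObj g⁻¹ (α.actObj g⁻¹⁻¹ X) = X := α.cancel_obj g⁻¹ X
  refine comp_heq rfl rfl e2 ?_ HEq.rfl
  refine HEq.trans (α.act_congr rfl (α.cancel_obj g Y).symm (α.inv_inv_obj g X) (castHom_heq _ _ _)) ?_
  exact α.act_inv_heq g _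

theorem emb_identity {X : C.Obj} {e : C.Hom X X} (he : IsIdentityAt C e) :
    IsIdentityAt hC.cat (X := X) (hC.emb.map e) := by
  have h1 : ∀ (Y : C.Obj) (u : hC.cat.Hom X Y), hC.cat.comp u (hC.emb.map e) = u := by
    intro Y u
    induction u using hC.ind with
    | h0 => exact zero_comp _ _
    | hadd u u' h h' => exact (add_comp _ _ _ _).trans (congrArg₂ _ h h')
    | hg g f =>
      refine (hC.gen_comp _ _ _ _).trans (hC.gen_congr (mul_one g) ?_)
      refine (castHom_heq _ _ _).trans ?_
      have : HEq (C.comp (α.actMap 1⁻¹ f) (C.castHom rfl (α.one_inv_obj X).symm e))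
          (C.comp f e) := by
        refine comp_heq rfl (α.one_inv_obj X) (α.one_inv_obj _) ?_ (castHom_heq _ _ _)
        exact α.act_one_heq inv_one f
      refine this.trans (heq_of_eq (he.1 _ f))
  refine ⟨h1, fun Y u => ?_⟩
  have h2 := congrArg hC.cat.star (h1 Y (hC.cat.star u))
  have h3 := hC.emb.map_star _ _ e
  rw [EndAlg.star_id he] at h3
  refine Eq.trans ?_ (h2.trans (hC.cat.star_star u))
  refine Eq.trans ?_ (hC.cat.star_comp _ _).symm
  exact congrArg₂ hC.cat.comp h3 (hC.cat.star_star u).symm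

variable {φ : StarFunctor C D} (hφ : EquivariantMap α β φ)

/-- The linear map on summands. -/
def summand (g : G) (X Y : C.Obj) :
    C.Hom X (α.actObj g⁻¹ Y) →ₗ[ℂ] D.Hom (φ.obj X) (β.actObj g⁻¹ (φ.obj Y)) where
  toFun f := D.castHom rfl (hφ.obj_comm g⁻¹ Y) (φ.map f)
  map_add' f f' := by rw [φ.map_add, castHom_add]
  map_smul' c f := by rw [φ.map_smul, castHom_smul]; rfl

theorem summand_heq (g : G) {X Y : C.Obj} (f : C.Hom X (α.actObj g⁻¹ Y)) :
    HEq (summand hφ g X Y f) (φ.map f) :=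
  castHom_heq rfl (hφ.obj_comm g⁻¹ Y) (φ.map f)

/-- The map on morphisms induced by an equivariant functor. -/
def indL (X Y : C.Obj) : hC.cat.Hom X Y →ₗ[ℂ] hD.cat.Hom (φ.obj X) (φ.obj Y) :=
  hC.lift (fun g => hD.genL g (φ.obj X) (φ.obj Y) ∘ₗ summand hφ g X Y)

theorem indL_gen (g : G) {X Y : C.Obj} (f : C.Hom X (α.actObj g⁻¹ Y)) :
    indL hC hD hφ X Y (hC.gen g f) = hD.gen g (summand hφ g X Y f) := hC.lift_gen _ g f

/-- The functor between crossed products induced by an equivariant functor. -/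
@[reducible] def induced : StarFunctor hC.cat hD.cat where
  obj := φ.obj
  map {X Y} u := indL hC hD hφ X Y u
  map_add X Y u u' := map_add _ _ _
  map_smul X Y c u := map_smul _ _ _
  map_comp X Y Z v u := by
    induction u using hC.ind with
    | h0 => rw [comp_zero]; erw [map_zero, map_zero, comp_zero]
    | hadd u u' h h' => rw [comp_add]; erw [map_add, map_add, comp_add]; exact congrArg₂ _ h h'
    | hg g f =>
      induction v using hC.ind with
      | h0 => rw [zero_comp]; erw [map_zero, map_zero, zero_comp]
      | hadd u u' h h' => rw [add_comp]; erw [map_add, map_add, add_comp]; exact congrArg₂ _ h h'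
      | hg g' f' =>
        rw [gen_comp, indL_gen, indL_gen, indL_gen]
        refine Eq.trans ?_ (hD.gen_comp _ _ _ _).symm
        refine hD.gen_congr rfl ?_
        refine (summand_heq hφ _ _).trans (HEq.trans ?_ (castHom_heq _ _ _).symm)
        rw [map_castHom]
        refine (castHom_heq _ _ _).trans ?_
        rw [φ.map_comp]
        refine comp_heq rfl (hφ.obj_comm _ _) ?_ ?_ (summand_heq hφ _ _).symm
        · rw [hφ.obj_comm, hφ.obj_comm]
        · refine (hφ.heq _ _).trans ?_
          exact β.act_congr rfl rfl (hφ.obj_comm _ _) (summand_heq hφ _ _).symm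
  map_star X Y u := by
    induction u using hC.ind with
    | h0 => rw [star_zero']; erw [map_zero, map_zero, star_zero']
    | hadd u u' h h' =>
      rw [hC.cat.star_add]; erw [map_add, map_add, hD.cat.star_add]; exact congrArg₂ _ h h'
    | hg g f =>
      rw [gen_star, indL_gen, indL_gen]
      refine Eq.trans ?_ (hD.gen_star _ _).symm
      refine hD.gen_congr rfl ?_
      refine (summand_heq hφ _ _).trans (HEq.trans ?_ (castHom_heq _ _ _).symm)
      rw [map_castHom]
      refine (castHom_heq _ _ _).trans ?_
      refine (hφ.heq _ _).trans ?_
      rw [φ.map_star]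
      refine β.act_congr rfl (hφ.obj_comm _ _) rfl ?_
      exact star_heq rfl (hφ.obj_comm _ _) (summand_heq hφ _ _).symm

theorem induced_gen (g : G) {X Y : C.Obj} (f : C.Hom X (α.actObj g⁻¹ Y)) :
    (induced hC hD hφ).map (hC.gen g f) =
      hD.gen g (D.castHom rfl (hφ.obj_comm g⁻¹ Y) (φ.map f)) := indL_gen hC hD hφ g f

theorem coef_induced (g : G) {X Y : C.Obj} (u : hC.cat.Hom X Y) :
    hD.coef g (φ.obj X) (φ.obj Y) ((induced hC hD hφ).map u) =
      D.castHom rfl (hφ.obj_comm g⁻¹ Y) (φ.map (hC.coef g X Y u)) := by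
  show hD.coef g (φ.obj X) (φ.obj Y) (indL hC hD hφ X Y u) = summand hφ g X Y (hC.coef g X Y u)
  induction u using hC.ind with
  | h0 => simp
  | hadd u u' h h' => simp only [map_add, h, h']
  | hg g' f =>
    rw [indL_gen]
    by_cases hg : g' = g
    · subst hg
      rw [coef_gen_same, coef_gen_same]
    · rw [coef_gen_ne _ _ _ hg, coef_gen_ne _ _ _ hg, map_zero]

theorem induced_emb {X Y : C.Obj} (f : C.Hom X Y) :
    (induced hC hD hφ).map (hC.emb.map f) = hD.emb.map (φ.map f) := by
  refine (induced_gen hC hD hφ _ _).trans (hD.gen_congr rfl ?_)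
  refine (castHom_heq _ _ _).trans (HEq.trans ?_ (castHom_heq _ _ _).symm)
  exact φ.map_heq rfl (α.one_inv_obj Y) (castHom_heq _ _ _)

/-- The morphisms with coefficients in an ideal. -/
def idealSub (I : CIdeal C) (X Y : C.Obj) : Submodule ℂ (hC.cat.Hom X Y) :=
  ⨅ g, (I.I X (α.actObj g⁻¹ Y)).comap (hC.coef g X Y)

theorem mem_idealSub (I : CIdeal C) {X Y : C.Obj} (u : hC.cat.Hom X Y) :
    u ∈ hC.idealSub I X Y ↔ ∀ g, hC.coef g X Y u ∈ I.I X (α.actObj g⁻¹ Y) := by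
  simp only [idealSub, Submodule.mem_iInf, Submodule.mem_comap]

theorem gen_mem_idealSub (I : CIdeal C) (g : G) {X Y : C.Obj} (f : C.Hom X (α.actObj g⁻¹ Y))
    (hf : f ∈ I.I X (α.actObj g⁻¹ Y)) : hC.gen g f ∈ hC.idealSub I X Y := by
  rw [mem_idealSub]
  intro g'
  by_cases h : g = g'
  · subst h; rwa [coef_gen_same]
  · rw [coef_gen_ne _ _ _ h]; exact zero_mem _

theorem ideal_ind (I : CIdeal C) {X Y : C.Obj} {P : hC.cat.Hom X Y → Prop} (h0 : P 0)
    (hadd : ∀ u u', P u → P u' → P (u + u'))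
    (hg : ∀ (g : G) (f : C.Hom X (α.actObj g⁻¹ Y)), f ∈ I.I X (α.actObj g⁻¹ Y) → P (hC.gen g f))
    (u : hC.cat.Hom X Y) (hu : u ∈ hC.idealSub I X Y) : P u := by
  rw [mem_idealSub] at hu
  obtain ⟨s, hs⟩ := hC.gen_sum_coef u
  rw [hs]
  exact Finset.sum_induction _ P hadd h0 fun g _ => hg g _ (hu g)

/-- The ideal of the crossed product given by an invariant ideal. -/
def ideal (I : CIdeal C)
    (hI : ∀ (g : G) {X Y : C.Obj} (f : C.Hom X Y), f ∈ I.I X Y →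
      α.actMap g f ∈ I.I (α.actObj g X) (α.actObj g Y)) :
    CIdeal hC.cat where
  I := hC.idealSub I
  comp_left := by
    intro X Y Z v u hu
    refine hC.ideal_ind I (P := fun u => hC.cat.comp v u ∈ hC.idealSub I X Z) ?_ ?_ ?_ u hu
    · rw [comp_zero]; exact zero_mem _
    · intro u u' h h'; rw [comp_add]; exact add_mem h h'
    · intro g f hf
      induction v using hC.ind with
      | h0 => rw [zero_comp]; exact zero_mem _
      | hadd v v' h h' => rw [add_comp]; exact add_mem h h'
      | hg g' f' =>
        rw [gen_comp]
        apply gen_mem_idealSub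
        rw [ideal_castHom]
        exact I.comp_left _ _ hf
  comp_right := by
    intro X Y Z v u hv
    refine hC.ideal_ind I (P := fun v => hC.cat.comp v u ∈ hC.idealSub I X Z) ?_ ?_ ?_ v hv
    · rw [zero_comp]; exact zero_mem _
    · intro u u' h h'; rw [add_comp]; exact add_mem h h'
    · intro g' f' hf'
      induction u using hC.ind with
      | h0 => rw [comp_zero]; exact zero_mem _
      | hadd v v' h h' => rw [comp_add]; exact add_mem h h'
      | hg g f =>
        rw [gen_comp]
        apply gen_mem_idealSub
        rw [ideal_castHom]
        exact I.comp_right _ _ (hI _ _ hf')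
  star_mem := by
    intro X Y u hu
    refine hC.ideal_ind I (P := fun u => hC.cat.star u ∈ hC.idealSub I Y X) ?_ ?_ ?_ u hu
    · rw [star_zero']; exact zero_mem _
    · intro u u' h h'; rw [hC.cat.star_add]; exact add_mem h h'
    · intro g f hf
      rw [gen_star]
      apply gen_mem_idealSub
      rw [ideal_castHom]
      exact hI _ _ (I.star_mem _ hf)

end IsCrossedProductAlg
end Crossed

/-! ### Inclusions of ideals are isometric -/

section Isometry
open StarCatNu hiding star_add star_smul star_star star_sub star_neg star
open StarFunctor hiding map_add map_smul map_neg map_sub map_zero map_star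

/-- Algebraic boundedness of a morphism. -/
def StarCatNu.Good (E : StarCatNu) {Z W : E.Obj} (f : E.Hom Z W) : Prop :=
  ∃ (K : ℝ) (γ : E.Hom Z Z), 0 ≤ K ∧ ∀ (X : E.Obj) (h : E.Hom X Z),
    E.comp (E.star f) (E.comp f h) = (K : ℂ) • h - E.comp (E.star γ) (E.comp γ h)

theorem exists_functional {U : Type} [NonUnitalCStarAlgebra U] (b x : U) (hb : b = star x * x)
    (c : ℝ) (hc0 : 0 ≤ c) (hc : c < ‖b‖) : ∃ l : U →ₗ[ℂ] ℂ, (∀ x : U, 0 ≤ (l (star x * x)).re) ∧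
      (∀ x, l (star x) = (starRingEnd ℂ) (l x)) ∧ c * (l b).re < (l (b * b)).re := by
  let := CStarAlgebra.spectralOrder U
  have := CStarAlgebra.spectralOrderedRing U
  have hb0 : 0 ≤ b := hb ▸ star_mul_self_nonneg x
  have hbs : star b = b := by rw [hb]; simp
  let S : Set U := {x | 0 ≤ x + star x}
  have hS : IsClosed S :=
    (CStarAlgebra.isClosed_nonneg (A := U)).preimage (f := fun x : U => x + star x) (by fun_prop)
  have hbb : 0 ≤ b * b := by
    have := star_mul_self_nonneg b
    rwa [hbs] at this
  obtain ⟨l, h1, h2, h3⟩ := exists_pos_functional S (by simp [S]) (by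
      intro x hx y hy
      have : x + y + star (x + y) = (x + star x) + (y + star y) := by rw [star_add]; abel
      show 0 ≤ x + y + star (x + y)
      rw [this]; exact add_nonneg hx hy) (by
      intro c hc x hx
      have : (c : ℂ) • x + star ((c : ℂ) • x) = c • (x + star x) := by
        rw [Complex.coe_smul, star_smul, smul_add]; simp
      show 0 ≤ (c : ℂ) • x + star ((c : ℂ) • x)
      rw [this]; exact smul_nonneg hc hx) (by
      intro x hx
      simp [S, hx]) ((c : ℂ) • b - b * b) (by
      rw [hS.closure_eq]
      intro hy
      have hy : 0 ≤ ((c : ℂ) • b - b * b) + star ((c : ℂ) • b - b * b) := hy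
      have e : ((c : ℂ) • b - b * b) + star ((c : ℂ) • b - b * b) =
          (2 : ℝ) • (c • b - b * b) := by
        rw [Complex.coe_smul, star_sub, star_smul, star_mul, hbs, two_smul]; simp
      rw [e] at hy
      have hy : 0 ≤ c • b - b * b := by
        have := smul_nonneg (a := (1/2 : ℝ)) (by norm_num) hy
        rwa [smul_smul, show (1/2 : ℝ) * 2 = 1 by norm_num, one_smul] at this
      have hle := CStarAlgebra.norm_le_norm_of_nonneg_of_le hbb (sub_nonneg.1 hy)
      have e2 : ‖b * b‖ = ‖b‖ * ‖b‖ := by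
        conv_lhs => rw [← hbs]
        nth_rewrite 2 [hbs]
        exact CStarRing.norm_star_mul_self
      rw [e2, norm_smul, Real.norm_eq_abs] at hle
      rw [abs_of_nonneg hc0] at hle
      nlinarith [norm_nonneg b])
  refine ⟨l, fun x => ?_, h2, ?_⟩
  · apply h1
    show 0 ≤ star x * x + star (star x * x)
    rw [star_mul, star_star]
    exact add_nonneg (star_mul_self_nonneg x) (star_mul_self_nonneg x)
  · rw [map_sub, map_smul, Complex.sub_re, smul_eq_mul, Complex.re_ofReal_mul] at h3
    linarith

theorem norm_le_of_ideal {A B : StarCatNu} (ψ : StarFunctor A B) (J : CIdeal B)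
    (hobj : Function.Surjective ψ.obj)
    (inj : ∀ {X Y : A.Obj} (f : A.Hom X Y), ψ.map f = 0 → f = 0)
    (himg : ∀ {X Y : A.Obj} (u : B.Hom (ψ.obj X) (ψ.obj Y)), u ∈ J.I _ _ ↔ ∃ a, ψ.map a = u)
    (hind : ∀ {Z W : B.Obj} {P : B.Hom Z W → Prop}, P 0 → (∀ u u', P u → P u' → P (u + u')) →
      (∀ u, B.Good u → P u) → ∀ u, P u)
    {X Y : A.Obj} (a : A.Hom X Y) : A.maxNorm a ≤ B.maxNorm (ψ.map a) := by
  by_contra hcon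
  push Not at hcon
  obtain ⟨U, _, ρ, hρ⟩ := exists_of_lt_maxNorm hcon
  have hfin : B.maxNorm (ψ.map a) ≠ ⊤ := hcon.ne_top
  set r := (B.maxNorm (ψ.map a)).toReal with hr
  have hr' : r < ‖ρ.ev a‖ := by
    rw [← ofReal_norm, ← ENNReal.ofReal_toReal hfin] at hρ
    exact (ENNReal.ofReal_lt_ofReal_iff_of_nonneg ENNReal.toReal_nonneg).1 hρ
  have hr0 : 0 ≤ r := ENNReal.toReal_nonneg
  obtain ⟨l, hl1, hl2, hl3⟩ := exists_functional (star (ρ.ev a) * ρ.ev a) (ρ.ev a) rfl (r ^ 2) (by positivity) (by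
    rw [CStarRing.norm_star_mul_self]; nlinarith)
  obtain ⟨p, hp⟩ := LinearMap.exists_leftInverse_of_injective (ψ.mapLin X X)
    (LinearMap.ker_eq_bot'.2 fun f hf => inj f hf)
  have hp' : ∀ f : A.Hom X X, p (ψ.map f) = f := fun f => LinearMap.congr_fun hp f
  let l' : B.Hom (ψ.obj X) (ψ.obj X) →ₗ[ℂ] ℂ := l ∘ₗ ρ.evLin X X ∘ₗ p
  have hl' : ∀ f : A.Hom X X, l' (ψ.map f) = l (ρ.ev f) := by
    intro f
    show l (ρ.ev (p (ψ.map f))) = _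
    rw [hp']
  have hpos : ∀ (Z : B.Obj) (h : B.Hom (ψ.obj X) Z), h ∈ J.I _ Z →
      0 ≤ (l' (B.comp (B.star h) h)).re := by
    intro Z h hh
    obtain ⟨Z, rfl⟩ := hobj Z
    obtain ⟨h, rfl⟩ := (himg h).1 hh
    rw [← ψ.map_star, ← ψ.map_comp, hl', ev_comp, ev_star]
    exact hl1 _
  let d : GNSData B :=
    { X := ψ.obj X
      L := fun Z => J.I _ Z
      L_comp := fun f h hh => J.comp_left _ _ hh
      l := l'
      l_symm := by
        intro Z h k hh hk
        obtain ⟨Z, rfl⟩ := hobj Z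
        obtain ⟨h, rfl⟩ := (himg h).1 hh
        obtain ⟨k, rfl⟩ := (himg k).1 hk
        rw [← ψ.map_star, ← ψ.map_comp, hl', ← ψ.map_star, ← ψ.map_comp, hl', ← hl2, ← ev_star,
          A.star_comp, A.star_star]
      l_pos := hpos
      bdd := by
        intro Z W f
        refine hind (P := fun f => ∃ K : ℝ, 0 ≤ K ∧ ∀ h : B.Hom (ψ.obj X) Z, h ∈ J.I _ Z →
          (l' (B.comp (B.star (B.comp f h)) (B.comp f h))).re ≤ K * (l' (B.comp (B.star h) h)).re)
          ?_ ?_ ?_ f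
        · refine ⟨0, le_rfl, fun h hh => ?_⟩
          rw [zero_comp, comp_zero, map_zero]
          simp
        · rintro u u' ⟨K, hK, h1⟩ ⟨K', hK', h2⟩
          refine ⟨2 * K + 2 * K', by positivity, fun h hh => ?_⟩
          have a1 := h1 h hh
          have a2 := h2 h hh
          have a3 := hpos _ (B.comp u h - B.comp u' h)
            (sub_mem (J.comp_left _ _ hh) (J.comp_left _ _ hh))
          rw [B.add_comp]
          simp only [B.star_add, B.star_sub, B.comp_add, B.comp_sub, B.add_comp, B.sub_comp, map_add,
            map_sub, Complex.add_re, Complex.sub_re] at a3 ⊢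
          linarith
        · rintro u ⟨K, γ, hK, hγ⟩
          refine ⟨K, hK, fun h hh => ?_⟩
          have a1 := hpos _ (B.comp γ h) (J.comp_left _ _ hh)
          rw [B.star_comp, B.comp_assoc] at a1
          rw [B.star_comp, B.comp_assoc, hγ, B.comp_sub, B.comp_smul, map_sub, map_smul,
            Complex.sub_re, smul_eq_mul, Complex.re_ofReal_mul]
          linarith }
  have h1 := d.le_norm_rep (ψ.map (A.star a)) (ψ.map a) ((himg _).2 ⟨a, rfl⟩)
  change (l' _).re ≤ _ * (l' _).re at h1
  have e1 : B.comp (B.star (ψ.map a)) (ψ.map a) = ψ.map (A.comp (A.star a) a) := by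
    rw [ψ.map_comp, ψ.map_star]
  have e2 : B.comp (ψ.map (A.star a)) (ψ.map a) = ψ.map (A.comp (A.star a) a) := by
    rw [ψ.map_comp]
  have e3 : B.comp (B.star (ψ.map (A.comp (A.star a) a))) (ψ.map (A.comp (A.star a) a)) =
      ψ.map (A.comp (A.comp (A.star a) a) (A.comp (A.star a) a)) := by
    rw [← ψ.map_star, ← ψ.map_comp, A.star_comp, A.star_star]
  rw [e1, e2, e3, hl', hl', ev_comp, ev_comp, ev_star] at h1
  have h2 : 0 ≤ (l (star (ρ.ev a) * ρ.ev a)).re := hl1 _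
  have h3 : ‖d.rep.ev (ψ.map (A.star a))‖ ≤ r := by
    have := ev_le_maxNorm d.rep (ψ.map (A.star a))
    rw [ψ.map_star, maxNorm_star, ← ofReal_norm, ← ENNReal.ofReal_toReal hfin] at this
    rw [ψ.map_star]
    exact (ENNReal.ofReal_le_ofReal_iff hr0).1 this
  have h4 : ‖d.rep.ev (ψ.map (A.star a))‖ ^ 2 ≤ r ^ 2 :=
    pow_le_pow_left₀ (norm_nonneg _) h3 2
  nlinarith

end Isometry

/-! ### Approximation in morphism spaces -/

section Approx
open StarCatNu hiding star_add star_smul star_star star_sub star_neg star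
open StarFunctor hiding map_add map_smul map_neg map_sub map_zero map_star

/-- `f` is in the closure of `S`. -/
def StarCatNu.Cl (E : StarCatNu) {X Y : E.Obj} (S : Set (E.Hom X Y)) (f : E.Hom X Y) : Prop :=
  ∀ ε : ℝ≥0∞, 0 < ε → ∃ s ∈ S, E.maxNorm (f - s) < ε

theorem StarCatNu.sub_lt {E : StarCatNu} {X Y : E.Obj} {f g h : E.Hom X Y} {ε δ : ℝ≥0∞}
    (h1 : E.maxNorm (f - g) < ε) (h2 : E.maxNorm (g - h) < δ) : E.maxNorm (f - h) < ε + δ := by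
  have e : f - h = (f - g) + (g - h) := by abel
  rw [e]
  exact (maxNorm_add_le _ _).trans_lt (ENNReal.add_lt_add h1 h2)

theorem StarCatNu.norm_sub_comm {E : StarCatNu} {X Y : E.Obj} (f g : E.Hom X Y) :
    E.maxNorm (f - g) = E.maxNorm (g - f) := by
  rw [← maxNorm_neg, neg_sub]

theorem StarCatNu.cl_self {E : StarCatNu} {X Y : E.Obj} {S : Set (E.Hom X Y)} {f : E.Hom X Y}
    (h : f ∈ S) : E.Cl S f := fun ε hε => ⟨f, h, by rwa [sub_self, maxNorm_zero]⟩

theorem StarCatNu.cl_lip {E E' : StarCatNu} {X Y : E.Obj} {X' Y' : E'.Obj} {S : Set (E.Hom X Y)}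
    {S' : Set (E'.Hom X' Y')} (T : E.Hom X Y → E'.Hom X' Y') (K : ℝ≥0∞) (hK : K ≠ ⊤)
    (hT : ∀ f s, E'.maxNorm (T f - T s) ≤ K * E.maxNorm (f - s))
    (hS : ∀ s ∈ S, E'.Cl S' (T s)) {f : E.Hom X Y} (hf : E.Cl S f) : E'.Cl S' (T f) := by
  intro ε hε
  have hε2 : 0 < ε / 2 := ENNReal.half_pos hε.ne'
  obtain ⟨δ, hδ, hlt⟩ := ENNReal.exists_nnreal_pos_mul_lt hK hε2.ne'
  obtain ⟨s, hs, h1⟩ := hf δ (by exact_mod_cast hδ)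
  obtain ⟨t, ht, h2⟩ := hS s hs _ hε2
  refine ⟨t, ht, ?_⟩
  have h3 : E'.maxNorm (T f - T s) < ε / 2 := by
    refine (hT f s).trans_lt (lt_of_le_of_lt ?_ hlt)
    rw [mul_comm]
    exact mul_le_mul_left h1.le K
  have := sub_lt h3 h2
  rwa [ENNReal.add_halves] at this

theorem StarCatNu.cl_add {E : StarCatNu} {X Y : E.Obj} {S : Set (E.Hom X Y)}
    (hS : ∀ s ∈ S, ∀ t ∈ S, s + t ∈ S) {f g : E.Hom X Y} (hf : E.Cl S f) (hg : E.Cl S g) :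
    E.Cl S (f + g) := by
  refine cl_lip (fun f => f + g) 1 ENNReal.one_ne_top (fun f s => ?_) (fun s hs => ?_) hf
  · simp
  · refine cl_lip (fun g => s + g) 1 ENNReal.one_ne_top (fun f s => ?_) (fun t ht => ?_) hg
    · simp
    · exact cl_self (hS s hs t ht)

/-- Isometric functors between C*-categories have closed image. -/
theorem StarFunctor.closed_image {P Q : StarCatNu} (hP : IsCStar P) (hQ : IsCStar Q)
    (F : StarFunctor P Q) {X Y : P.Obj}
    (hF : ∀ f : P.Hom X Y, P.maxNorm f ≤ Q.maxNorm (F.map f)) (d : Q.Hom (F.obj X) (F.obj Y))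
    (hd : Q.Cl {d | ∃ p : P.Hom X Y, F.map p = d} d) : ∃ p : P.Hom X Y, F.map p = d := by
  have hpos : ∀ n : ℕ, (0 : ℝ≥0∞) < ((n : ℝ≥0∞) + 1)⁻¹ := fun n => by
    rw [ENNReal.inv_pos]; finiteness
  have : ∀ n : ℕ, ∃ p : P.Hom X Y, Q.maxNorm (d - F.map p) < ((n : ℝ≥0∞) + 1)⁻¹ := by
    intro n
    obtain ⟨_, ⟨p, rfl⟩, h⟩ := hd _ (hpos n)
    exact ⟨p, h⟩
  choose u hu using this
  have small : ∀ ε : ℝ≥0∞, 0 < ε → ∃ N, ∀ n ≥ N, Q.maxNorm (d - F.map (u n)) < ε := by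
    intro ε hε
    obtain ⟨N, hN⟩ := ENNReal.exists_inv_nat_lt hε.ne'
    refine ⟨N, fun n hn => (hu n).trans_le (le_trans ?_ hN.le)⟩
    rw [ENNReal.inv_le_inv]
    exact (Nat.cast_le.2 hn).trans le_self_add
  obtain ⟨p, hp⟩ := hP.2.2 X Y u (by
    intro ε hε
    have hε2 : 0 < ε / 2 := ENNReal.half_pos hε.ne'
    obtain ⟨N, hN⟩ := small _ hε2
    refine ⟨N, fun m hm n hn => (hF _).trans_lt ?_⟩
    rw [F.map_sub]
    have h1 := hN m hm
    rw [StarCatNu.norm_sub_comm] at h1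
    have := sub_lt h1 (hN n hn)
    rwa [ENNReal.add_halves] at this)
  refine ⟨p, ?_⟩
  rw [← sub_eq_zero]
  apply hQ.2.1
  by_contra hne
  have hε := pos_iff_ne_zero.2 hne
  have hε2 := ENNReal.half_pos hε.ne'
  obtain ⟨N, hN⟩ := small _ hε2
  obtain ⟨M, hM⟩ := hp _ hε2
  have h1 := hN (max N M) (le_max_left _ _)
  have h2 := hM (max N M) (le_max_right _ _)
  have h3 := (maxNorm_map_le F _).trans_lt h2
  rw [F.map_sub] at h3
  have := sub_lt h1 h3
  rw [ENNReal.add_halves, StarCatNu.norm_sub_comm] at this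
  exact lt_irrefl _ this

theorem StarFunctor.isometric_of_dense {P Q : StarCatNu} (F : StarFunctor P Q) {X Y : P.Obj}
    (S : Set (P.Hom X Y)) (hS : ∀ f, P.Cl S f)
    (h : ∀ s ∈ S, P.maxNorm s ≤ Q.maxNorm (F.map s)) (f : P.Hom X Y) :
    P.maxNorm f ≤ Q.maxNorm (F.map f) := by
  refine ENNReal.le_of_forall_pos_le_add fun ε hε _ => ?_
  have hε2 : (0 : ℝ≥0∞) < (ε : ℝ≥0∞) / 2 := ENNReal.half_pos (by exact_mod_cast hε.ne')
  obtain ⟨s, hs, h1⟩ := hS f _ hε2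
  have h2 := (maxNorm_map_le F (f - s)).trans_lt h1
  rw [F.map_sub] at h2
  calc P.maxNorm f = P.maxNorm (s + (f - s)) := by congr 1; abel
    _ ≤ P.maxNorm s + P.maxNorm (f - s) := maxNorm_add_le _ _
    _ ≤ Q.maxNorm (F.map s) + ε / 2 := add_le_add (h s hs) h1.le
    _ = Q.maxNorm (F.map f - (F.map f - F.map s)) + ε / 2 := by congr 2; abel
    _ ≤ (Q.maxNorm (F.map f) + ε / 2) + ε / 2 := by
        gcongr
        exact (maxNorm_sub_le _ _).trans (add_le_add le_rfl h2.le)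
    _ = Q.maxNorm (F.map f) + ε := by rw [add_assoc, ENNReal.add_halves]

theorem eq_of_dense {P Q : StarCatNu} (hQ : IsCStar Q) {X Y : P.Obj} {X' Y' : Q.Obj}
    (S T : P.Hom X Y → Q.Hom X' Y') (K : ℝ≥0∞) (hK : K ≠ ⊤)
    (hS : ∀ f s, Q.maxNorm (S f - S s) ≤ K * P.maxNorm (f - s))
    (hT : ∀ f s, Q.maxNorm (T f - T s) ≤ K * P.maxNorm (f - s))
    (D : Set (P.Hom X Y)) (hD : ∀ f, P.Cl D f) (h : ∀ s ∈ D, S s = T s) (f : P.Hom X Y) :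
    S f = T f := by
  have : Q.Cl {0} (S f - T f) := by
    refine cl_lip (S := D) (fun f => S f - T f) (K + K) (by finiteness) (fun f s => ?_) (fun s hs => ?_) (hD f)
    · have e : S f - T f - (S s - T s) = (S f - S s) - (T f - T s) := by abel
      rw [e, add_mul]
      exact (maxNorm_sub_le _ _).trans (add_le_add (hS _ _) (hT _ _))
    · apply cl_self
      simp [h s hs]
  rw [← sub_eq_zero]
  apply hQ.2.1
  by_contra hne
  obtain ⟨s, hs, hlt⟩ := this _ (pos_iff_ne_zero.2 hne)
  rw [Set.mem_singleton_iff.1 hs, sub_zero] at hlt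
  exact lt_irrefl _ hlt

end Approx

/-! ### Completions with the same set of objects -/

section Compl
open StarCatNu hiding star_add star_smul star_star star_sub star_neg star
open StarFunctor hiding map_add map_smul map_neg map_sub map_zero map_star

/-- The completion with its objects replaced by those of the source. -/
@[reducible] def StarFunctor.pc {E Ec : StarCatNu} (κ : StarFunctor E Ec) : StarCatNu :=
  Ec.pull κ.obj

/-- The canonical functor into the completion. -/
@[reducible] def StarFunctor.inc {E Ec : StarCatNu} (κ : StarFunctor E Ec) :
    StarFunctor E κ.pc where
  obj X := X
  map f := κ.map f
  map_add := κ.map_add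
  map_smul := κ.map_smul
  map_comp := κ.map_comp
  map_star := κ.map_star

namespace IsCompletion
variable {E Ec : StarCatNu} {κ : StarFunctor E Ec}

theorem pc_cstar (h : IsCompletion E Ec κ) : IsCStar κ.pc := pull_isCStar _ _ h.obj_bij h.cstar

theorem inc_norm (h : IsCompletion E Ec κ) {X Y : E.Obj} (f : E.Hom X Y) : κ.pc.maxNorm (κ.inc.map f) = E.maxNorm f :=
  (pull_norm _ _ h.obj_bij _).trans (h.isometric _ _ f)

theorem inc_dense (h : IsCompletion E Ec κ) {X Y : E.Obj} (f : κ.pc.Hom X Y) :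
    κ.pc.Cl {f | ∃ e : E.Hom X Y, κ.inc.map e = f} f := by
  intro ε hε
  obtain ⟨e, he⟩ := h.dense X Y f ε hε
  refine ⟨κ.inc.map e, ⟨e, rfl⟩, ?_⟩
  exact (pull_norm _ _ h.obj_bij _).trans_lt he

theorem inc_identity (h : IsCompletion E Ec κ) {X : E.Obj} {e : E.Hom X X} (he : IsIdentityAt E e) :
    IsIdentityAt κ.pc (X := X) (κ.inc.map e) := by
  have hK : κ.pc.maxNorm (κ.inc.map e) ≠ ⊤ := (h.pc_cstar.1 _ _ _).ne
  have h1 : ∀ (Y : E.Obj) (f : κ.pc.Hom X Y), κ.pc.comp f (κ.inc.map e) = f := by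
    intro Y f
    refine eq_of_dense h.pc_cstar (P := κ.pc) (Q := κ.pc) (X := X) (Y := Y) (X' := X) (Y' := Y)
      (fun f => κ.pc.comp f (κ.inc.map e)) (fun f => f)
      (κ.pc.maxNorm (κ.inc.map e) + 1) (by finiteness) (fun f s => ?_) (fun f s => ?_) _
      h.inc_dense ?_ f
    · rw [← κ.pc.sub_comp]
      refine (maxNorm_comp_le _ _).trans ?_
      rw [mul_comm]
      gcongr
      exact le_self_add
    · rw [add_mul, one_mul]; exact le_add_self
    · rintro _ ⟨b, rfl⟩
      exact (κ.map_comp _ _ _ b e).symm.trans (congrArg _ (he.1 _ b))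
  refine ⟨h1, fun Y f => ?_⟩
  have h2 := congrArg κ.pc.star (h1 Y (κ.pc.star f))
  rw [κ.pc.star_comp, κ.pc.star_star, ← κ.inc.map_star, EndAlg.star_id he] at h2
  exact h2

theorem pc_unital (h : IsCompletion E Ec κ) (hu : E.IsUnital) : κ.pc.IsUnital := fun X => by
  obtain ⟨e, he⟩ := hu X
  exact ⟨κ.inc.map e, h.inc_identity he⟩

/-- The closure of an ideal in the completion. -/
def clIdeal (h : IsCompletion E Ec κ) (J : CIdeal E) : CIdeal κ.pc where
  I X Y :=
    { carrier := {f | κ.pc.Cl (X := X) (Y := Y) {f | ∃ j ∈ J.I X Y, κ.inc.map j = f} f}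
      add_mem' := by
        intro f g hf hg
        refine cl_add ?_ hf hg
        rintro _ ⟨j, hj, rfl⟩ _ ⟨j', hj', rfl⟩
        exact ⟨j + j', add_mem hj hj', κ.map_add _ _ _ _⟩
      zero_mem' := cl_self ⟨0, zero_mem _, κ.map_zero _ _⟩
      smul_mem' := by
        intro c f hf
        refine cl_lip (E := κ.pc) (E' := κ.pc) (fun f => c • f) ‖c‖ₑ (by simp) (fun f s => ?_)
          ?_ hf
        · rw [← smul_sub]; exact maxNorm_smul_le _ _
        · rintro _ ⟨j, hj, rfl⟩
          exact cl_self ⟨c • j, Submodule.smul_mem _ _ hj, κ.map_smul _ _ _ _⟩ }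
  comp_left := by
    intro X Y Z g f hf
    refine cl_lip (E := κ.pc) (E' := κ.pc) (X := X) (Y := Y) (X' := X) (Y' := Z)
      (fun f => κ.pc.comp g f) (κ.pc.maxNorm g) ((h.pc_cstar.1 _ _ _).ne) (fun f s => ?_) ?_ hf
    · rw [← κ.pc.comp_sub]; exact maxNorm_comp_le _ _
    · rintro _ ⟨j, hj, rfl⟩
      refine cl_lip (E := κ.pc) (E' := κ.pc) (X := Y) (Y := Z) (X' := X) (Y' := Z)
        (fun g => κ.pc.comp g (κ.inc.map j)) (κ.pc.maxNorm (κ.inc.map j))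
        ((h.pc_cstar.1 _ _ _).ne) (fun f s => ?_) ?_ (h.inc_dense g)
      · rw [← κ.pc.sub_comp, mul_comm]; exact maxNorm_comp_le _ _
      · rintro _ ⟨b, rfl⟩
        exact cl_self ⟨E.comp b j, J.comp_left _ _ hj, κ.map_comp _ _ _ _ _⟩
  comp_right := by
    intro X Y Z g f hg
    refine cl_lip (E := κ.pc) (E' := κ.pc) (X := Y) (Y := Z) (X' := X) (Y' := Z)
      (fun g => κ.pc.comp g f) (κ.pc.maxNorm f) ((h.pc_cstar.1 _ _ _).ne) (fun f s => ?_) ?_ hg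
    · rw [← κ.pc.sub_comp, mul_comm]; exact maxNorm_comp_le _ _
    · rintro _ ⟨j, hj, rfl⟩
      refine cl_lip (E := κ.pc) (E' := κ.pc) (X := X) (Y := Y) (X' := X) (Y' := Z)
        (fun f => κ.pc.comp (κ.inc.map j) f) (κ.pc.maxNorm (κ.inc.map j))
        ((h.pc_cstar.1 _ _ _).ne) (fun f s => ?_) ?_ (h.inc_dense f)
      · rw [← κ.pc.comp_sub]; exact maxNorm_comp_le _ _
      · rintro _ ⟨b, rfl⟩
        exact cl_self ⟨E.comp j b, J.comp_right _ _ hj, κ.map_comp _ _ _ _ _⟩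
  star_mem := by
    intro X Y f hf
    refine cl_lip (E := κ.pc) (E' := κ.pc) (X := X) (Y := Y) (X' := Y) (Y' := X)
      (fun f => κ.pc.star f) 1 ENNReal.one_ne_top (fun f s => ?_) ?_ hf
    · rw [← κ.pc.star_sub, maxNorm_star, one_mul]
    · rintro _ ⟨j, hj, rfl⟩
      exact cl_self ⟨E.star j, J.star_mem _ hj, κ.map_star _ _ _⟩

theorem mem_clIdeal (h : IsCompletion E Ec κ) (J : CIdeal E) {X Y : E.Obj} (f : κ.pc.Hom X Y) :
    f ∈ (h.clIdeal J).I X Y ↔ κ.pc.Cl {f | ∃ j ∈ J.I X Y, κ.inc.map j = f} f := Iff.rfl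

theorem clIdeal_closed (h : IsCompletion E Ec κ) (J : CIdeal E) : (h.clIdeal J).Closed := by
  intro X Y f hf
  refine cl_lip (E := κ.pc) (E' := κ.pc) (X := X) (Y := Y) (X' := X) (Y' := Y)
    (S := (h.clIdeal J).I X Y) (fun f => f) 1 ENNReal.one_ne_top (fun f s => ?_) ?_ hf
  · rw [one_mul]
  · intro s hs
    exact hs

end IsCompletion

/-- A functor between completions extending a given functor. -/
structure ExtMap {E Ec F Fc : StarCatNu} (κ : StarFunctor E Ec) (μ : StarFunctor F Fc)
    (ψ : StarFunctor E F) where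
  map : ∀ {X Y : E.Obj}, κ.pc.Hom X Y → μ.pc.Hom (ψ.obj X) (ψ.obj Y)
  map_add : ∀ (X Y : E.Obj) (f f' : κ.pc.Hom X Y), map (f + f') = map f + map f'
  map_smul : ∀ (X Y : E.Obj) (c : ℂ) (f : κ.pc.Hom X Y), map (c • f) = c • map f
  map_comp : ∀ (X Y Z : E.Obj) (g : κ.pc.Hom Y Z) (f : κ.pc.Hom X Y),
    map (κ.pc.comp g f) = μ.pc.comp (map g) (map f)
  map_star : ∀ (X Y : E.Obj) (f : κ.pc.Hom X Y), map (κ.pc.star f) = μ.pc.star (map f)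
  map_inc : ∀ (X Y : E.Obj) (f : E.Hom X Y), map (κ.inc.map f) = μ.inc.map (ψ.map f)

/-- The underlying functor. -/
@[reducible] def ExtMap.fn {E Ec F Fc : StarCatNu} {κ : StarFunctor E Ec} {μ : StarFunctor F Fc}
    {ψ : StarFunctor E F} (m : ExtMap κ μ ψ) : StarFunctor κ.pc μ.pc where
  obj := ψ.obj
  map := m.map
  map_add := m.map_add
  map_smul := m.map_smul
  map_comp := m.map_comp
  map_star := m.map_star

section Ideal
variable {E Ec F Fc : StarCatNu} {κ : StarFunctor E Ec} {μ : StarFunctor F Fc}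
  {ψ : StarFunctor E F} (m : ExtMap κ μ ψ)

theorem ExtMap.isometric
    (hκ : IsCompletion E Ec κ) (hμ : IsCompletion F Fc μ)
    (hiso : ∀ {X Y : E.Obj} (a : E.Hom X Y), E.maxNorm a ≤ F.maxNorm (ψ.map a))
    {X Y : E.Obj} (f : κ.pc.Hom X Y) :
    κ.pc.maxNorm f ≤ μ.pc.maxNorm (m.fn.map f) := by
  refine m.fn.isometric_of_dense _ hκ.inc_dense ?_ f
  rintro _ ⟨a, rfl⟩
  rw [hκ.inc_norm]
  refine (hiso a).trans ?_
  rw [← hμ.inc_norm]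
  exact (congrArg _ (m.map_inc _ _ a)).symm.le

theorem ExtMap.mem_clIdeal_iff
    (hκ : IsCompletion E Ec κ) (hμ : IsCompletion F Fc μ)
    (J : CIdeal F) (himg : ∀ {X Y : E.Obj} (u : F.Hom (ψ.obj X) (ψ.obj Y)), u ∈ J.I _ _ ↔
      ∃ a, ψ.map a = u)
    (hiso : ∀ {X Y : E.Obj} (a : E.Hom X Y), E.maxNorm a ≤ F.maxNorm (ψ.map a))
    {X Y : E.Obj} (f : μ.pc.Hom (ψ.obj X) (ψ.obj Y)) :
    f ∈ (hμ.clIdeal J).I _ _ ↔ ∃ g : κ.pc.Hom X Y, m.map g = f := by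
  constructor
  · intro hf
    refine m.fn.closed_image hκ.pc_cstar hμ.pc_cstar
      (fun f => m.isometric hκ hμ hiso f) f ?_
    intro ε hε
    obtain ⟨_, ⟨j, hj, rfl⟩, hlt⟩ := hf ε hε
    obtain ⟨a, rfl⟩ := (himg j).1 hj
    exact ⟨_, ⟨κ.inc.map a, m.map_inc _ _ a⟩, hlt⟩
  · rintro ⟨g, rfl⟩
    refine cl_lip (E := κ.pc) (E' := μ.pc) (X := X) (Y := Y) (X' := ψ.obj X) (Y' := ψ.obj Y)
      (fun g => m.fn.map g) 1 ENNReal.one_ne_top (fun f s => ?_) ?_ (hκ.inc_dense g)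
    · rw [one_mul, ← m.fn.map_sub]
      exact maxNorm_map_le m.fn _
    · rintro _ ⟨a, rfl⟩
      exact cl_self ⟨ψ.map a, (himg _).2 ⟨a, rfl⟩, (m.map_inc _ _ a).symm⟩

theorem ExtMap.exact
    (hκ : IsCompletion E Ec κ) (hμ : IsCompletion F Fc μ)
    (J : CIdeal F) (himg : ∀ {X Y : E.Obj} (u : F.Hom (ψ.obj X) (ψ.obj Y)), u ∈ J.I _ _ ↔
      ∃ a, ψ.map a = u)
    (hiso : ∀ {X Y : E.Obj} (a : E.Hom X Y), E.maxNorm a ≤ F.maxNorm (ψ.map a))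
    (hobj : Function.Bijective ψ.obj) : IsExactSeq m.fn (hμ.clIdeal J).proj where
  i_obj_bij := hobj
  i_map_inj X Y := by
    intro f f' hf
    have hf : m.fn.map f = m.fn.map f' := hf
    rw [← sub_eq_zero]
    apply hκ.pc_cstar.2.1
    have := m.isometric hκ hμ hiso (f - f')
    rw [m.fn.map_sub, hf, sub_self, maxNorm_zero] at this
    exact le_antisymm this bot_le
  p_quot := CIdeal.proj_quot _
  exact X Y f := (CIdeal.proj_eq_zero _ _).trans (m.mem_clIdeal_iff hκ hμ J himg hiso f)

end Ideal
end Compl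

/-! ### The abstract core -/

section Core
open StarCatNu hiding star_add star_smul star_star star_sub star_neg star
open StarFunctor hiding map_add map_smul map_neg map_sub map_zero map_star

theorem castHom_isUnitary {C : StarCatNu} {X X' Y Y' : C.Obj} (hX : X = X') (hY : Y = Y')
    (u : C.Hom X Y) (hu : IsUnitary C u) : IsUnitary C (C.castHom hX hY u) := by
  subst hX hY; exact hu

theorem IsQuotientHom.identity {D Q : StarCatNu} {q : StarFunctor D Q} (hq : IsQuotientHom q)
    {X : D.Obj} {e : D.Hom X X} (he : IsIdentityAt D e) : IsIdentityAt Q (q.map e) := by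
  constructor
  · intro Y f
    obtain ⟨Y, rfl⟩ := hq.1.2 Y
    obtain ⟨f, rfl⟩ := hq.2 _ _ f
    show Q.comp (q.map f) (q.map e) = q.map f
    rw [← q.map_comp, he.1]
  · intro Y f
    obtain ⟨Y, rfl⟩ := hq.1.2 Y
    obtain ⟨f, rfl⟩ := hq.2 _ _ f
    show Q.comp (q.map e) (q.map f) = q.map f
    rw [← q.map_comp, he.2]

theorem IsQuotientHom.isUnital {D Q : StarCatNu} {q : StarFunctor D Q} (hq : IsQuotientHom q)
    (h : D.IsUnital) : Q.IsUnital := by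
  intro X
  obtain ⟨X, rfl⟩ := hq.1.2 X
  obtain ⟨e, he⟩ := h X
  exact ⟨_, hq.identity he⟩

/-- A functor which becomes an equivalence modulo ideals. -/
structure ModEquiv {B D : StarCatNu} (v : StarFunctor B D) (JA : CIdeal B) (JC : CIdeal D) :
    Prop where
  full : ∀ {X Y : B.Obj} (d : D.Hom (v.obj X) (v.obj Y)), ∃ b : B.Hom X Y,
    v.map b - d ∈ JC.I (v.obj X) (v.obj Y)
  mem_iff : ∀ {X Y : B.Obj} (b : B.Hom X Y), v.map b ∈ JC.I (v.obj X) (v.obj Y) ↔ b ∈ JA.I X Y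
  ess : ∀ Y : D.Obj, ∃ (X : B.Obj) (u : D.Hom (v.obj X) Y),
    (∀ e, IsIdentityAt D e → D.comp (D.star u) u - e ∈ JC.I (v.obj X) (v.obj X)) ∧
    (∀ e, IsIdentityAt D e → D.comp u (D.star u) - e ∈ JC.I Y Y)
  unit : ∀ (X : B.Obj) (e : B.Hom X X) (e' : D.Hom (v.obj X) (v.obj X)), IsIdentityAt B e →
    IsIdentityAt D e' → v.map e - e' ∈ JC.I (v.obj X) (v.obj X)

theorem ModEquiv.norm_le {B D : StarCatNu} {v : StarFunctor B D} {JA : CIdeal B} {JC : CIdeal D}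
    (h : ModEquiv v JA JC) (hB : B.IsUnital) (hD : D.IsUnital) {X Y : B.Obj} (b : B.Hom X Y) :
    JA.quot.maxNorm (JA.proj.map b) ≤ JC.quot.maxNorm (JC.proj.map (v.map b)) := by
  let F : StarFunctor JA.quot JC.quot := JA.desc (v.comp JC.proj) (by
    intro X Y f hf
    exact (JC.proj_eq_zero _).2 ((h.mem_iff f).2 hf))
  have hF : IsUnitaryEquiv F := by
    refine IsUnitaryEquiv.of_ff (JA.quot_isUnital hB) ?_ ?_ ?_ ?_
    · intro X e he
      obtain ⟨e1, he1⟩ := hB X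
      obtain ⟨e2, he2⟩ := hD (v.obj X)
      have h1 : IsIdentityAt JA.quot (X := X) (JA.proj.map e1) := JA.proj_quot.identity he1
      have h2 : e = JA.proj.map e1 := he.unique h1
      have h3 : F.map e = JC.proj.map e2 := by
        rw [h2]
        exact (JC.proj_eq (v.map e1) e2).2 (h.unit X e1 e2 he1 he2)
      rw [h3]
      exact JC.proj_quot.identity he2
    · intro X Y f hf
      obtain ⟨f, rfl⟩ := JA.proj_surj f
      exact (JA.proj_eq_zero f).2 ((h.mem_iff f).1 ((JC.proj_eq_zero _).1 hf))
    · intro X Y d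
      obtain ⟨d, rfl⟩ := JC.proj_surj (X := v.obj X) (Y := v.obj Y) d
      obtain ⟨b, hb⟩ := h.full d
      exact ⟨JA.proj.map b, (JC.proj_eq (v.map b) d).2 hb⟩
    · intro Y
      obtain ⟨X, u, h1, h2⟩ := h.ess Y
      refine ⟨X, JC.proj.map u, ?_, ?_⟩
      · obtain ⟨e, he⟩ := hD (v.obj X)
        have h3 := (JC.proj_eq (D.comp (D.star u) u) e).2 (h1 e he)
        have h4 : IsIdentityAt JC.quot (X := v.obj X) (JC.proj.map e) := JC.proj_quot.identity he
        rw [← h3] at h4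
        exact h4
      · obtain ⟨e, he⟩ := hD Y
        have h3 := (JC.proj_eq (D.comp u (D.star u)) e).2 (h2 e he)
        have h4 : IsIdentityAt JC.quot (X := Y) (JC.proj.map e) := JC.proj_quot.identity he
        rw [← h3] at h4
        exact h4
  exact hF.norm_map (JA.proj.map b)

variable {A B C D Ac Bc Cc Dc : StarCatNu} {i₁ : StarFunctor A B} {v₁ : StarFunctor A C}
  {v₂ : StarFunctor B D} {i₂ : StarFunctor C D}
  {κA : StarFunctor A Ac} {κB : StarFunctor B Bc} {κC : StarFunctor C Cc} {κD : StarFunctor D Dc}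

theorem core_comm (hA : IsCompletion A Ac κA) (hD : IsCompletion D Dc κD)
    (comm : i₁.comp v₂ = v₁.comp i₂)
    (m₁ : ExtMap κA κB i₁) (w₁ : ExtMap κA κC v₁) (w₂ : ExtMap κB κD v₂) (m₂ : ExtMap κC κD i₂) :
    m₁.fn.comp w₂.fn = w₁.fn.comp m₂.fn := by
  refine ext_cast (fun X => obj_congr comm X) (fun X Y f => ?_)
  have hX : v₂.obj (i₁.obj X) = i₂.obj (v₁.obj X) := obj_congr comm X
  have hY : v₂.obj (i₁.obj Y) = i₂.obj (v₁.obj Y) := obj_congr comm Y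
  refine eq_of_dense hD.pc_cstar (P := κA.pc) (Q := κD.pc) (X := X) (Y := Y)
    (X' := i₂.obj (v₁.obj X)) (Y' := i₂.obj (v₁.obj Y))
    (fun f => κD.pc.castHom hX hY (w₂.fn.map (m₁.fn.map f))) (fun f => m₂.fn.map (w₁.fn.map f))
    1 ENNReal.one_ne_top (fun f s => ?_) (fun f s => ?_) _ hA.inc_dense ?_ f
  · rw [← castHom_sub, maxNorm_castHom, ← w₂.fn.map_sub, ← m₁.fn.map_sub, one_mul]
    exact (maxNorm_map_le w₂.fn _).trans (maxNorm_map_le m₁.fn _)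
  · rw [← m₂.fn.map_sub, ← w₁.fn.map_sub, one_mul]
    exact (maxNorm_map_le m₂.fn _).trans (maxNorm_map_le w₁.fn _)
  · rintro _ ⟨a, rfl⟩
    have e1 : w₂.fn.map (m₁.fn.map (κA.inc.map a)) = κD.inc.map (v₂.map (i₁.map a)) :=
      (congrArg w₂.fn.map (m₁.map_inc _ _ a)).trans (w₂.map_inc _ _ _)
    have e2 : m₂.fn.map (w₁.fn.map (κA.inc.map a)) = κD.inc.map (i₂.map (v₁.map a)) :=
      (congrArg m₂.fn.map (w₁.map_inc _ _ a)).trans (m₂.map_inc _ _ _)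
    have e3 : D.castHom hX hY (v₂.map (i₁.map a)) = i₂.map (v₁.map a) := map_congr comm a
    show κD.pc.castHom hX hY (w₂.fn.map (m₁.fn.map (κA.inc.map a))) =
      m₂.fn.map (w₁.fn.map (κA.inc.map a))
    rw [e1, e2, ← e3]
    exact (map_castHom κD.inc hX hY _).symm

theorem core_quot (hκA : IsCompletion A Ac κA) (hκB : IsCompletion B Bc κB)
    (hκC : IsCompletion C Cc κC) (hκD : IsCompletion D Dc κD)
    (hBu : B.IsUnital) (hDu : D.IsUnital)
    (m₁ : ExtMap κA κB i₁) (w₂ : ExtMap κB κD v₂) (m₂ : ExtMap κC κD i₂)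
    (JA : CIdeal B) (JC : CIdeal D)
    (hi₁ : Function.Bijective i₁.obj) (hi₂ : Function.Bijective i₂.obj)
    (himgA : ∀ {X Y : A.Obj} (u : B.Hom (i₁.obj X) (i₁.obj Y)), u ∈ JA.I _ _ ↔ ∃ a, i₁.map a = u)
    (himgC : ∀ {X Y : C.Obj} (u : D.Hom (i₂.obj X) (i₂.obj Y)), u ∈ JC.I _ _ ↔ ∃ a, i₂.map a = u)
    (hisoC : ∀ {X Y : C.Obj} (a : C.Hom X Y), C.maxNorm a ≤ D.maxNorm (i₂.map a))
    (hv : ModEquiv v₂ JA JC)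
    (QB QD : StarCatNu) (qB : StarFunctor κB.pc QB) (qD : StarFunctor κD.pc QD)
    (r : StarFunctor QB QD) (hQB : IsCStar QB) (hQD : IsCStar QD)
    (exB : IsExactSeq m₁.fn qB) (exD : IsExactSeq m₂.fn qD) (hr : w₂.fn.comp qD = qB.comp r) :
    QB.IsUnital ∧ QD.IsUnital ∧ r.Unital ∧ IsUnitaryEquiv r := by
  have hBc := hκB.pc_unital hBu
  have hDc := hκD.pc_unital hDu
  -- the projections kill the ideals
  have killB : ∀ {X Y : B.Obj} (b : B.Hom X Y), b ∈ JA.I X Y → qB.map (κB.inc.map b) = 0 := by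
    intro X Y b hb
    obtain ⟨X, rfl⟩ := hi₁.2 X
    obtain ⟨Y, rfl⟩ := hi₁.2 Y
    obtain ⟨a, rfl⟩ := (himgA b).1 hb
    exact (exB.exact X Y _).2 ⟨κA.inc.map a, m₁.map_inc _ _ a⟩
  have killD : ∀ {X Y : D.Obj} (b : D.Hom X Y), b ∈ JC.I X Y → qD.map (κD.inc.map b) = 0 := by
    intro X Y b hb
    obtain ⟨X, rfl⟩ := hi₂.2 X
    obtain ⟨Y, rfl⟩ := hi₂.2 Y
    obtain ⟨a, rfl⟩ := (himgC b).1 hb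
    exact (exD.exact X Y _).2 ⟨κC.inc.map a, m₂.map_inc _ _ a⟩
  have killD' : ∀ {X Y : D.Obj} (b b' : D.Hom X Y), b - b' ∈ JC.I X Y →
      qD.map (κD.inc.map b) = qD.map (κD.inc.map b') := by
    intro X Y b b' hb
    have := killD _ hb
    rw [κD.inc.map_sub, qD.map_sub, sub_eq_zero] at this
    exact this
  have hker : ∀ {X Y : D.Obj} (k : κD.pc.Hom X Y), qD.map k = 0 →
      κD.pc.Cl {f | ∃ j ∈ JC.I X Y, κD.inc.map j = f} k := by
    intro X Y k hk
    obtain ⟨X, rfl⟩ := hi₂.2 X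
    obtain ⟨Y, rfl⟩ := hi₂.2 Y
    exact (m₂.mem_clIdeal_iff hκC hκD JC himgC hisoC k).2 ((exD.exact X Y k).1 hk)
  -- norm estimates
  have n1 : ∀ {X Y : B.Obj} (b : B.Hom X Y),
      QB.maxNorm (qB.map (κB.inc.map b)) ≤ JA.quot.maxNorm (JA.proj.map b) := by
    intro X Y b
    exact maxNorm_map_le (JA.desc (κB.inc.comp qB) (fun f hf => killB f hf)) (JA.proj.map b)
  have n2 : ∀ {X Y : D.Obj} (d : D.Hom X Y),
      JC.quot.maxNorm (JC.proj.map d) ≤ QD.maxNorm (qD.map (κD.inc.map d)) := by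
    intro X Y d
    refine le_of_forall_gt fun ε hε => ?_
    obtain ⟨k, hk, hlt⟩ := exists_lift_of_quot hκD.pc_cstar hDc qD exD.p_quot (κD.inc.map d) ε hε
    obtain ⟨_, ⟨j, hj, rfl⟩, hlt'⟩ := hker k hk _ (tsub_pos_of_lt hlt)
    refine (JC.quot_norm_le d j hj).trans_lt ?_
    rw [← hκD.inc_norm, κD.inc.map_sub]
    have e : κD.inc.map d - κD.inc.map j = (κD.inc.map d - k) + (k - κD.inc.map j) := by abel
    rw [e]
    refine (maxNorm_add_le _ _).trans_lt ?_
    rw [add_comm]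
    exact lt_tsub_iff_right.1 hlt'
  have robj : ∀ X : B.Obj, qD.obj (v₂.obj X) = r.obj (qB.obj X) := fun X => obj_congr hr X
  have rmap : ∀ {X Y : B.Obj} (f : κB.pc.Hom X Y),
      QD.castHom (robj X) (robj Y) (qD.map (w₂.fn.map f)) = r.map (qB.map f) :=
    fun f => map_congr hr f
  have rmap' : ∀ {X Y : B.Obj} (b : B.Hom X Y), QD.castHom (robj X) (robj Y)
      (qD.map (κD.inc.map (v₂.map b))) = r.map (qB.map (κB.inc.map b)) := by
    intro X Y b
    rw [← rmap]
    exact congrArg (fun z => QD.castHom (robj X) (robj Y) (qD.map z))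
      (w₂.map_inc _ _ b).symm
  have n3 : ∀ {X Y : B.Obj} (b : B.Hom X Y),
      QB.maxNorm (qB.map (κB.inc.map b)) ≤ QD.maxNorm (r.map (qB.map (κB.inc.map b))) := by
    intro X Y b
    rw [← rmap', maxNorm_castHom]
    exact (n1 b).trans ((hv.norm_le hBu hDu b).trans (n2 _))
  have n4 : ∀ {X Y : QB.Obj} (f : QB.Hom X Y), QB.maxNorm f ≤ QD.maxNorm (r.map f) := by
    intro X Y f
    obtain ⟨X, rfl⟩ := exB.p_quot.1.2 X
    obtain ⟨Y, rfl⟩ := exB.p_quot.1.2 Y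
    refine r.isometric_of_dense {f | ∃ b : B.Hom X Y, qB.map (κB.inc.map b) = f} ?_ ?_ f
    · intro f
      obtain ⟨f, rfl⟩ := exB.p_quot.2 _ _ f
      refine cl_lip (E := κB.pc) (E' := QB) (X := X) (Y := Y)
        (fun f => qB.map f) 1 ENNReal.one_ne_top (fun f s => ?_) ?_ (hκB.inc_dense f)
      · rw [← qB.map_sub, one_mul]; exact maxNorm_map_le _ _
      · rintro _ ⟨b, rfl⟩
        exact cl_self ⟨b, rfl⟩
    · rintro _ ⟨b, rfl⟩
      exact n3 b
  have hQBu : QB.IsUnital := exB.p_quot.isUnital hBc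
  have hQDu : QD.IsUnital := exD.p_quot.isUnital hDc
  have hru : r.Unital := by
    intro X e he
    obtain ⟨X, rfl⟩ := exB.p_quot.1.2 X
    obtain ⟨e1, he1⟩ := hBu X
    obtain ⟨e2, he2⟩ := hDu (v₂.obj X)
    have h1 : e = qB.map (κB.inc.map e1) :=
      he.unique (exB.p_quot.identity (hκB.inc_identity he1))
    rw [h1, ← rmap']
    apply castHom_isIdentity
    rw [killD' _ _ (hv.unit X e1 e2 he1 he2)]
    exact exD.p_quot.identity (hκD.inc_identity he2)
  refine ⟨hQBu, hQDu, hru, IsUnitaryEquiv.of_ff hQBu hru ?_ ?_ ?_⟩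
  · intro X Y f hf
    apply hQB.2.1
    have := n4 f
    rw [hf, maxNorm_zero] at this
    exact le_antisymm this bot_le
  · intro X Y d
    refine r.closed_image hQB hQD (fun f => n4 f) d ?_
    obtain ⟨X, rfl⟩ := exB.p_quot.1.2 X
    obtain ⟨Y, rfl⟩ := exB.p_quot.1.2 Y
    have hX : qD.obj (v₂.obj X) = r.obj (qB.obj X) := obj_congr hr X
    have hY : qD.obj (v₂.obj Y) = r.obj (qB.obj Y) := obj_congr hr Y
    obtain ⟨δ, hδ⟩ := exD.p_quot.2 (v₂.obj X) (v₂.obj Y) (QD.castHom hX.symm hY.symm d)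
    have hδ : d = QD.castHom hX hY (qD.map δ) := ((castHom_eq_iff _ _ _ _).2 hδ).symm
    rw [hδ]
    refine cl_lip (E := κD.pc) (E' := QD) (X := v₂.obj X) (Y := v₂.obj Y)
      (fun δ => QD.castHom hX hY (qD.map δ)) 1 ENNReal.one_ne_top (fun f s => ?_) ?_
      (hκD.inc_dense δ)
    · rw [← castHom_sub, maxNorm_castHom, ← qD.map_sub, one_mul]; exact maxNorm_map_le _ _
    · rintro _ ⟨d, rfl⟩
      apply cl_self
      obtain ⟨b, hb⟩ := hv.full d
      refine ⟨qB.map (κB.inc.map b), ?_⟩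
      rw [← rmap', killD' _ _ hb]
  · intro Y
    obtain ⟨Y, rfl⟩ := exD.p_quot.1.2 Y
    obtain ⟨X, u, h1, h2⟩ := hv.ess Y
    have hX : qD.obj (v₂.obj X) = r.obj (qB.obj X) := obj_congr hr X
    refine ⟨qB.obj X, QD.castHom hX rfl (qD.map (κD.inc.map u)), castHom_isUnitary _ _ _ ⟨?_, ?_⟩⟩
    · obtain ⟨e, he⟩ := hDu (v₂.obj X)
      have h3 := killD' _ _ (h1 e he)
      rw [← qD.map_star, ← qD.map_comp, ← κD.inc.map_star, ← κD.inc.map_comp, h3]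
      exact exD.p_quot.identity (hκD.inc_identity he)
    · obtain ⟨e, he⟩ := hDu Y
      have h3 := killD' _ _ (h2 e he)
      rw [← qD.map_star, ← qD.map_comp, ← κD.inc.map_star, ← κD.inc.map_comp, h3]
      exact exD.p_quot.identity (hκD.inc_identity he)

theorem core (hκA : IsCompletion A Ac κA) (hκB : IsCompletion B Bc κB)
    (hκC : IsCompletion C Cc κC) (hκD : IsCompletion D Dc κD)
    (hBu : B.IsUnital) (hDu : D.IsUnital) (comm : i₁.comp v₂ = v₁.comp i₂)
    (m₁ : ExtMap κA κB i₁) (w₁ : ExtMap κA κC v₁) (w₂ : ExtMap κB κD v₂) (m₂ : ExtMap κC κD i₂)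
    (JA : CIdeal B) (JC : CIdeal D)
    (hi₁ : Function.Bijective i₁.obj) (hi₂ : Function.Bijective i₂.obj)
    (himgA : ∀ {X Y : A.Obj} (u : B.Hom (i₁.obj X) (i₁.obj Y)), u ∈ JA.I _ _ ↔ ∃ a, i₁.map a = u)
    (himgC : ∀ {X Y : C.Obj} (u : D.Hom (i₂.obj X) (i₂.obj Y)), u ∈ JC.I _ _ ↔ ∃ a, i₂.map a = u)
    (hisoA : ∀ {X Y : A.Obj} (a : A.Hom X Y), A.maxNorm a ≤ B.maxNorm (i₁.map a))
    (hisoC : ∀ {X Y : C.Obj} (a : C.Hom X Y), C.maxNorm a ≤ D.maxNorm (i₂.map a))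
    (hv : ModEquiv v₂ JA JC) : IsExcisive m₁.fn w₁.fn w₂.fn m₂.fn where
  comm := core_comm hκA hκD comm m₁ w₁ w₂ m₂
  exB := ⟨_, _, (hκB.clIdeal JA).quot_isCStar hκB.pc_cstar (hκB.pc_unital hBu)
    (hκB.clIdeal_closed JA), m₁.exact hκA hκB JA himgA hisoA hi₁⟩
  exD := ⟨_, _, (hκD.clIdeal JC).quot_isCStar hκD.pc_cstar (hκD.pc_unital hDu)
    (hκD.clIdeal_closed JC), m₂.exact hκC hκD JC himgC hisoC hi₂⟩
  quot QB QD qB qD r hQB hQD exB exD hr := core_quot hκA hκB hκC hκD hBu hDu m₁ w₂ m₂ JA JC hi₁ hi₂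
    himgA himgC hisoC hv QB QD qB qD r hQB hQD exB exD hr

end Core

/-! ### Concrete inputs: crossed products -/

section Concrete
open StarCatNu hiding star_add star_smul star_star star_sub star_neg star
open StarFunctor hiding map_add map_smul map_neg map_sub map_zero map_star

variable {G : Type} [Group G] {C D : StarCatNu} {α : GAction G C} {β : GAction G D}
  {CG DG CGc DGc : StarCatNu}

namespace IsCrossedProductAlg

/-- The completion functor on the crossed product with the original objects. -/
@[reducible] def kap (hC : IsCrossedProductAlg G C α CG) (κ : StarFunctor CG CGc) :
    StarFunctor hC.cat CGc where
  obj X := κ.obj (hC.obj X)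
  map f := κ.map f
  map_add _ _ f f' := κ.map_add _ _ f f'
  map_smul _ _ c f := κ.map_smul _ _ c f
  map_comp _ _ _ g f := κ.map_comp _ _ _ g f
  map_star _ _ f := κ.map_star _ _ f

theorem kap_bij (hC : IsCrossedProductAlg G C α CG) {κ : StarFunctor CG CGc}
    (hκ : IsCompletion CG CGc κ) : Function.Bijective (hC.kap κ).obj :=
  hκ.obj_bij.comp hC.obj_bij

theorem kap_completion (hC : IsCrossedProductAlg G C α CG) {κ : StarFunctor CG CGc}
    (hκ : IsCompletion CG CGc κ) : IsCompletion hC.cat CGc (hC.kap κ) where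
  pre X Y f := (CG.pull_norm hC.obj hC.obj_bij (X := X) (Y := Y) f).trans_lt (hκ.pre _ _ _)
  cstar := hκ.cstar
  obj_bij := hC.kap_bij hκ
  isometric X Y f := (hκ.isometric _ _ f).trans
    (CG.pull_norm hC.obj hC.obj_bij (X := X) (Y := Y) f).symm
  dense X Y h ε hε := hκ.dense _ _ h ε hε

variable (hC : IsCrossedProductAlg G C α CG) (hD : IsCrossedProductAlg G D β DG)
  {φ : StarFunctor C D} (hφ : EquivariantMap α β φ)

/-- The functor between completed crossed products. -/
def ext {κC : StarFunctor CG CGc} {κD : StarFunctor DG DGc} {ψ : StarFunctor CGc DGc}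
    (h : IsCrossedMapC α β φ hφ hC hD κC κD ψ) :
    ExtMap (hC.kap κC) (hD.kap κD) (induced hC hD hφ) where
  map {X Y} f := DGc.castHom (h.obj_eq X) (h.obj_eq Y) (ψ.map f)
  map_add X Y f f' := (congrArg _ (ψ.map_add _ _ f f')).trans (castHom_add _ _ _ _)
  map_smul X Y c f := (congrArg _ (ψ.map_smul _ _ c f)).trans (castHom_smul _ _ _ _)
  map_comp X Y Z g f := (congrArg _ (ψ.map_comp _ _ _ g f)).trans (castHom_comp _ _ _ _ _)
  map_star X Y f := (congrArg _ (ψ.map_star _ _ f)).trans (castHom_star _ _ _)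
  map_inc X Y f := by
    show DGc.castHom (h.obj_eq X) (h.obj_eq Y) (ψ.map ((hC.kap κC).map f)) =
      (hD.kap κD).map ((induced hC hD hφ).map f)
    induction f using hC.ind with
    | h0 =>
      rw [StarFunctor.map_zero (induced hC hD hφ), StarFunctor.map_zero (hD.kap κD)]
      rw [StarFunctor.map_zero (hC.kap κC), StarFunctor.map_zero, castHom_zero]
    | hadd u u' hu hu' =>
      rw [StarFunctor.map_add (induced hC hD hφ), StarFunctor.map_add (hD.kap κD)]
      rw [StarFunctor.map_add (hC.kap κC), StarFunctor.map_add, castHom_add]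
      exact congrArg₂ _ hu hu'
    | hg g f =>
      refine (h.map_eq g X Y f).trans ?_
      exact congrArg (hD.kap κD).map (induced_gen hC hD hφ g f).symm

theorem ext_unpull {κC : StarFunctor CG CGc} {κD : StarFunctor DG DGc} {ψ : StarFunctor CGc DGc}
    (h : IsCrossedMapC α β φ hφ hC hD κC κD ψ) :
    (ext hC hD hφ h).fn.comp (DGc.unpull (hD.kap κD).obj) = (CGc.unpull (hC.kap κC).obj).comp ψ := by
  refine ext_cast (fun X => (h.obj_eq X).symm) (fun X Y f => ?_)
  exact castHom_castHom _ _ _ _ _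

/-- The crossed product of a unital category is unital. -/
theorem cat_unital (hu : C.IsUnital) : hC.cat.IsUnital := by
  intro X
  obtain ⟨e, he⟩ := hu X
  exact ⟨hC.emb.map e, hC.emb_identity he⟩

theorem good_gen (hs : IsCStar C) (hu : C.IsUnital) (g : G) {X Y : C.Obj}
    (f : C.Hom X (α.actObj g⁻¹ Y)) : hC.cat.Good (hC.gen g f) := by
  obtain ⟨e, he⟩ := hu X
  obtain ⟨c, γ, hc, hγ⟩ := EndAlg.exists_sqrt hs he (C.comp (C.star f) f)
    (by rw [C.star_comp, C.star_star])
  refine ⟨c, hC.emb.map γ, hc, fun W h => ?_⟩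
  have e1 : hC.cat.comp (hC.cat.star (hC.gen g f)) (hC.cat.comp (hC.gen g f) h) =
      hC.cat.comp (hC.emb.map (C.comp (C.star f) f)) h :=
    (hC.cat.comp_assoc _ _ _).symm.trans
      (congrArg (fun z => hC.cat.comp z h) (hC.star_gen_comp_gen g f))
  have e2 : C.comp (C.star f) f = (c : ℂ) • e - C.comp (C.star γ) γ := by
    rw [← hγ]; abel
  have e3 : (hC.emb.map (C.comp (C.star f) f) : hC.cat.Hom X X) =
      (c : ℂ) • hC.emb.map e - hC.cat.comp (hC.cat.star (hC.emb.map γ)) (hC.emb.map γ) := by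
    rw [e2, StarFunctor.map_sub, StarFunctor.map_smul, StarFunctor.map_comp, StarFunctor.map_star]
  refine e1.trans ?_
  refine (congrArg (fun z => hC.cat.comp z h) e3).trans ?_
  refine (hC.cat.sub_comp _ _ _).trans ?_
  refine congrArg₂ _ ?_ (hC.cat.comp_assoc _ _ _)
  refine (hC.cat.smul_comp _ _ _).trans ?_
  exact congrArg _ ((hC.emb_identity he).2 _ h)

theorem ind_good (hs : IsCStar C) (hu : C.IsUnital) {Z W : hC.cat.Obj}
    {P : hC.cat.Hom Z W → Prop} (h0 : P 0) (hadd : ∀ u u', P u → P u' → P (u + u'))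
    (hg : ∀ u, hC.cat.Good u → P u) (u : hC.cat.Hom Z W) : P u :=
  hC.ind h0 hadd (fun g f => hg _ (hC.good_gen hs hu g f)) u

end IsCrossedProductAlg

open IsCrossedProductAlg

/-- The kernel is invariant. -/
theorem ker_invariant {Q : StarCatNu} {i : StarFunctor C D} {q : StarFunctor D Q}
    (hi : EquivariantMap α β i) (h : IsExactSeq i q) (g : G) {X Y : D.Obj} (f : D.Hom X Y)
    (hf : f ∈ (CIdeal.ker q).I X Y) :
    β.actMap g f ∈ (CIdeal.ker q).I (β.actObj g X) (β.actObj g Y) := by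
  obtain ⟨X, rfl⟩ := h.i_obj_bij.2 X
  obtain ⟨Y, rfl⟩ := h.i_obj_bij.2 Y
  obtain ⟨a, rfl⟩ := (h.exact X Y f).1 hf
  rw [← hi.map_comm, ideal_castHom]
  exact (h.exact _ _ _).2 ⟨_, rfl⟩

section Img
variable (hC : IsCrossedProductAlg G C α CG) (hD : IsCrossedProductAlg G D β DG)
  {Q : StarCatNu} {i : StarFunctor C D} {q : StarFunctor D Q}
  (hi : EquivariantMap α β i) (h : IsExactSeq i q)

theorem induced_img {X Y : C.Obj} (u : hD.cat.Hom (i.obj X) (i.obj Y)) :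
    u ∈ (hD.ideal (CIdeal.ker q) (ker_invariant hi h)).I (i.obj X) (i.obj Y) ↔
      ∃ a : hC.cat.Hom X Y, (induced hC hD hi).map a = u := by
  constructor
  · intro hu
    refine hD.ideal_ind (CIdeal.ker q)
      (P := fun u => ∃ a : hC.cat.Hom X Y, (induced hC hD hi).map a = u) ?_ ?_ ?_ u hu
    · exact ⟨0, StarFunctor.map_zero _ _ _⟩
    · rintro _ _ ⟨a, rfl⟩ ⟨a', rfl⟩
      exact ⟨a + a', StarFunctor.map_add _ _ _ _ _⟩
    · intro g f hf
      have hf' : D.castHom rfl (hi.obj_comm g⁻¹ Y).symm f ∈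
          (CIdeal.ker q).I (i.obj X) (i.obj (α.actObj g⁻¹ Y)) := by
        rw [ideal_castHom]; exact hf
      obtain ⟨a, ha⟩ := (h.exact _ _ _).1 hf'
      refine ⟨hC.gen g a, (induced_gen hC hD hi g a).trans ?_⟩
      rw [ha, castHom_castHom, castHom_rfl]
  · rintro ⟨a, rfl⟩
    refine (hD.mem_idealSub _ _).2 fun g => ?_
    refine (coef_induced hC hD hi g a).symm ▸ ?_
    rw [ideal_castHom]
    exact (h.exact _ _ _).2 ⟨_, rfl⟩

theorem induced_inj (h : IsExactSeq i q) {X Y : C.Obj} (u : hC.cat.Hom X Y) (hu : (induced hC hD hi).map u = 0) :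
    u = 0 := by
  refine hC.ext_coef fun g => ?_
  have h1 := coef_induced hC hD hi g u
  rw [hu] at h1
  have h2 : i.map (hC.coef g X Y u) = 0 := by
    have h3 : D.castHom rfl (hi.obj_comm g⁻¹ Y) (i.map (hC.coef g X Y u)) = 0 :=
      h1.symm.trans (map_zero (hD.coef g (i.obj X) (i.obj Y)))
    have h4 := congrArg (D.castHom rfl (hi.obj_comm g⁻¹ Y).symm) h3
    rwa [castHom_castHom, castHom_rfl, castHom_zero] at h4
  rw [map_zero]
  apply h.i_map_inj
  show i.map _ = i.map 0
  rw [h2, StarFunctor.map_zero]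

theorem induced_iso (h : IsExactSeq i q) (hs : IsCStar D) (hu : D.IsUnital) {X Y : C.Obj} (a : hC.cat.Hom X Y) :
    hC.cat.maxNorm a ≤ hD.cat.maxNorm ((induced hC hD hi).map a) :=
  norm_le_of_ideal (induced hC hD hi) (hD.ideal (CIdeal.ker q) (ker_invariant hi h))
    h.i_obj_bij.2 (fun f hf => induced_inj hC hD hi h f hf)
    (fun u => induced_img hC hD hi h u)
    (fun h0 hadd hg u => hD.ind_good hs hu h0 hadd hg u) a

end Img

/-- Lifting equivalences modulo ideals to crossed products. -/
theorem ModEquiv.lift (hC : IsCrossedProductAlg G C α CG) (hD : IsCrossedProductAlg G D β DG)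
    {v : StarFunctor C D} (hv : EquivariantMap α β v) {I : CIdeal C} {J : CIdeal D}
    (hI : ∀ (g : G) {X Y : C.Obj} (f : C.Hom X Y), f ∈ I.I X Y →
      α.actMap g f ∈ I.I (α.actObj g X) (α.actObj g Y))
    (hJ : ∀ (g : G) {X Y : D.Obj} (f : D.Hom X Y), f ∈ J.I X Y →
      β.actMap g f ∈ J.I (β.actObj g X) (β.actObj g Y))
    (hCu : C.IsUnital) (hDu : D.IsUnital)
    (h : ModEquiv v I J) : ModEquiv (induced hC hD hv) (hC.ideal I hI) (hD.ideal J hJ) := by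
  have embJ : ∀ {X Y : D.Obj} (f : D.Hom X Y), f ∈ J.I X Y →
      hD.emb.map f ∈ (hD.ideal J hJ).I X Y := by
    intro X Y f hf
    refine hD.gen_mem_idealSub J 1 _ ?_
    rw [ideal_castHom]; exact hf
  have idD : ∀ {X : D.Obj} (e : hD.cat.Hom X X), IsIdentityAt hD.cat e →
      ∃ e' : D.Hom X X, IsIdentityAt D e' ∧ hD.emb.map e' = e := by
    intro X e he
    obtain ⟨e', he'⟩ := hDu X
    exact ⟨e', he', (hD.emb_identity he').unique he⟩
  have idC : ∀ {X : C.Obj} (e : hC.cat.Hom X X), IsIdentityAt hC.cat e →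
      ∃ e' : C.Hom X X, IsIdentityAt C e' ∧ hC.emb.map e' = e := by
    intro X e he
    obtain ⟨e', he'⟩ := hCu X
    exact ⟨e', he', (hC.emb_identity he').unique he⟩
  refine ⟨?_, ?_, ?_, ?_⟩
  · intro X Y d
    refine hD.ind (X := v.obj X) (Y := v.obj Y)
      (P := fun d => ∃ b : hC.cat.Hom X Y, (induced hC hD hv).map b - d ∈
        hD.idealSub J (v.obj X) (v.obj Y)) ?_ ?_ ?_ d
    · refine ⟨0, ?_⟩
      rw [StarFunctor.map_zero]
      exact (sub_zero (0 : hD.cat.Hom (v.obj X) (v.obj Y))).symm ▸ zero_mem _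
    · rintro u u' ⟨b, hb⟩ ⟨b', hb'⟩
      refine ⟨b + b', ?_⟩
      have := add_mem hb hb'
      rw [← add_sub_add_comm] at this
      rw [StarFunctor.map_add]
      exact this
    · intro g f
      obtain ⟨b, hb⟩ := h.full (X := X) (Y := α.actObj g⁻¹ Y)
        (D.castHom rfl (hv.obj_comm g⁻¹ Y).symm f)
      refine ⟨hC.gen g b, ?_⟩
      have e1 : hD.gen g (D.castHom rfl (hv.obj_comm g⁻¹ Y) (v.map b) - f) =
          (induced hC hD hv).map (hC.gen g b) - hD.gen g f := by
        refine ((hD.genL g (v.obj X) (v.obj Y)).map_sub _ _).trans ?_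
        exact congrArg (fun z : hD.cat.Hom (v.obj X) (v.obj Y) => z - hD.gen g f)
          (induced_gen hC hD hv g b).symm
      rw [← e1]
      apply gen_mem_idealSub
      rw [← ideal_castHom J rfl (hv.obj_comm g⁻¹ Y), castHom_sub, castHom_castHom, castHom_rfl] at hb
      exact hb
  · intro X Y b
    refine (hD.mem_idealSub J _).trans (Iff.trans ?_ (hC.mem_idealSub I b).symm)
    refine forall_congr' fun g => ?_
    rw [← h.mem_iff, ← ideal_castHom J rfl (hv.obj_comm g⁻¹ Y)]
    exact (coef_induced hC hD hv g b) ▸ Iff.rfl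
  · intro Y
    obtain ⟨X, u, h1, h2⟩ := h.ess Y
    refine ⟨X, hD.emb.map u, ?_, ?_⟩
    · intro e he
      obtain ⟨e', he', rfl⟩ := idD (X := v.obj X) e he
      have := embJ _ (h1 e' he')
      rw [StarFunctor.map_sub, StarFunctor.map_comp, StarFunctor.map_star] at this
      exact this
    · intro e he
      obtain ⟨e', he', rfl⟩ := idD (X := Y) e he
      have := embJ _ (h2 e' he')
      rw [StarFunctor.map_sub, StarFunctor.map_comp, StarFunctor.map_star] at this
      exact this
  · intro X e e' he he'
    obtain ⟨e, he0, rfl⟩ := idC e he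
    obtain ⟨e', he0', rfl⟩ := idD (X := v.obj X) e' he'
    have := embJ _ (h.unit X e e' he0 he0')
    rw [StarFunctor.map_sub] at this
    exact (congrArg (fun z : hD.cat.Hom (v.obj X) (v.obj X) => z - hD.emb.map e')
      (induced_emb hC hD hv e)) ▸ this

end Concrete

/-! ### Assembling -/

section Assemble
open StarCatNu hiding star_add star_smul star_star star_sub star_neg star
open StarFunctor hiding map_add map_smul map_neg map_sub map_zero map_star
open IsCrossedProductAlg

theorem IsExcisive.modEquiv {A B C D QB QD : StarCatNu} {i₁ : StarFunctor A B}
    {v₁ : StarFunctor A C} {v₂ : StarFunctor B D} {i₂ : StarFunctor C D}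
    (hex : IsExcisive i₁ v₁ v₂ i₂) (hB : IsCStar B) (hD : IsCStar D)
    (hBu : B.IsUnital) (hDu : D.IsUnital)
    {qB : StarFunctor B QB} {qD : StarFunctor D QD} (hQB : IsCStar QB) (hQD : IsCStar QD)
    (exB : IsExactSeq i₁ qB) (exD : IsExactSeq i₂ qD) :
    ModEquiv v₂ (CIdeal.ker qB) (CIdeal.ker qD) := by
  set I := CIdeal.ker qB with hI
  set J := CIdeal.ker qD with hJ
  have hIJ : ∀ {X Y : B.Obj} (f : B.Hom X Y), f ∈ I.I X Y →
      v₂.map f ∈ J.I (v₂.obj X) (v₂.obj Y) := by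
    intro X Y f hf
    obtain ⟨X, rfl⟩ := exB.i_obj_bij.2 X
    obtain ⟨Y, rfl⟩ := exB.i_obj_bij.2 Y
    obtain ⟨a, rfl⟩ := (exB.exact X Y f).1 hf
    have hX : v₂.obj (i₁.obj X) = i₂.obj (v₁.obj X) := obj_congr hex.comm X
    have hY : v₂.obj (i₁.obj Y) = i₂.obj (v₁.obj Y) := obj_congr hex.comm Y
    have h1 : D.castHom hX hY (v₂.map (i₁.map a)) = i₂.map (v₁.map a) := map_congr hex.comm a
    rw [← ideal_castHom J hX hY, h1]
    exact (exD.exact _ _ _).2 ⟨_, rfl⟩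
  let r : StarFunctor I.quot J.quot := I.desc (v₂.comp J.proj) (by
    intro X Y f hf
    exact (J.proj_eq_zero _).2 (hIJ f hf))
  obtain ⟨h1, h2, h3, h4⟩ := hex.quot I.quot J.quot I.proj J.proj r
    (I.quot_isCStar hB hBu (CIdeal.ker_closed hQB qB))
    (J.quot_isCStar hD hDu (CIdeal.ker_closed hQD qD))
    (CIdeal.exact_proj_ker exB) (CIdeal.exact_proj_ker exD) rfl
  refine ⟨?_, ?_, ?_, ?_⟩
  · intro X Y d
    obtain ⟨b, hb⟩ := h4.full (X := X) (Y := Y) (J.proj.map d)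
    obtain ⟨b, rfl⟩ := I.proj_surj b
    exact ⟨b, (J.proj_eq (v₂.map b) d).1 hb⟩
  · intro X Y b
    refine ⟨fun hb => ?_, hIJ b⟩
    refine (I.proj_eq_zero b).1 (h4.faithful (X := X) (Y := Y) (I.proj.map b) ?_)
    exact (J.proj_eq_zero (v₂.map b)).2 hb
  · intro Y
    obtain ⟨X, u, hu⟩ := h4.essSurj Y
    obtain ⟨u, rfl⟩ := J.proj_surj (X := v₂.obj X) (Y := Y) u
    refine ⟨X, u, fun e he => ?_, fun e he => ?_⟩
    · have k1 : IsIdentityAt J.quot (X := v₂.obj X) (J.proj.map e) := J.proj_quot.identity he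
      refine (J.proj_eq _ _).1 (Eq.trans ?_ (IsIdentityAt.unique hu.1 k1))
      exact (J.proj.map_comp _ _ _ _ _).trans
        (congrArg (fun z => J.quot.comp z (J.proj.map u)) (J.proj.map_star _ _ u))
    · have k1 : IsIdentityAt J.quot (X := Y) (J.proj.map e) := J.proj_quot.identity he
      refine (J.proj_eq _ _).1 (Eq.trans ?_ (IsIdentityAt.unique hu.2 k1))
      exact (J.proj.map_comp _ _ _ _ _).trans
        (congrArg (fun z => J.quot.comp (J.proj.map u) z) (J.proj.map_star _ _ u))
  · intro X e e' he he'
    have k1 : IsIdentityAt J.quot (X := v₂.obj X) (J.proj.map e') := J.proj_quot.identity he'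
    have k2 : IsIdentityAt I.quot (X := X) (I.proj.map e) := I.proj_quot.identity he
    have k3 : IsIdentityAt J.quot (X := v₂.obj X) (J.proj.map (v₂.map e)) := h3 X _ k2
    exact (J.proj_eq _ _).1 (k3.unique k1)

variable {G : Type} [Group G]

theorem IsCrossedProductAlg.castHom_gen {D DG : StarCatNu} {β : GAction G D}
    (hD : IsCrossedProductAlg G D β DG) {X X' Y Y' : D.Obj} (hX : X = X') (hY : Y = Y') (g : G)
    (f : D.Hom X (β.actObj g⁻¹ Y)) : hD.cat.castHom hX hY (hD.gen g f) =
      hD.gen g (D.castHom hX (congrArg (β.actObj g⁻¹) hY) f) := by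
  subst hX hY; rfl

theorem induced_comm {A B C D AG BG CG DG : StarCatNu} {i₁ : StarFunctor A B}
    {v₁ : StarFunctor A C} {v₂ : StarFunctor B D} {i₂ : StarFunctor C D}
    {αA : GAction G A} {αB : GAction G B} {αC : GAction G C} {αD : GAction G D}
    (hi₁ : EquivariantMap αA αB i₁) (hv₁ : EquivariantMap αA αC v₁)
    (hv₂ : EquivariantMap αB αD v₂) (hi₂ : EquivariantMap αC αD i₂)
    (hAG : IsCrossedProductAlg G A αA AG) (hBG : IsCrossedProductAlg G B αB BG)
    (hCG : IsCrossedProductAlg G C αC CG) (hDG : IsCrossedProductAlg G D αD DG)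
    (comm : i₁.comp v₂ = v₁.comp i₂) :
    (induced hAG hBG hi₁).comp (induced hBG hDG hv₂) =
      (induced hAG hCG hv₁).comp (induced hCG hDG hi₂) := by
  refine ext_cast (fun X => obj_congr comm X) (fun X Y u => ?_)
  have hX : v₂.obj (i₁.obj X) = i₂.obj (v₁.obj X) := obj_congr comm X
  have hY : v₂.obj (i₁.obj Y) = i₂.obj (v₁.obj Y) := obj_congr comm Y
  show hDG.cat.castHom hX hY ((induced hBG hDG hv₂).map ((induced hAG hBG hi₁).map u)) =
    (induced hCG hDG hi₂).map ((induced hAG hCG hv₁).map u)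
  induction u using hAG.ind with
  | h0 =>
    rw [StarFunctor.map_zero (induced hAG hBG hi₁), StarFunctor.map_zero (induced hBG hDG hv₂),
      StarFunctor.map_zero (induced hAG hCG hv₁), StarFunctor.map_zero (induced hCG hDG hi₂)]
    exact castHom_zero _ _
  | hadd u u' h h' =>
    refine Eq.trans ?_ ((congrArg₂ (· + ·) h h').trans ?_)
    · rw [StarFunctor.map_add (induced hAG hBG hi₁), StarFunctor.map_add (induced hBG hDG hv₂)]
      exact castHom_add _ _ _ _
    · rw [StarFunctor.map_add (induced hAG hCG hv₁), StarFunctor.map_add (induced hCG hDG hi₂)]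
  | hg g f =>
    refine (congrArg (fun z => hDG.cat.castHom hX hY ((induced hBG hDG hv₂).map z))
      (induced_gen hAG hBG hi₁ g f)).trans ?_
    refine (congrArg (fun z => hDG.cat.castHom hX hY z)
      (induced_gen hBG hDG hv₂ g _)).trans ?_
    refine Eq.trans ?_ (congrArg (fun z => (induced hCG hDG hi₂).map z)
      (induced_gen hAG hCG hv₁ g f)).symm
    refine Eq.trans ?_ (induced_gen hCG hDG hi₂ g _).symm
    refine (hDG.castHom_gen hX hY g _).trans (hDG.gen_congr rfl ?_)
    refine (castHom_heq _ _ _).trans ((castHom_heq _ _ _).trans ?_)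
    refine HEq.trans ?_ (castHom_heq _ _ _).symm
    refine HEq.trans (v₂.map_heq rfl (hi₁.obj_comm g⁻¹ Y).symm (castHom_heq _ _ _)) ?_
    refine HEq.trans ?_ (i₂.map_heq rfl (hv₁.obj_comm g⁻¹ Y).symm (castHom_heq _ _ _)).symm
    have e : D.castHom _ _ (v₂.map (i₁.map f)) = i₂.map (v₁.map f) := map_congr comm f
    exact (castHom_heq _ _ _).symm.trans (heq_of_eq e)

end Assemble

/-- If a commutative square in `Fun(BG, C*Cat^nu)` with top arrow
`A → B` and bottom arrow `C → D` is excisive and moreover `B` and `D` are unital, then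
the induced square with corners `A ⋊ G`, `B ⋊ G`, `C ⋊ G`, `D ⋊ G` is an excisive square
in `C*Cat^nu`. -/
theorem crossed_product_preserves_excisive_squares
    (G : Type) [Group G] (A B C D : StarCatNu)
    (hA : IsCStar A) (hB : IsCStar B) (hC : IsCStar C) (hD : IsCStar D)
    (αA : GAction G A) (αB : GAction G B) (αC : GAction G C) (αD : GAction G D)
    (i₁ : StarFunctor A B) (v₁ : StarFunctor A C)
    (v₂ : StarFunctor B D) (i₂ : StarFunctor C D)
    (hi₁ : EquivariantMap αA αB i₁) (hv₁ : EquivariantMap αA αC v₁)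
    (hv₂ : EquivariantMap αB αD v₂) (hi₂ : EquivariantMap αC αD i₂)
    (hex : IsExcisive i₁ v₁ v₂ i₂) (hBu : B.IsUnital) (hDu : D.IsUnital)
    -- realizations of the four completed crossed products
    (AG BG CG DG AGc BGc CGc DGc : StarCatNu)
    (hAG : IsCrossedProductAlg G A αA AG) (hBG : IsCrossedProductAlg G B αB BG)
    (hCG : IsCrossedProductAlg G C αC CG) (hDG : IsCrossedProductAlg G D αD DG)
    (κA : StarFunctor AG AGc) (κB : StarFunctor BG BGc)
    (κC : StarFunctor CG CGc) (κD : StarFunctor DG DGc)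
    (hκA : IsCompletion AG AGc κA) (hκB : IsCompletion BG BGc κB)
    (hκC : IsCompletion CG CGc κC) (hκD : IsCompletion DG DGc κD)
    -- the induced square of completed crossed products
    (i₁G : StarFunctor AGc BGc) (v₁G : StarFunctor AGc CGc)
    (v₂G : StarFunctor BGc DGc) (i₂G : StarFunctor CGc DGc)
    (hi₁G : IsCrossedMapC αA αB i₁ hi₁ hAG hBG κA κB i₁G)
    (hv₁G : IsCrossedMapC αA αC v₁ hv₁ hAG hCG κA κC v₁G)
    (hv₂G : IsCrossedMapC αB αD v₂ hv₂ hBG hDG κB κD v₂G)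
    (hi₂G : IsCrossedMapC αC αD i₂ hi₂ hCG hDG κC κD i₂G) :
    IsExcisive i₁G v₁G v₂G i₂G := by
  obtain ⟨QB, qB, hQB, exB⟩ := hex.exB
  obtain ⟨QD, qD, hQD, exD⟩ := hex.exD
  have hmod := (hex.modEquiv hB hD hBu hDu hQB hQD exB exD).lift hBG hDG hv₂
    (ker_invariant hi₁ exB) (ker_invariant hi₂ exD) hBu hDu
  have key := core (hAG.kap_completion hκA) (hBG.kap_completion hκB) (hCG.kap_completion hκC)
    (hDG.kap_completion hκD) (hBG.cat_unital hBu) (hDG.cat_unital hDu)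
    (induced_comm hi₁ hv₁ hv₂ hi₂ hAG hBG hCG hDG hex.comm)
    (IsCrossedProductAlg.ext hAG hBG hi₁ hi₁G) (IsCrossedProductAlg.ext hAG hCG hv₁ hv₁G)
    (IsCrossedProductAlg.ext hBG hDG hv₂ hv₂G) (IsCrossedProductAlg.ext hCG hDG hi₂ hi₂G)
    _ _ exB.i_obj_bij exD.i_obj_bij
    (fun u => induced_img hAG hBG hi₁ exB u) (fun u => induced_img hCG hDG hi₂ exD u)
    (fun a => induced_iso hAG hBG hi₁ exB hB hBu a)
    (fun a => induced_iso hCG hDG hi₂ exD hD hDu a) hmod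
  exact key.transport
    (AGc.unpull_isIso _ (hAG.kap_bij hκA)) (BGc.unpull_isIso _ (hBG.kap_bij hκB))
    (CGc.unpull_isIso _ (hCG.kap_bij hκC)) (DGc.unpull_isIso _ (hDG.kap_bij hκD))
    (IsCrossedProductAlg.ext_unpull hAG hBG hi₁ hi₁G)
    (IsCrossedProductAlg.ext_unpull hAG hCG hv₁ hv₁G)
    (IsCrossedProductAlg.ext_unpull hBG hDG hv₂ hv₂G)
    (IsCrossedProductAlg.ext_unpull hCG hDG hi₂ hi₂G)
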